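/- Let K be a number field, R an order in K, and G a finite nonabelian group. If the group of units RG* of the group ring RG is virtually a direct product of finitely many free-by-free groups, then either K is totally real, or K is an imaginary quadratic extension of ℚ and every noncommutative simple quotient of the group algebra KG is isomorphic to M₂(F) for some field F. -/

import Mathlib

/-- An order in a finite-dimensional `ℚ`-algebra `A`: a subring that is finitely
generated as a `ℤ`-module and whose `ℚ`-span is all of `A`. -/
def IsOrderIn {A : Type} [Ring A] [Algebra ℚ A] (S : Subring A) : Prop :=
  S.toAddSubgroup.FG ∧ Submodule.span ℚ (S : Set A) = ⊤

/-- A group is free-by-free if it has a (normal) subgroup which is free, namely the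
kernel of a surjection onto a free group, with free quotient. -/
def IsFreeByFree (Γ : Type) [Group Γ] : Prop :=
  ∃ (Y : Type) (φ : Γ →* FreeGroup Y), Function.Surjective φ ∧
    ∃ X : Type, Nonempty (↥φ.ker ≃* FreeGroup X)

/-- A group is virtually a direct product of finitely many free-by-free groups if
it has a finite-index subgroup isomorphic to a finite direct product of
free-by-free groups. -/
def IsVirtuallyDirectProductOfFreeByFree (Γ : Type) [Group Γ] : Prop :=
  ∃ H : Subgroup Γ, H.FiniteIndex ∧
    ∃ (m : ℕ) (P : Fin m → Type) (inst : ∀ i, Group (P i)),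
      haveI := inst
      (∀ i, IsFreeByFree (P i)) ∧ Nonempty (↥H ≃* ∀ i, P i)


namespace FbF

/-- indicator that the labels 0,1,2 all occur -/
def psi3 (a b c : Fin 4) : ZMod 2 :=
  if (∀ i : Fin 4, i ≤ 2 → (a = i ∨ b = i ∨ c = i)) then 1 else 0

/-- indicator of rainbow -/
def phi4 (a b c d : Fin 4) : ZMod 2 :=
  if (∀ i : Fin 4, (a = i ∨ b = i ∨ c = i ∨ d = i)) then 1 else 0

/-- indicator that the labels 0,1 both occur -/
def chi2 (a b : Fin 4) : ZMod 2 :=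
  if (∀ i : Fin 4, i ≤ 1 → (a = i ∨ b = i)) then 1 else 0

def one0 (a : Fin 4) : ZMod 2 := if a = 0 then 1 else 0

theorem phi4_eq : ∀ a b c d : Fin 4,
    phi4 a b c d = psi3 b c d + psi3 a c d + psi3 a b d + psi3 a b c := by decide

theorem psi3_eq : ∀ a b c : Fin 4, a ≤ 2 → b ≤ 2 → c ≤ 2 →
    psi3 a b c = chi2 b c + chi2 a c + chi2 a b := by decide

theorem chi2_eq : ∀ a b : Fin 4, a ≤ 1 → b ≤ 1 → chi2 a b = one0 a + one0 b := by decide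

theorem psi3_zero : ∀ i : Fin 4, i ≤ 2 → ∀ a b c : Fin 4, a ≠ i → b ≠ i → c ≠ i →
    psi3 a b c = 0 := by decide

theorem chi2_zero : ∀ i : Fin 4, i ≤ 1 → ∀ a b : Fin 4, a ≠ i → b ≠ i →
    chi2 a b = 0 := by decide

theorem phi4_rainbow : ∀ a b c d : Fin 4, phi4 a b c d ≠ 0 →
    a ≠ b ∧ a ≠ c ∧ a ≠ d ∧ b ≠ c ∧ b ≠ d ∧ c ≠ d := by decide

theorem tele2 (f : ℕ → ZMod 2) (n : ℕ) :
    ∑ x ∈ Finset.range n, (f (x + 1) + f x) = f n + f 0 := by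
  induction n with
  | zero => simp [CharTwo.add_self_eq_zero]
  | succ n ih =>
    rw [Finset.sum_range_succ, ih]
    have := CharTwo.add_self_eq_zero (f n)
    linear_combination this

/-- sum of the two triangles of a unit square -/
def sq3 (g : ℕ → ℕ → Fin 4) (x y : ℕ) : ZMod 2 :=
  psi3 (g x y) (g (x+1) y) (g (x+1) (y+1)) + psi3 (g x y) (g x (y+1)) (g (x+1) (y+1))

/-- sum of the six tetrahedra of a unit cube -/
def cu4 (g : ℕ → ℕ → ℕ → Fin 4) (x y z : ℕ) : ZMod 2 :=
  phi4 (g x y z) (g (x+1) y z) (g (x+1) (y+1) z) (g (x+1) (y+1) (z+1)) +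
  phi4 (g x y z) (g (x+1) y z) (g (x+1) y (z+1)) (g (x+1) (y+1) (z+1)) +
  phi4 (g x y z) (g x (y+1) z) (g (x+1) (y+1) z) (g (x+1) (y+1) (z+1)) +
  phi4 (g x y z) (g x (y+1) z) (g x (y+1) (z+1)) (g (x+1) (y+1) (z+1)) +
  phi4 (g x y z) (g x y (z+1)) (g (x+1) y (z+1)) (g (x+1) (y+1) (z+1)) +
  phi4 (g x y z) (g x y (z+1)) (g x (y+1) (z+1)) (g (x+1) (y+1) (z+1))

theorem cu4_eq (g : ℕ → ℕ → ℕ → Fin 4) (x y z : ℕ) :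
    cu4 g x y z =
      (sq3 (fun y z => g (x+1) y z) y z + sq3 (fun y z => g x y z) y z) +
      (sq3 (fun x z => g x (y+1) z) x z + sq3 (fun x z => g x y z) x z) +
      (sq3 (fun x y => g x y (z+1)) x y + sq3 (fun x y => g x y z) x y) := by
  have h2 : (2 : ZMod 2) = 0 := by decide
  simp only [cu4, sq3, phi4_eq]
  linear_combination (
    psi3 (g x y z) (g (x+1) (y+1) z) (g (x+1) (y+1) (z+1)) +
    psi3 (g x y z) (g (x+1) y (z+1)) (g (x+1) (y+1) (z+1)) +
    psi3 (g x y z) (g x (y+1) (z+1)) (g (x+1) (y+1) (z+1)) +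
    psi3 (g x y z) (g (x+1) y z) (g (x+1) (y+1) (z+1)) +
    psi3 (g x y z) (g x (y+1) z) (g (x+1) (y+1) (z+1)) +
    psi3 (g x y z) (g x y (z+1)) (g (x+1) (y+1) (z+1))) * h2

theorem sq3_eq (g : ℕ → ℕ → Fin 4) (x y : ℕ) (h : ∀ a b, a ≤ 1 → b ≤ 1 → g (x + a) (y + b) ≤ 2) :
    sq3 g x y = (chi2 (g (x+1) y) (g (x+1) (y+1)) + chi2 (g x y) (g x (y+1))) +
      (chi2 (g x (y+1)) (g (x+1) (y+1)) + chi2 (g x y) (g (x+1) y)) := by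
  have h2 : (2 : ZMod 2) = 0 := by decide
  have h00 := h 0 0 (by norm_num) (by norm_num)
  have h01 := h 0 1 (by norm_num) (by norm_num)
  have h10 := h 1 0 (by norm_num) (by norm_num)
  have h11 := h 1 1 (by norm_num) (by norm_num)
  simp only [add_zero] at h00 h01 h10 h11
  rw [sq3, psi3_eq _ _ _ h00 h10 h11, psi3_eq _ _ _ h00 h01 h11]
  linear_combination (chi2 (g x y) (g (x+1) (y+1))) * h2

theorem sq3_zero (i : Fin 4) (hi : i ≤ 2) (g : ℕ → ℕ → Fin 4) (x y : ℕ)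
    (h : ∀ a b, a ≤ 1 → b ≤ 1 → g (x + a) (y + b) ≠ i) : sq3 g x y = 0 := by
  have h00 := h 0 0 (by norm_num) (by norm_num)
  have h01 := h 0 1 (by norm_num) (by norm_num)
  have h10 := h 1 0 (by norm_num) (by norm_num)
  have h11 := h 1 1 (by norm_num) (by norm_num)
  simp only [add_zero] at h00 h01 h10 h11
  rw [sq3, psi3_zero i hi _ _ _ h00 h10 h11, psi3_zero i hi _ _ _ h00 h01 h11, add_zero]

theorem sperner (g : ℕ → ℕ → ℕ → Fin 4) (n0 n1 n2 : ℕ)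
    (l0 : ∀ y z, y ≤ n1 → z ≤ n2 → g 0 y z ≠ 0)
    (l1 : ∀ x z, x ≤ n0 → z ≤ n2 → g x 0 z ≠ 1)
    (l2 : ∀ x y, x ≤ n0 → y ≤ n1 → g x y 0 ≠ 2)
    (t0 : ∀ y z, y ≤ n1 → z ≤ n2 → g n0 y z ≤ 0)
    (t1 : ∀ x z, x ≤ n0 → z ≤ n2 → g x n1 z ≤ 1)
    (t2 : ∀ x y, x ≤ n0 → y ≤ n1 → g x y n2 ≤ 2) :
    ∃ x y z, x < n0 ∧ y < n1 ∧ z < n2 ∧ cu4 g x y z ≠ 0 := by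
  by_contra hcon
  push Not at hcon
  have key : ∑ x ∈ Finset.range n0, ∑ y ∈ Finset.range n1, ∑ z ∈ Finset.range n2,
      cu4 g x y z = 0 := by
    refine Finset.sum_eq_zero fun x hx => Finset.sum_eq_zero fun y hy => Finset.sum_eq_zero
      fun z hz => ?_
    simp only [Finset.mem_range] at hx hy hz
    exact hcon x y z hx hy hz
  have ne1 : ∀ a : Fin 4, a ≤ 0 → a ≠ 1 := by decide
  have ne2 : ∀ a : Fin 4, a ≤ 1 → a ≠ 2 := by decide
  have A : ∑ x ∈ Finset.range n0, ∑ y ∈ Finset.range n1, ∑ z ∈ Finset.range n2,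
      (sq3 (fun y z => g (x+1) y z) y z + sq3 (fun y z => g x y z) y z) = 0 := by
    have : ∀ x, ∑ y ∈ Finset.range n1, ∑ z ∈ Finset.range n2,
      (sq3 (fun y z => g (x+1) y z) y z + sq3 (fun y z => g x y z) y z)
       = (fun x => ∑ y ∈ Finset.range n1, ∑ z ∈ Finset.range n2,
          sq3 (fun y z => g x y z) y z) (x+1) + (fun x => ∑ y ∈ Finset.range n1,
          ∑ z ∈ Finset.range n2, sq3 (fun y z => g x y z) y z) x := by
      intro x; simp only [Finset.sum_add_distrib]
    refine (Finset.sum_congr rfl fun x _ => this x).trans ((tele2 (fun x =>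
      ∑ y ∈ Finset.range n1, ∑ z ∈ Finset.range n2, sq3 (fun y z => g x y z) y z) n0).trans ?_)
    have e1 : ∑ y ∈ Finset.range n1, ∑ z ∈ Finset.range n2,
          sq3 (fun y z => g n0 y z) y z = 0 := by
      refine Finset.sum_eq_zero fun y hy => Finset.sum_eq_zero fun z hz => ?_
      simp only [Finset.mem_range] at hy hz
      exact sq3_zero 1 (by decide) _ _ _ fun a b ha hb => ne1 _ (t0 _ _ (by omega) (by omega))
    have e2 : ∑ y ∈ Finset.range n1, ∑ z ∈ Finset.range n2,
          sq3 (fun y z => g 0 y z) y z = 0 := by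
      refine Finset.sum_eq_zero fun y hy => Finset.sum_eq_zero fun z hz => ?_
      simp only [Finset.mem_range] at hy hz
      exact sq3_zero 0 (by decide) _ _ _ fun a b ha hb => (l0 _ _ (by omega) (by omega))
    simp only [e1, e2, add_zero]
  have B : ∑ x ∈ Finset.range n0, ∑ y ∈ Finset.range n1, ∑ z ∈ Finset.range n2,
      (sq3 (fun x z => g x (y+1) z) x z + sq3 (fun x z => g x y z) x z) = 0 := by
    rw [Finset.sum_comm]
    have : ∀ y, ∑ x ∈ Finset.range n0, ∑ z ∈ Finset.range n2,
      (sq3 (fun x z => g x (y+1) z) x z + sq3 (fun x z => g x y z) x z)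
       = (fun y => ∑ x ∈ Finset.range n0, ∑ z ∈ Finset.range n2,
          sq3 (fun x z => g x y z) x z) (y+1) + (fun y => ∑ x ∈ Finset.range n0,
          ∑ z ∈ Finset.range n2, sq3 (fun x z => g x y z) x z) y := by
      intro x; simp only [Finset.sum_add_distrib]
    refine (Finset.sum_congr rfl fun x _ => this x).trans ((tele2 (fun y =>
      ∑ x ∈ Finset.range n0, ∑ z ∈ Finset.range n2, sq3 (fun x z => g x y z) x z) n1).trans ?_)
    have e1 : ∑ x ∈ Finset.range n0, ∑ z ∈ Finset.range n2,
          sq3 (fun x z => g x n1 z) x z = 0 := by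
      refine Finset.sum_eq_zero fun y hy => Finset.sum_eq_zero fun z hz => ?_
      simp only [Finset.mem_range] at hy hz
      exact sq3_zero 2 (by decide) _ _ _ fun a b ha hb => ne2 _ (t1 _ _ (by omega) (by omega))
    have e2 : ∑ x ∈ Finset.range n0, ∑ z ∈ Finset.range n2,
          sq3 (fun x z => g x 0 z) x z = 0 := by
      refine Finset.sum_eq_zero fun y hy => Finset.sum_eq_zero fun z hz => ?_
      simp only [Finset.mem_range] at hy hz
      exact sq3_zero 1 (by decide) _ _ _ fun a b ha hb => (l1 _ _ (by omega) (by omega))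
    simp only [e1, e2, add_zero]
  have C : ∑ x ∈ Finset.range n0, ∑ y ∈ Finset.range n1, ∑ z ∈ Finset.range n2,
      (sq3 (fun x y => g x y (z+1)) x y + sq3 (fun x y => g x y z) x y) =
      ∑ x ∈ Finset.range n0, ∑ y ∈ Finset.range n1, sq3 (fun x y => g x y n2) x y := by
    refine Finset.sum_congr rfl fun x hx => Finset.sum_congr rfl fun y hy => ?_
    rw [tele2 (fun z => sq3 (fun x y => g x y z) x y)]
    simp only [Finset.mem_range] at hx hy
    rw [sq3_zero 2 (by decide) (fun x y => g x y 0)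
      _ _ fun a b ha hb => (l2 _ _ (by omega) (by omega)), add_zero]
  simp only [cu4_eq, Finset.sum_add_distrib] at key A B C
  rw [A, B, C, zero_add, zero_add] at key
  have key2 : ∑ x ∈ Finset.range n0, ∑ y ∈ Finset.range n1,
      ((chi2 (g (x+1) y n2) (g (x+1) (y+1) n2) + chi2 (g x y n2) (g x (y+1) n2)) +
      (chi2 (g x (y+1) n2) (g (x+1) (y+1) n2) + chi2 (g x y n2) (g (x+1) y n2))) = 0 := by
    rw [← key]
    refine Finset.sum_congr rfl fun x hx => Finset.sum_congr rfl fun y hy => ?_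
    simp only [Finset.mem_range] at hx hy
    rw [sq3_eq _ _ _ fun a b ha hb => t2 _ _ (by omega) (by omega)]
  have A2 : ∑ x ∈ Finset.range n0, ∑ y ∈ Finset.range n1,
      (chi2 (g (x+1) y n2) (g (x+1) (y+1) n2) + chi2 (g x y n2) (g x (y+1) n2)) = 0 := by
    rw [Finset.sum_comm]
    refine Finset.sum_eq_zero fun y hy => ?_
    simp only [Finset.mem_range] at hy
    rw [tele2 (fun x => chi2 (g x y n2) (g x (y+1) n2))]
    rw [chi2_zero 1 (by decide) _ _ (ne1 _ (t0 y n2 (by omega) le_rfl))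
      (ne1 _ (t0 (y+1) n2 (by omega) le_rfl)),
      chi2_zero 0 (by decide) _ _ (l0 y n2 (by omega) le_rfl) (l0 (y+1) n2 (by omega) le_rfl),
      add_zero]
  have B2 : ∑ x ∈ Finset.range n0, ∑ y ∈ Finset.range n1,
      (chi2 (g x (y+1) n2) (g (x+1) (y+1) n2) + chi2 (g x y n2) (g (x+1) y n2)) = 1 := by
    have : ∀ x ∈ Finset.range n0, ∑ y ∈ Finset.range n1,
      (chi2 (g x (y+1) n2) (g (x+1) (y+1) n2) + chi2 (g x y n2) (g (x+1) y n2)) =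
        one0 (g (x+1) n1 n2) + one0 (g x n1 n2) := by
      intro x hx
      simp only [Finset.mem_range] at hx
      rw [tele2 (fun y => chi2 (g x y n2) (g (x+1) y n2))]
      rw [chi2_zero 1 (by decide) _ _ (l1 x n2 (by omega) le_rfl) (l1 (x+1) n2 (by omega) le_rfl),
        add_zero, chi2_eq _ _ (t1 x n2 (by omega) le_rfl) (t1 (x+1) n2 (by omega) le_rfl),
        add_comm]
    rw [Finset.sum_congr rfl this, tele2 (fun x => one0 (g x n1 n2))]
    have h1 : g n0 n1 n2 = 0 := by
      have := t0 n1 n2 le_rfl le_rfl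
      simpa using this
    have h2 := l0 n1 n2 le_rfl le_rfl
    simp [one0, h1, h2]
  simp only [Finset.sum_add_distrib] at key2 A2 B2
  rw [A2, B2] at key2
  revert key2; decide

/-- The cube lemma. -/
theorem cube_lemma {X : Type*} (c : X → Fin 3) (Adj : X → X → Prop) (hs : ∀ x y, Adj x y → Adj y x)
    (F : ℕ → ℕ → ℕ → X) (n0 n1 n2 : ℕ)
    (hF : ∀ x y z x' y' z', x ≤ x' → x' ≤ x + 1 → y ≤ y' → y' ≤ y + 1 → z ≤ z' → z' ≤ z + 1 →
      x' ≤ n0 → y' ≤ n1 → z' ≤ n2 → Adj (F x y z) (F x' y' z')) :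
    (∃ y z y' z', y ≤ n1 ∧ z ≤ n2 ∧ y' ≤ n1 ∧ z' ≤ n2 ∧
      Relation.ReflTransGen (fun p q => Adj p q ∧ c p = c q) (F 0 y z) (F n0 y' z')) ∨
    (∃ x z x' z', x ≤ n0 ∧ z ≤ n2 ∧ x' ≤ n0 ∧ z' ≤ n2 ∧
      Relation.ReflTransGen (fun p q => Adj p q ∧ c p = c q) (F x 0 z) (F x' n1 z')) ∨
    (∃ x y x' y', x ≤ n0 ∧ y ≤ n1 ∧ x' ≤ n0 ∧ y' ≤ n1 ∧
      Relation.ReflTransGen (fun p q => Adj p q ∧ c p = c q) (F x y 0) (F x' y' n2)) := by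
  classical
  by_contra hcon
  simp only [not_or] at hcon
  obtain ⟨k0, k1, k2⟩ := hcon
  set r : X → X → Prop := fun p q => Adj p q ∧ c p = c q with hr
  have rs : ∀ p q, r p q → r q p := fun p q h => ⟨hs _ _ h.1, h.2.symm⟩
  let Q0 : X → Prop := fun p => ∃ y z, y ≤ n1 ∧ z ≤ n2 ∧ Relation.ReflTransGen r (F 0 y z) p
  let Q1 : X → Prop := fun p => ∃ x z, x ≤ n0 ∧ z ≤ n2 ∧ Relation.ReflTransGen r (F x 0 z) p
  let Q2 : X → Prop := fun p => ∃ x y, x ≤ n0 ∧ y ≤ n1 ∧ Relation.ReflTransGen r (F x y 0) p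
  have Q0m : ∀ p q, r p q → Q0 p → Q0 q := fun p q h ⟨y, z, hy, hz, hh⟩ => ⟨y, z, hy, hz, hh.tail h⟩
  have Q1m : ∀ p q, r p q → Q1 p → Q1 q := fun p q h ⟨y, z, hy, hz, hh⟩ => ⟨y, z, hy, hz, hh.tail h⟩
  have Q2m : ∀ p q, r p q → Q2 p → Q2 q := fun p q h ⟨y, z, hy, hz, hh⟩ => ⟨y, z, hy, hz, hh.tail h⟩
  let lab : X → Fin 4 := fun p => if ¬ Q0 p then 0 else if ¬ Q1 p then 1 else if ¬ Q2 p then 2 else 3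
  have labm : ∀ p q, r p q → lab p = lab q := by
    intro p q h
    have e0 : Q0 p ↔ Q0 q := ⟨Q0m _ _ h, Q0m _ _ (rs _ _ h)⟩
    have e1 : Q1 p ↔ Q1 q := ⟨Q1m _ _ h, Q1m _ _ (rs _ _ h)⟩
    have e2 : Q2 p ↔ Q2 q := ⟨Q2m _ _ h, Q2m _ _ (rs _ _ h)⟩
    simp only [lab, e0, e1, e2]
  have d : ∀ p, (Q0 p → lab p ≠ 0) ∧ (Q1 p → lab p ≠ 1) ∧ (Q2 p → lab p ≠ 2) ∧
      (¬ Q0 p → lab p ≤ 0) ∧ (¬ Q1 p → lab p ≤ 1) ∧ (¬ Q2 p → lab p ≤ 2) := by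
    intro p
    by_cases h0 : Q0 p <;> by_cases h1 : Q1 p <;> by_cases h2 : Q2 p <;>
      simp [lab, h0, h1, h2]
  obtain ⟨x, y, z, hx, hy, hz, hne⟩ := sperner (fun x y z => lab (F x y z)) n0 n1 n2
    (fun y z hy hz => (d _).1 ⟨y, z, hy, hz, .refl⟩)
    (fun y z hy hz => (d _).2.1 ⟨y, z, hy, hz, .refl⟩)
    (fun y z hy hz => (d _).2.2.1 ⟨y, z, hy, hz, .refl⟩)
    (fun y z hy hz => (d _).2.2.2.1 fun ⟨a, b, ha, hb, h⟩ => k0 ⟨a, b, y, z, ha, hb, hy, hz, h⟩)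
    (fun y z hy hz => (d _).2.2.2.2.1 fun ⟨a, b, ha, hb, h⟩ => k1 ⟨a, b, y, z, ha, hb, hy, hz, h⟩)
    (fun y z hy hz => (d _).2.2.2.2.2 fun ⟨a, b, ha, hb, h⟩ => k2 ⟨a, b, y, z, ha, hb, hy, hz, h⟩)
  have pig : ∀ a b c d : Fin 3, a = b ∨ a = c ∨ a = d ∨ b = c ∨ b = d ∨ c = d := by decide
  have nr : ∀ a b e f : X, Adj a b → Adj a e → Adj a f → Adj b e → Adj b f → Adj e f →
      phi4 (lab a) (lab b) (lab e) (lab f) = 0 := by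
    intro a b e f h1 h2 h3 h4 h5 h6
    by_contra hh
    obtain ⟨g1, g2, g3, g4, g5, g6⟩ := phi4_rainbow _ _ _ _ hh
    rcases pig (c a) (c b) (c e) (c f) with h | h | h | h | h | h
    · exact g1 (labm _ _ ⟨h1, h⟩)
    · exact g2 (labm _ _ ⟨h2, h⟩)
    · exact g3 (labm _ _ ⟨h3, h⟩)
    · exact g4 (labm _ _ ⟨h4, h⟩)
    · exact g5 (labm _ _ ⟨h5, h⟩)
    · exact g6 (labm _ _ ⟨h6, h⟩)
  apply hne
  simp only [cu4]
  have cell : ∀ x1 y1 z1 x2 y2 z2, x ≤ x1 → x1 ≤ x2 → x2 ≤ x+1 → y ≤ y1 → y1 ≤ y2 → y2 ≤ y+1 →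
      z ≤ z1 → z1 ≤ z2 → z2 ≤ z+1 → Adj (F x1 y1 z1) (F x2 y2 z2) := by
    intros
    apply hF <;> omega
  rw [nr, nr, nr, nr, nr, nr]
  · simp
  all_goals (apply cell <;> omega)

end FbF

namespace FbF
open Relation Pointwise

/-- asymptotic dimension at most `k - 1`, in colouring form -/
def AD (k : ℕ) (P : Type*) [Group P] : Prop :=
  ∀ S : Set P, S.Finite → ∃ c : P → Fin k, ∃ B : Set P, B.Finite ∧
    ∀ x y, ReflTransGen (fun a b => a⁻¹ * b ∈ S ∧ c a = c b) x y → x⁻¹ * y ∈ B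

theorem AD_of_equiv {k : ℕ} {P Q : Type*} [Group P] [Group Q] (e : P ≃* Q) (h : AD k Q) :
    AD k P := by
  intro S hS
  obtain ⟨c, B, hB, hc⟩ := h (e '' S) (hS.image _)
  refine ⟨fun x => c (e x), e.symm '' B, hB.image _, fun x y hxy => ?_⟩
  refine ⟨(e x)⁻¹ * e y, hc _ _ ?_, by simp⟩
  refine hxy.lift e fun a b hab => ⟨⟨_, hab.1, by simp⟩, hab.2⟩

section Free
variable {Y : Type}

open Classical in
noncomputable def VV (g : FreeGroup Y) : List (Y × Bool) := (g⁻¹).toWord.reverse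

open Classical in
noncomputable def nn (g : FreeGroup Y) : ℕ := g.norm

theorem VV_length (g : FreeGroup Y) : (VV g).length = nn g := by
  classical
  unfold VV nn
  rw [List.length_reverse, ← FreeGroup.norm_inv_eq]
  unfold FreeGroup.norm
  congr!

open Classical in
theorem toWord_letter_mul (a : Y × Bool) (g : FreeGroup Y) :
    (FreeGroup.mk [a] * g).toWord = a :: g.toWord ∨
      ∃ b, g.toWord = b :: (FreeGroup.mk [a] * g).toWord := by
  have h : (FreeGroup.mk [a] * g).toWord = FreeGroup.reduce (a :: g.toWord) := by
    conv_lhs => rw [← FreeGroup.mk_toWord (x := g)]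
    rw [FreeGroup.mul_mk, FreeGroup.toWord_mk, List.singleton_append]
  rw [h, FreeGroup.reduce.cons, FreeGroup.reduce_toWord]
  cases hg : g.toWord with
  | nil => left; rfl
  | cons b t =>
    simp only
    split_ifs
    · right; exact ⟨b, rfl⟩
    · left; rfl

theorem VV_letter (g : FreeGroup Y) (a : Y × Bool) (k : ℕ) (hk : k + 1 ≤ nn g) :
    (VV (g * FreeGroup.mk [a])).take k = (VV g).take k ∧ nn g ≤ nn (g * FreeGroup.mk [a]) + 1 := by
  classical
  rw [← VV_length] at *
  rw [← VV_length]
  have h : VV (g * FreeGroup.mk [a]) = (FreeGroup.mk [(a.1, !a.2)] * g⁻¹).toWord.reverse := by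
    unfold VV
    rw [mul_inv_rev, FreeGroup.inv_mk]
    rfl
  rw [h]
  have h2 : VV g = (g⁻¹).toWord.reverse := by unfold VV; congr!
  rw [h2] at hk ⊢
  rcases toWord_letter_mul (a.1, !a.2) g⁻¹ with h | ⟨b, h⟩
  · rw [show (FreeGroup.mk [(a.1, !a.2)] * g⁻¹).toWord = _ by convert h]
    constructor
    · rw [List.reverse_cons, List.take_append_of_le_length (by omega)]
    · simp; omega
  · have h' : (g⁻¹).toWord = b :: (FreeGroup.mk [(a.1, !a.2)] * g⁻¹).toWord := by convert h
    constructor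
    · rw [h', List.reverse_cons, List.take_append_of_le_length]
      have := congrArg List.length h'
      simp at this hk ⊢
      omega
    · rw [h']; simp

theorem VV_word (u : List (Y × Bool)) : ∀ (g : FreeGroup Y) (k : ℕ) (_ : k + u.length ≤ nn g),
    (VV (g * FreeGroup.mk u)).take k = (VV g).take k := by
  induction u with
  | nil => intro g k _; rw [← FreeGroup.one_eq_mk, mul_one]
  | cons a u ih =>
    intro g k hk
    have : FreeGroup.mk (a :: u) = FreeGroup.mk [a] * FreeGroup.mk u := by
      rw [FreeGroup.mul_mk]; rfl
    simp only [List.length_cons] at hk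
    obtain ⟨h1, h2⟩ := VV_letter g a k (by omega)
    rw [this, ← mul_assoc, ih _ _ (by omega), h1]

theorem VV_step (x y : FreeGroup Y) (k w : ℕ) (hw : nn (x⁻¹ * y) ≤ w) (hk : k + w ≤ nn x) :
    (VV x).take k = (VV y).take k := by
  classical
  have h := VV_word ((x⁻¹ * y).toWord) x k (by
    have : (x⁻¹ * y).toWord.length = nn (x⁻¹ * y) := by
      unfold nn FreeGroup.norm; congr!
    omega)
  rw [FreeGroup.mk_toWord] at h
  rw [← h]; simp

theorem nn_mul (x y : FreeGroup Y) : nn (x * y) ≤ nn x + nn y := by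
  classical
  exact FreeGroup.norm_mul_le x y

theorem nn_inv (x : FreeGroup Y) : nn x⁻¹ = nn x := by
  classical
  exact FreeGroup.norm_inv_eq

theorem nn_step (x y : FreeGroup Y) (w : ℕ) (hw : nn (x⁻¹ * y) ≤ w) :
    nn y ≤ nn x + w ∧ nn x ≤ nn y + w := by
  constructor
  · have := nn_mul x (x⁻¹ * y)
    rw [mul_inv_cancel_left] at this; omega
  · have := nn_mul y (x⁻¹ * y)⁻¹
    rw [nn_inv] at this
    simp at this; omega

theorem nn_pre (x y : FreeGroup Y) (k M : ℕ) (h : (VV x).take k = (VV y).take k)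
    (hx : nn x ≤ k + M) (hy : nn y ≤ k + M) : nn (x⁻¹ * y) ≤ 2 * M := by
  classical
  have key : ∀ x : FreeGroup Y, x⁻¹ = FreeGroup.mk ((VV x).drop k).reverse *
      FreeGroup.mk ((VV x).take k).reverse := by
    intro x
    rw [FreeGroup.mul_mk, ← List.reverse_append, List.take_append_drop]
    unfold VV
    rw [List.reverse_reverse]
    exact FreeGroup.mk_toWord.symm
  have e : x⁻¹ * y = FreeGroup.mk ((VV x).drop k).reverse *
      (FreeGroup.mk ((VV y).drop k).reverse)⁻¹ := by
    have hy := key y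
    have hy2 : y = (FreeGroup.mk ((VV y).take k).reverse)⁻¹ *
      (FreeGroup.mk ((VV y).drop k).reverse)⁻¹ := by
      rw [← mul_inv_rev, ← hy, inv_inv]
    calc x⁻¹ * y = x⁻¹ * ((FreeGroup.mk ((VV y).take k).reverse)⁻¹ *
          (FreeGroup.mk ((VV y).drop k).reverse)⁻¹) := by rw [← hy2]
      _ = _ := by rw [key x, h]; group
  have b : ∀ x : FreeGroup Y, nn x ≤ k + M → nn (FreeGroup.mk ((VV x).drop k).reverse) ≤ M := by
    intro x hx
    refine le_trans FreeGroup.norm_mk_le ?_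
    rw [List.length_reverse, List.length_drop, VV_length]; omega
  rw [e]
  refine (nn_mul _ _).trans ?_
  rw [nn_inv]
  have := b x hx
  have := b y hy
  omega

theorem finite_ball (S : Set (FreeGroup Y)) (hS : S.Finite) (M : ℕ) :
    {g | g ∈ Subgroup.closure S ∧ nn g ≤ M}.Finite := by
  classical
  -- the letters
  let A : Set Y := ⋃ s ∈ S, {a | a ∈ (s.toWord.map Prod.fst)}
  have hA : A.Finite := hS.biUnion fun s _ => List.finite_toSet _
  have : Finite A := hA
  let r : FreeGroup Y →* FreeGroup A := FreeGroup.lift fun y => if h : y ∈ A then FreeGroup.of ⟨y, h⟩ else 1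
  let i : FreeGroup A →* FreeGroup Y := FreeGroup.map Subtype.val
  have hr : ∀ g ∈ Subgroup.closure S, i (r g) = g := by
    have : Subgroup.closure S ≤ (i.comp r).eqLocus (MonoidHom.id _) := by
      rw [Subgroup.closure_le]
      intro s hs
      have : ∀ l : List (Y × Bool), (∀ a ∈ l, a.1 ∈ A) → i (r (FreeGroup.mk l)) = FreeGroup.mk l := by
        intro l
        induction l with
        | nil => intro _; rw [← FreeGroup.one_eq_mk]; simp
        | cons a l ih =>
          intro h
          have e : FreeGroup.mk (a :: l) = FreeGroup.mk [a] * FreeGroup.mk l := by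
            rw [FreeGroup.mul_mk]; rfl
          rw [e, map_mul, map_mul, ih fun b hb => h b (List.mem_cons_of_mem _ hb)]
          congr 1
          have ha := h a List.mem_cons_self
          obtain ⟨a, b⟩ := a
          cases b <;> simp [r, i, ha] <;> rfl
      change i (r s) = s
      rw [← FreeGroup.mk_toWord (x := s)]
      apply this
      intro a ha
      simp only [A, Set.mem_iUnion]
      exact ⟨s, hs, List.mem_map_of_mem ha⟩
    exact fun g hg => this hg
  have hl : ∀ l : List (Y × Bool), ∃ l' : List (A × Bool), l'.length ≤ l.length ∧
      r (FreeGroup.mk l) = FreeGroup.mk l' := by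
    intro l
    induction l with
    | nil => exact ⟨[], le_rfl, by rw [← FreeGroup.one_eq_mk, map_one]; rfl⟩
    | cons a l ih =>
      obtain ⟨l', h1, h2⟩ := ih
      have e : FreeGroup.mk (a :: l) = FreeGroup.mk [a] * FreeGroup.mk l := by
        rw [FreeGroup.mul_mk]; rfl
      obtain ⟨a, b⟩ := a
      by_cases ha : a ∈ A
      · refine ⟨(⟨a, ha⟩, b) :: l', by simpa using h1, ?_⟩
        have e' : FreeGroup.mk ((⟨a, ha⟩, b) :: l') = FreeGroup.mk [((⟨a, ha⟩ : A), b)] * FreeGroup.mk l' := by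
          rw [FreeGroup.mul_mk]; rfl
        rw [e, e', map_mul, h2]
        congr 1
        cases b <;> simp [r, ha] <;> rfl
      · refine ⟨l', by simp; omega, ?_⟩
        rw [e, map_mul, h2]
        cases b <;> simp [r, ha]
  have fin : ((fun l => i (FreeGroup.mk l)) '' {l : List (A × Bool) | l.length ≤ M}).Finite :=
    (List.finite_length_le _ _).image _
  refine fin.subset ?_
  rintro g ⟨hg, hn⟩
  obtain ⟨l', h1, h2⟩ := hl g.toWord
  refine ⟨l', h1.trans ?_, ?_⟩
  · refine le_trans (le_of_eq ?_) hn
    unfold nn FreeGroup.norm; congr!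
  · simp only
    rw [← h2, FreeGroup.mk_toWord, hr g hg]

theorem exists_w (S : Set (FreeGroup Y)) (hS : S.Finite) : ∃ w, 1 ≤ w ∧ ∀ s ∈ S, nn s ≤ w := by
  obtain ⟨w, hw⟩ := (hS.image nn).bddAbove
  exact ⟨w + 1, by omega, fun s hs => (hw ⟨s, hs, rfl⟩).trans (by omega)⟩

theorem div_step {w a b : ℕ} (hw : 1 ≤ w) (h1 : b ≤ a + w) : b / w ≤ a / w + 1 := by
  rw [← Nat.add_div_right _ (by omega)]
  exact Nat.div_le_div_right h1

theorem AD_free : AD 2 (FreeGroup Y) := by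
  intro S hS
  obtain ⟨w, hw1, hw⟩ := exists_w S hS
  refine ⟨fun x => ⟨(nn x / w) % 2, Nat.mod_lt _ (by norm_num)⟩,
    {g | g ∈ Subgroup.closure S ∧ nn g ≤ 2 * (2 * w)}, finite_ball S hS _, fun x y hxy => ?_⟩
  have key : nn x / w = nn y / w ∧ (VV x).take ((nn x / w - 1) * w) = (VV y).take ((nn x / w - 1) * w)
      ∧ x⁻¹ * y ∈ Subgroup.closure S := by
    induction hxy with
    | refl => exact ⟨rfl, rfl, by simp⟩
    | @tail b c _ h ih =>
      obtain ⟨e1, e2, e3⟩ := ih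
      obtain ⟨hs, hc⟩ := h
      have hn := hw _ hs
      have hst := nn_step _ _ _ hn
      have d1 := div_step hw1 hst.1
      have d2 := div_step hw1 hst.2
      have hc' : (nn b / w) % 2 = (nn c / w) % 2 := by simpa using hc
      refine ⟨by omega, ?_, ?_⟩
      · rw [e2, e1]
        rcases Nat.eq_zero_or_pos (nn b / w) with h0 | h0
        · simp [h0]
        · refine VV_step _ _ _ w hn ?_
          have : (nn b / w - 1) * w + w = (nn b / w) * w := by
            rw [← Nat.succ_mul, Nat.succ_eq_add_one, Nat.sub_add_cancel h0]
          rw [this]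
          exact Nat.div_mul_le_self _ _
      · have := mul_mem e3 (Subgroup.subset_closure hs)
        simpa [mul_assoc] using this
  obtain ⟨e1, e2, e3⟩ := key
  refine ⟨e3, nn_pre _ _ _ _ e2 ?_ ?_⟩
  · have := Nat.lt_div_mul_add (a := nn x) (b := w) (by omega)
    have : (nn x / w) * w ≤ (nn x / w - 1) * w + w := by
      rw [← Nat.succ_mul]; exact Nat.mul_le_mul_right _ (by omega)
    omega
  · have := Nat.lt_div_mul_add (a := nn y) (b := w) (by omega)
    have : (nn x / w) * w ≤ (nn x / w - 1) * w + w := by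
      rw [← Nat.succ_mul]; exact Nat.mul_le_mul_right _ (by omega)
    rw [e1] at *
    omega

end Free
end FbF

namespace FbF
open Relation Pointwise

theorem union_lemma {P : Type*} [Group P] (r : P → P → Prop) (T : P → Prop) (S DX DY : Set P)
    (hS : ∀ a b, r a b → a⁻¹ * b ∈ S)
    (hX : ∀ x y, ReflTransGen (fun a b => r a b ∧ ¬ T a ∧ ¬ T b) x y → x⁻¹ * y ∈ DX)
    (hY : ∀ x y, ReflTransGen (fun a b => T a ∧ T b ∧ a⁻¹ * b ∈ S ∪ S * DX * S ∧
      ReflTransGen r a b) x y → x⁻¹ * y ∈ DY) :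
    ∀ x y, ReflTransGen r x y → x⁻¹ * y ∈ DX ∪ ({1} ∪ DX * S) * DY * ({1} ∪ S * DX) := by
  intro x y hxy
  set rX : P → P → Prop := fun a b => r a b ∧ ¬ T a ∧ ¬ T b with hrX
  set rY : P → P → Prop := fun a b => T a ∧ T b ∧ a⁻¹ * b ∈ S ∪ S * DX * S ∧
      ReflTransGen r a b with hrY
  have rXr : ∀ a b, ReflTransGen rX a b → ReflTransGen r a b :=
    fun a b h => h.lift id fun a b h => h.1
  have key : (¬ T y ∧ ReflTransGen rX x y) ∨ ∃ u v, T u ∧ T v ∧ (x = u ∨ x⁻¹ * u ∈ DX * S) ∧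
      ReflTransGen rY u v ∧ ((T y ∧ v = y) ∨ (¬ T y ∧ ∃ z, ¬ T z ∧ r v z ∧ ReflTransGen rX z y)) := by
    induction hxy with
    | refl =>
      by_cases hx : T x
      · right; exact ⟨x, x, hx, hx, .inl rfl, .refl, .inl ⟨hx, rfl⟩⟩
      · left; exact ⟨hx, .refl⟩
    | @tail b c hb h ih =>
      rcases ih with ⟨hTb, h1⟩ | ⟨u, v, hu, hv, hxu, huv, h2⟩
      · by_cases hc : T c
        · right
          refine ⟨c, c, hc, hc, .inr ?_, .refl, .inl ⟨hc, rfl⟩⟩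
          refine Set.mem_mul.2 ⟨_, hX _ _ h1, _, hS _ _ h, by group⟩
        · left; exact ⟨hc, h1.tail ⟨h, hTb, hc⟩⟩
      · right
        rcases h2 with ⟨hTb, rfl⟩ | ⟨hTb, z, hz, hvz, hzb⟩
        · by_cases hc : T c
          · exact ⟨u, c, hu, hc, hxu, huv.tail ⟨hv, hc, .inl (hS _ _ h), .single h⟩, .inl ⟨hc, rfl⟩⟩
          · exact ⟨u, v, hu, hv, hxu, huv, .inr ⟨hc, c, hc, h, .refl⟩⟩
        · by_cases hc : T c
          · refine ⟨u, c, hu, hc, hxu, huv.tail ⟨hv, hc, .inr ?_, ?_⟩, .inl ⟨hc, rfl⟩⟩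
            · refine Set.mem_mul.2 ⟨v⁻¹ * b, Set.mem_mul.2 ⟨_, hS _ _ hvz, _, hX _ _ hzb, by group⟩,
                _, hS _ _ h, by group⟩
            · exact ((ReflTransGen.single hvz).trans (rXr _ _ hzb)).tail h
          · exact ⟨u, v, hu, hv, hxu, huv, .inr ⟨hc, z, hz, hvz, hzb.tail ⟨h, hTb, hc⟩⟩⟩
  rcases key with ⟨_, h⟩ | ⟨u, v, hu, hv, hxu, huv, h2⟩
  · exact .inl (hX _ _ h)
  · right
    refine Set.mem_mul.2 ⟨x⁻¹ * v, Set.mem_mul.2 ⟨x⁻¹ * u, ?_, u⁻¹ * v, hY _ _ huv, by group⟩,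
      v⁻¹ * y, ?_, by group⟩
    · rcases hxu with rfl | h
      · left; simp
      · right; exact h
    · rcases h2 with ⟨_, rfl⟩ | ⟨_, z, hz, hvz, hzy⟩
      · left; simp
      · right; exact Set.mem_mul.2 ⟨_, hS _ _ hvz, _, hX _ _ hzy, by group⟩

/-- colourings along a label whose classes are at bounded distance from a coset of the kernel -/
theorem label_colour {P : Type*} [Group P] {Y : Type} (φ : P →* FreeGroup Y)
    (hφ : Function.Surjective φ) (hN : AD 2 φ.ker) {Λ : Type*} (lam : P → Λ)
    (Φ : Set (FreeGroup Y)) (hΦ : Φ.Finite)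
    (hlam : ∀ x y, lam x = lam y → φ (x⁻¹ * y) ∈ Φ) (S : Set P) (hS : S.Finite) :
    ∃ c : P → Fin 2, ∃ D : Set P, D.Finite ∧ ∀ x y,
      ReflTransGen (fun a b => a⁻¹ * b ∈ S ∧ lam a = lam b ∧ c a = c b) x y → x⁻¹ * y ∈ D := by
  classical
  choose t ht using hφ
  have hr : ∃ ref : Λ → P, ∀ x, lam (ref (lam x)) = lam x := by
    refine ⟨fun l => if h : ∃ x, lam x = l then h.choose else 1, fun x => ?_⟩
    have h : ∃ y, lam y = lam x := ⟨x, rfl⟩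
    simp only [h, dif_pos]
    exact h.choose_spec
  obtain ⟨ref, hr⟩ := hr
  let τ : P → P := fun x => t (φ ((ref (lam x))⁻¹ * x))
  have hτ : ∀ x, τ x ∈ t '' Φ := fun x => ⟨_, hlam _ _ (hr x), rfl⟩
  let n : P → φ.ker := fun x => ⟨(ref (lam x))⁻¹ * x * (τ x)⁻¹, by
    rw [MonoidHom.mem_ker, map_mul, map_inv, ht]; simp⟩
  let T : Set P := t '' Φ
  have hT : T.Finite := hΦ.image _
  obtain ⟨c, B, hB, hc⟩ := hN (Subtype.val ⁻¹' (T * S * T⁻¹))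
    ((((hT.mul hS).mul hT.inv)).preimage Subtype.val_injective.injOn)
  refine ⟨fun x => c (n x), T⁻¹ * (Subtype.val '' B) * T, (hT.inv.mul (hB.image _)).mul hT, ?_⟩
  intro x y hxy
  have h1 : lam x = lam y := by
    induction hxy with
    | refl => rfl
    | tail _ h ih => rw [ih, h.2.1]
  have h2 : ReflTransGen (fun a b => a⁻¹ * b ∈ (Subtype.val ⁻¹' (T * S * T⁻¹) : Set φ.ker) ∧
      c a = c b) (n x) (n y) := by
    refine hxy.lift n fun a b h => ⟨?_, h.2.2⟩
    refine Set.mem_mul.2 ⟨τ a * (a⁻¹ * b), Set.mem_mul.2 ⟨_, hτ a, _, h.1, rfl⟩, (τ b)⁻¹,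
      Set.inv_mem_inv.2 (hτ b), ?_⟩
    simp only [n, Subgroup.coe_mul, Subgroup.coe_inv, h.2.1]
    group
  refine Set.mem_mul.2 ⟨(τ x)⁻¹ * ((n x)⁻¹ * n y : φ.ker), Set.mem_mul.2 ⟨_,
    Set.inv_mem_inv.2 (hτ x), _, ⟨_, hc _ _ h2, rfl⟩, rfl⟩, τ y, hτ y, ?_⟩
  simp only [n, Subgroup.coe_mul, Subgroup.coe_inv, h1]
  group

theorem AD_ext {P : Type*} [Group P] {Y : Type} (φ : P →* FreeGroup Y)
    (hφ : Function.Surjective φ) (hN : AD 2 φ.ker) : AD 3 P := by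
  intro S hS
  obtain ⟨w, hw1, hw⟩ := exists_w (φ '' S) (hS.image _)
  let i : P → ℕ := fun x => nn (φ x) / w
  let lam : P → ℕ × List (Y × Bool) × (P ⧸ Subgroup.closure S) :=
    fun x => (i x, (VV (φ x)).take ((i x - 2) * w), QuotientGroup.mk x)
  have hΦ := finite_ball (φ '' S) (hS.image _) (2 * (3 * w))
  have hlam : ∀ x y, lam x = lam y →
      φ (x⁻¹ * y) ∈ {g | g ∈ Subgroup.closure (φ '' S) ∧ nn g ≤ 2 * (3 * w)} := by
    intro x y h
    simp only [lam, Prod.mk.injEq] at h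
    obtain ⟨h1, h2, h3⟩ := h
    constructor
    · rw [← MonoidHom.map_closure]
      exact Subgroup.mem_map_of_mem _ (QuotientGroup.eq.1 h3)
    · rw [map_mul, map_inv]
      rw [← h1] at h2
      have q : (i x) * w ≤ (i x - 2) * w + 2 * w := by
        rw [← add_mul]; exact Nat.mul_le_mul_right _ (by omega)
      refine nn_pre _ _ _ _ h2 ?_ ?_
      · have := Nat.lt_div_mul_add (a := nn (φ x)) (b := w) (by omega)
        simp only [i] at *
        omega
      · have := Nat.lt_div_mul_add (a := nn (φ y)) (b := w) (by omega)
        simp only [i] at *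
        rw [← h1] at this
        omega
  obtain ⟨cA, DA, hDA, hA⟩ := label_colour φ hφ hN lam _ hΦ hlam S hS
  have hSB : (S ∪ S * DA * S).Finite := hS.union ((hS.mul hDA).mul hS)
  obtain ⟨cB, DB, hDB, hB⟩ := label_colour φ hφ hN lam _ hΦ hlam (S ∪ S * DA * S) hSB
  have hSC : (S ∪ S * DA * S ∪ S * DB * S).Finite := hSB.union ((hS.mul hDB).mul hS)
  obtain ⟨cC, DC, hDC, hC⟩ := label_colour φ hφ hN lam _ hΦ hlam
    (S ∪ S * DA * S ∪ S * DB * S) hSC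
  let sub : P → Fin 2 := fun x => if i x % 3 = 0 then cA x else if i x % 3 = 1 then cB x else cC x
  let col : P → ℕ := fun x => (i x + (sub x : ℕ)) % 3
  let r : ℕ → P → P → Prop := fun κ a b => a⁻¹ * b ∈ S ∧ col a = κ ∧ col b = κ
  -- the invariant
  have inv : ∀ κ x y, ReflTransGen (r κ) x y → x ≠ y → col x = κ ∧ col y = κ := by
    intro κ x y h hne
    induction h with
    | refl => exact absurd rfl hne
    | @tail b c hb h ih =>
      by_cases hxb : x = b
      · subst hxb; exact h.2
      · exact ⟨(ih hxb).1, h.2.2⟩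
  have star : ∀ κ x y, ReflTransGen (r κ) x y → i x % 3 = i y % 3 → lam x = lam y := by
    intro κ x y h ht
    by_cases hxy : x = y
    · rw [hxy]
    have hcol := (inv κ x y h hxy).1
    -- q
    obtain ⟨q, hq, hqk⟩ : ∃ q, (i x = q ∨ i x + 1 = q) ∧ q % 3 = κ := by
      have : (sub x : ℕ) < 2 := (sub x).2
      refine ⟨i x + sub x, ?_, hcol⟩
      omega
    have key : (i y = q ∨ i y + 1 = q) ∧
        (VV (φ x)).take ((q - 2) * w) = (VV (φ y)).take ((q - 2) * w) ∧
        x⁻¹ * y ∈ Subgroup.closure S := by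
      clear hxy ht
      induction h with
      | refl => exact ⟨hq, rfl, by simp⟩
      | @tail b c _ h ih =>
        obtain ⟨e1, e2, e3⟩ := ih
        obtain ⟨hs, hb, hc⟩ := h
        have hn : nn ((φ b)⁻¹ * φ c) ≤ w := by
          rw [← map_inv, ← map_mul]; exact hw _ ⟨_, hs, rfl⟩
        have hst := nn_step _ _ _ hn
        have d1 := div_step hw1 hst.1
        have d2 := div_step hw1 hst.2
        have s1 : (sub b : ℕ) < 2 := (sub b).2
        have s2 : (sub c : ℕ) < 2 := (sub c).2
        simp only [col] at hb hc
        have ib : i b = nn (φ b) / w := rfl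
        have ic : i c = nn (φ c) / w := rfl
        rw [← ib, ← ic] at d1 d2
        refine ⟨by omega, ?_, ?_⟩
        · rw [e2]
          rcases Nat.lt_or_ge q 2 with h0 | h0
          · have : q - 2 = 0 := by omega
            simp [this]
          · refine VV_step _ _ _ w hn ?_
            have : (q - 2) * w + w = (q - 1) * w := by
              rw [← Nat.succ_mul]; congr 1; omega
            rw [this]
            refine le_trans (Nat.mul_le_mul_right w (?_ : q - 1 ≤ i b)) (Nat.div_mul_le_self _ _)
            omega
        · have := mul_mem e3 (Subgroup.subset_closure hs)
          simpa [mul_assoc] using this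
    obtain ⟨k1, k2, k3⟩ := key
    have hi : i x = i y := by omega
    simp only [lam, Prod.mk.injEq]
    refine ⟨hi, ?_, QuotientGroup.eq.2 k3⟩
    rw [← hi]
    have hle : (i x - 2) * w ≤ (q - 2) * w := Nat.mul_le_mul_right _ (by omega)
    have := congrArg (List.take ((i x - 2) * w)) k2
    rwa [List.take_take, List.take_take, min_eq_left hle] at this
  have sA : ∀ x, i x % 3 = 0 → sub x = cA x := fun x h => by simp [sub, h]
  have sB : ∀ x, i x % 3 = 1 → sub x = cB x := fun x h => by simp [sub, h]
  have sC : ∀ x, i x % 3 = 2 → sub x = cC x := fun x h => by simp [sub, h]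
  have ceq : ∀ x y, i x % 3 = i y % 3 → col x = col y → sub x = sub y := by
    intro x y h1 h2
    have s1 : (sub x : ℕ) < 2 := (sub x).2
    have s2 : (sub y : ℕ) < 2 := (sub y).2
    simp only [col] at h2
    apply Fin.ext
    omega
  have coleq : ∀ κ x y, ReflTransGen (r κ) x y → col x = col y := by
    intro κ x y h
    by_cases hxy : x = y
    · rw [hxy]
    · obtain ⟨a, b⟩ := inv κ x y h hxy; rw [a, b]
  have typ : ∀ x κ, col x = κ → i x % 3 = κ ∨ (i x + 1) % 3 = κ := by
    intro x κ h
    have s1 : (sub x : ℕ) < 2 := (sub x).2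
    simp only [col] at h
    omega
  have gen : ∀ (κ tX tY : ℕ) (cX cY : P → Fin 2) (SX SY DX DY : Set P),
      (∀ x, col x = κ → i x % 3 = tX ∨ i x % 3 = tY) →
      (∀ x, i x % 3 = tX → sub x = cX x) → (∀ x, i x % 3 = tY → sub x = cY x) →
      S ⊆ SX → S ∪ S * DX * S ⊆ SY →
      (∀ x y, ReflTransGen (fun a b => a⁻¹ * b ∈ SX ∧ lam a = lam b ∧ cX a = cX b) x y →
        x⁻¹ * y ∈ DX) →
      (∀ x y, ReflTransGen (fun a b => a⁻¹ * b ∈ SY ∧ lam a = lam b ∧ cY a = cY b) x y →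
        x⁻¹ * y ∈ DY) →
      ∀ x y, ReflTransGen (r κ) x y →
        x⁻¹ * y ∈ DX ∪ ({1} ∪ DX * S) * DY * ({1} ∪ S * DX) := by
    intro κ tX tY cX cY SX SY DX DY ht hcX hcY hSX hSY hX hY
    refine union_lemma (r κ) (fun x => i x % 3 = tY) S DX DY (fun a b h => h.1) ?_ ?_
    · intro x y h
      refine hX x y (ReflTransGen.mono ?_ _ _ h)
      rintro a b ⟨h, ha, hb⟩

      have ha' := (ht a h.2.1).resolve_right ha
      have hb' := (ht b h.2.2).resolve_right hb
      refine ⟨hSX h.1, star κ _ _ (.single h) (by rw [ha', hb']), ?_⟩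
      rw [← hcX a ha', ← hcX b hb']
      exact ceq _ _ (by rw [ha', hb']) (by rw [h.2.1, h.2.2])
    · intro x y h
      refine hY x y (ReflTransGen.mono ?_ _ _ h)
      rintro a b ⟨ha, hb, hs, h⟩

      refine ⟨hSY hs, star κ _ _ h (by rw [ha, hb]), ?_⟩
      rw [← hcY a ha, ← hcY b hb]
      exact ceq _ _ (by rw [ha, hb]) (coleq κ _ _ h)
  have g1 := gen 1 0 1 cA cB S _ DA DB (fun x h => by have := typ x 1 h; omega) sA sB le_rfl le_rfl hA hB
  have g2 := gen 2 1 2 cB cC _ _ DB DC (fun x h => by have := typ x 2 h; omega) sB sC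
    Set.subset_union_left (by
      intro z hz
      rcases hz with hz | hz
      · exact .inl (.inl hz)
      · exact .inr hz) hB hC
  have g0 := gen 0 0 2 cA cC _ _ DA DC (fun x h => by have := typ x 0 h; omega) sA sC
    le_rfl Set.subset_union_left hA hC
  have fU : ∀ D D' : Set P, D.Finite → D'.Finite →
      (D ∪ ({1} ∪ D * S) * D' * ({1} ∪ S * D)).Finite := fun D D' h h' =>
    h.union ((((Set.finite_singleton _).union (h.mul hS)).mul h').mul
      ((Set.finite_singleton _).union (hS.mul h)))
  refine ⟨fun x => ⟨col x, Nat.mod_lt _ (by norm_num)⟩, _,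
    ((fU _ _ hDA hDB).union (fU _ _ hDB hDC)).union (fU _ _ hDA hDC), fun x y hxy => ?_⟩
  have hchain : ReflTransGen (r (col x)) x y ∧ col y = col x := by
    induction hxy with
    | refl => exact ⟨.refl, rfl⟩
    | @tail b c _ h ih =>
      have hc : col b = col c := by simpa using h.2
      exact ⟨ih.1.tail ⟨h.1, ih.2, by rw [← hc, ih.2]⟩, by rw [← hc, ih.2]⟩
  have hlt : col x < 3 := Nat.mod_lt _ (by norm_num)
  obtain h | h | h : col x = 0 ∨ col x = 1 ∨ col x = 2 := by omega
  · right; exact g0 _ _ (h ▸ hchain.1)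
  · left; left; exact g1 _ _ (h ▸ hchain.1)
  · left; right; exact g2 _ _ (h ▸ hchain.1)

end FbF

namespace FbF

theorem free_center {X : Type*} (z : FreeGroup X) (hz : ∀ g, g * z = z * g) (x y : X) (hxy : x ≠ y) :
    z = 1 := by
  classical
  by_contra hne
  obtain ⟨a, t, hat⟩ : ∃ a t, z.toWord = a :: t := by
    cases h : z.toWord with
    | nil => exact absurd (FreeGroup.toWord_eq_nil_iff.1 h) hne
    | cons a t => exact ⟨a, t, rfl⟩
  obtain ⟨y, hy⟩ : ∃ y, y ≠ a.1 := by
    by_cases h : x = a.1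
    · exact ⟨y, fun h' => hxy (h.trans h'.symm)⟩
    · exact ⟨x, h⟩
  have h1 : (FreeGroup.of y * z).toWord = (y, true) :: z.toWord := by
    rw [FreeGroup.toWord_mul, FreeGroup.toWord_of, List.singleton_append, FreeGroup.reduce.cons,
      FreeGroup.reduce_toWord, hat]
    simp [hy]
  have h2 := FreeGroup.toWord_mul_sublist z (FreeGroup.of y)
  rw [← hz, h1, FreeGroup.toWord_of] at h2
  have h3 := h2.eq_of_length (by simp)
  rw [hat] at h3
  simp only [List.cons_append, List.cons.injEq] at h3
  exact hy (by rw [← h3.1])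

variable {F : Type*} [Group F]

theorem free_cyclic_of_center [IsFreeGroup F] (z : F) (hz : ∀ g, g * z = z * g) (h1 : z ≠ 1) :
    ∃ c : F, ∀ g, g ∈ Subgroup.zpowers c := by
  let e := IsFreeGroup.toFreeGroup F
  have hs : Subsingleton (IsFreeGroup.Generators F) := by
    by_contra hns
    rw [not_subsingleton_iff_nontrivial] at hns
    obtain ⟨x, y, hxy⟩ := hns
    have := free_center (e z) (fun g => by
      have := congrArg e (hz (e.symm g)); simpa using this) x y hxy
    exact h1 (by simpa using this)
  rcases isEmpty_or_nonempty (IsFreeGroup.Generators F) with hE | ⟨⟨x⟩⟩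
  · exfalso
    apply h1
    apply e.injective
    exact Subsingleton.elim _ _
  · have : Unique (IsFreeGroup.Generators F) := ⟨⟨x⟩, fun y => Subsingleton.elim _ _⟩
    obtain ⟨c, hc⟩ := IsCyclic.exists_generator (α := FreeGroup (IsFreeGroup.Generators F))
    refine ⟨e.symm c, fun g => ?_⟩
    obtain ⟨k, hk⟩ := hc (e g)
    refine ⟨k, ?_⟩
    apply e.injective
    simpa using hk

theorem free_tf [IsFreeGroup F] (x : F) (hx : x ≠ 1) (k : ℤ) (hk : x ^ k = 1) : k = 0 := by
  let e := IsFreeGroup.toFreeGroup F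
  by_contra h
  apply hx
  apply e.injective
  have : (e x) ^ k = 1 := by rw [← map_zpow, hk, map_one]
  rw [map_one]
  exact (IsMulTorsionFree.zpow_eq_one_iff_left h).1 this

theorem free_centralizer {F : Type} [Group F] [IsFreeGroup F] (f : F) (hf : f ≠ 1) :
    ∃ c : F, Commute c f ∧ ∀ g, Commute g f → ∃ k : ℤ, c ^ k = g := by
  let C := Subgroup.centralizer {f}
  have mem : ∀ g, g ∈ C ↔ Commute g f := fun g => by
    simp only [C, Subgroup.mem_centralizer_singleton_iff]
    exact ⟨fun h => h, fun h => h⟩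
  obtain ⟨c, hc⟩ := free_cyclic_of_center (F := C) ⟨f, (mem f).2 (Commute.refl f)⟩
    (fun g => Subtype.ext ((mem g.1).1 g.2)) (fun h => hf (congrArg Subtype.val h))
  refine ⟨c, (mem _).1 c.2, fun g hg => ?_⟩
  obtain ⟨k, hk⟩ := hc ⟨g, (mem g).2 hg⟩
  exact ⟨k, by simpa using congrArg Subtype.val hk⟩

theorem free_ct {F : Type} [Group F] [IsFreeGroup F] {f a b : F} (hf : f ≠ 1) (ha : Commute a f)
    (hb : Commute b f) : Commute a b := by
  obtain ⟨c, -, hc⟩ := free_centralizer f hf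
  obtain ⟨k, rfl⟩ := hc a ha
  obtain ⟨l, rfl⟩ := hc b hb
  exact (Commute.refl c).zpow_zpow _ _

theorem commute_conj {G : Type*} [Group G] {a b : G} (h : G) (hab : Commute a b) :
    Commute (h * a * h⁻¹) (h * b * h⁻¹) := by
  have := hab.map (MulAut.conj h)
  simpa using this

/-- `h c h⁻¹ = c ^ (± 1)` if `h` normalises the infinite cyclic `⟨c⟩` -/
theorem conj_pm {G : Type*} [Group G] {c h : G} (j j' : ℤ) (hc : ∀ k : ℤ, c ^ k = 1 → k = 0)
    (h1 : h * c * h⁻¹ = c ^ j) (h2 : h⁻¹ * c * h = c ^ j') :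
    h * c * h⁻¹ = c ∨ h * c * h⁻¹ = c⁻¹ := by
  have h3 : c = c ^ (j * j') := by
    calc c = h * (h⁻¹ * c * h) * h⁻¹ := by group
      _ = h * c ^ j' * h⁻¹ := by rw [h2]
      _ = (h * c * h⁻¹) ^ j' := by rw [conj_zpow]
      _ = _ := by rw [h1, zpow_mul]
  have h4 : j * j' - 1 = 0 := hc _ (by rw [zpow_sub, ← h3]; simp)
  have h5 : j * j' = 1 := by omega
  rcases Int.mul_eq_one_iff_eq_one_or_neg_one.1 h5 with ⟨h, _⟩ | ⟨h, _⟩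
  · left; rw [h1, h, zpow_one]
  · right; rw [h1, h]; simp

theorem free_F3 {F : Type} [Group F] [IsFreeGroup F] {e h : F} (H : Commute e (h * e * h⁻¹)) :
    Commute h e := by
  by_cases he : e = 1
  · rw [he]; exact Commute.one_right _
  obtain ⟨c, hce, hc⟩ := free_centralizer e he
  obtain ⟨m, hm⟩ := hc e (Commute.refl e)
  have hc1 : c ≠ 1 := by rintro rfl; simp at hm; exact he hm.symm
  have he' : h * e * h⁻¹ ≠ 1 := by simpa using he
  have he'' : h⁻¹ * e * h ≠ 1 := by
    intro hh
    apply he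
    have : e = h * (h⁻¹ * e * h) * h⁻¹ := by group
    rw [this, hh]; simp
  have H2 : Commute e (h⁻¹ * e * h) := by
    have := commute_conj h⁻¹ H
    rw [show h⁻¹ * (h * e * h⁻¹) * h⁻¹⁻¹ = e by group, inv_inv] at this
    exact this.symm
  obtain ⟨j, hj⟩ := hc (h * c * h⁻¹) (free_ct he' (commute_conj h hce) H)
  obtain ⟨j', hj'⟩ := hc (h⁻¹ * c * h) (free_ct he'' (by simpa using commute_conj h⁻¹ hce) H2)
  rcases conj_pm j j' (fun k hk => free_tf c hc1 k hk) hj.symm hj'.symm with h1 | h1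
  · have : Commute h c := by
      show h * c = c * h
      rw [← mul_inv_eq_iff_eq_mul]; exact h1
    rw [← hm]; exact this.zpow_right m
  · by_cases hh : h = 1
    · rw [hh]; exact Commute.one_left _
    have h2 : h ^ 2 ≠ 1 := fun h' => by
      have := free_tf h hh 2 (by exact_mod_cast h'); omega
    have h3 : Commute c (h ^ 2) := by
      show c * h ^ 2 = h ^ 2 * c
      rw [← eq_mul_inv_iff_mul_eq]
      calc c = (c⁻¹)⁻¹ := by simp
        _ = (h * c * h⁻¹)⁻¹ := by rw [h1]
        _ = h * c⁻¹ * h⁻¹ := by group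
        _ = h * (h * c * h⁻¹) * h⁻¹ := by rw [h1]
        _ = _ := by rw [pow_two]; group
    have h4 := free_ct h2 ((Commute.refl h).pow_right 2) h3
    rw [← hm]; exact h4.zpow_right m

theorem free_rel {F : Type} [Group F] [IsFreeGroup F] {x y : F} (H : Commute x y) :
    ∃ a b : ℤ, (a ≠ 0 ∨ b ≠ 0) ∧ x ^ a * y ^ b = 1 := by
  by_cases hx : x = 1
  · exact ⟨1, 0, by simp, by simp [hx]⟩
  obtain ⟨c, -, hc⟩ := free_centralizer x hx
  obtain ⟨m, hm⟩ := hc x (Commute.refl x)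
  obtain ⟨n, hn⟩ := hc y H.symm
  refine ⟨n, -m, .inr ?_, ?_⟩
  · intro h
    have : m = 0 := by omega
    rw [this] at hm; simp at hm; exact hx hm.symm
  · rw [← hm, ← hn, ← zpow_mul, ← zpow_mul, ← zpow_add]
    simp [mul_comm]

theorem lemma_S {P : Type} [Group P] {Q : Type} [Group Q] [IsFreeGroup Q] (φ : P →* Q)
    [IsFreeGroup φ.ker] {e h : P} (H1 : Commute e (h * e * h⁻¹))
    (H2 : Commute e (h ^ 2 * e * (h ^ 2)⁻¹)) : Commute (h ^ 2) e := by
  have hφ : Commute (φ h) (φ e) := free_F3 (by simpa using H1.map φ)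
  set f := h * e * h⁻¹ * e⁻¹ with hf
  have fN : f ∈ φ.ker := by
    rw [MonoidHom.mem_ker, hf]; simp only [map_mul, map_inv]
    rw [hφ.eq]; group
  have fe : h * e * h⁻¹ = f * e := by rw [hf]; group
  have cfe : Commute f e := by
    rw [hf]; exact (H1.symm.mul_left ((Commute.refl e).inv_left))
  have H3 : Commute (h * e * h⁻¹) (h ^ 2 * e * (h ^ 2)⁻¹) := by
    have := commute_conj h H1
    convert this using 1; rw [pow_two]; group
  have f' : h * f * h⁻¹ = (h ^ 2 * e * (h ^ 2)⁻¹) * (h * e * h⁻¹)⁻¹ := by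
    rw [hf, pow_two]; group
  have cff' : Commute f (h * f * h⁻¹) := by
    rw [f', hf]
    have a1 : Commute (h * e * h⁻¹) (h ^ 2 * e * (h ^ 2)⁻¹ * (h * e * h⁻¹)⁻¹) :=
      H3.mul_right (Commute.refl _).inv_right
    have a2 : Commute e (h ^ 2 * e * (h ^ 2)⁻¹ * (h * e * h⁻¹)⁻¹) :=
      H2.mul_right H1.inv_right
    exact a1.mul_left a2.inv_left
  by_cases hf1 : f = 1
  · have : Commute h e := by
      show h * e = e * h
      rw [← mul_inv_eq_iff_eq_mul, fe, hf1, one_mul]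
    exact this.pow_left 2
  -- work in N
  have nrm : ∀ g : P, ∀ x ∈ φ.ker, g * x * g⁻¹ ∈ φ.ker := fun g x hx =>
    (inferInstance : φ.ker.Normal).conj_mem x hx g
  have nrm' : ∀ g : P, ∀ x ∈ φ.ker, g⁻¹ * x * g ∈ φ.ker := fun g x hx => by
    simpa using nrm g⁻¹ x hx
  have ct : ∀ u a b : P, u ∈ φ.ker → a ∈ φ.ker → b ∈ φ.ker → u ≠ 1 → Commute a u → Commute b u →
      Commute a b := by
    intro u a b hu ha hb h1 h2 h3
    have := free_ct (F := φ.ker) (f := ⟨u, hu⟩) (a := ⟨a, ha⟩) (b := ⟨b, hb⟩)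
      (fun h => h1 (congrArg Subtype.val h)) (Subtype.ext h2) (Subtype.ext h3)
    exact congrArg Subtype.val this
  have tf : ∀ u : P, u ∈ φ.ker → u ≠ 1 → ∀ k : ℤ, u ^ k = 1 → k = 0 := by
    intro u hu h1 k hk
    refine free_tf (F := φ.ker) ⟨u, hu⟩ (fun h => h1 (congrArg Subtype.val h)) k ?_
    apply Subtype.ext
    simpa using hk
  obtain ⟨c, cN, ccf, hc⟩ : ∃ c ∈ φ.ker, Commute c f ∧
      ∀ g ∈ φ.ker, Commute g f → ∃ k : ℤ, c ^ k = g := by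
    obtain ⟨c, h1, h2⟩ := free_centralizer (F := φ.ker) ⟨f, fN⟩
      (fun h => hf1 (congrArg Subtype.val h))
    refine ⟨c, c.2, congrArg Subtype.val h1, fun g hg hgf => ?_⟩
    obtain ⟨k, hk⟩ := h2 ⟨g, hg⟩ (Subtype.ext hgf)
    exact ⟨k, by simpa using congrArg Subtype.val hk⟩
  obtain ⟨m, hm⟩ := hc f fN (Commute.refl f)
  have hc1 : c ≠ 1 := by rintro rfl; simp at hm; exact hf1 hm.symm
  have f1 : h * f * h⁻¹ ≠ 1 := by simpa using hf1
  have f2 : h⁻¹ * f * h ≠ 1 := by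
    intro hh
    apply hf1
    have : f = h * (h⁻¹ * f * h) * h⁻¹ := by group
    rw [this, hh]; simp
  have cff'' : Commute f (h⁻¹ * f * h) := by
    have := commute_conj h⁻¹ cff'
    rw [show h⁻¹ * (h * f * h⁻¹) * h⁻¹⁻¹ = f by group, inv_inv] at this
    exact this.symm
  obtain ⟨j, hj⟩ := hc (h * c * h⁻¹) (nrm h c cN)
    (ct _ _ _ (nrm h f fN) (nrm h c cN) fN f1 (commute_conj h ccf) cff')
  obtain ⟨j', hj'⟩ := hc (h⁻¹ * c * h) (nrm' h c cN)
    (ct _ _ _ (nrm' h f fN) (nrm' h c cN) fN f2 (by simpa using commute_conj h⁻¹ ccf) cff'')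
  rcases conj_pm j j' (tf c cN hc1) hj.symm hj'.symm with h1 | h1
  · -- h commutes with c
    exfalso
    have hhc : Commute h c := by
      show h * c = c * h
      rw [← mul_inv_eq_iff_eq_mul]; exact h1
    have hhf : Commute h f := by rw [← hm]; exact hhc.zpow_right m
    have eec : Commute e c := by
      obtain ⟨i, hi⟩ := hc (e * c * e⁻¹) (nrm e c cN) (by
        have := commute_conj e ccf
        rwa [show e * f * e⁻¹ = f by rw [← cfe.eq]; group] at this)
      have h5 : c ^ (i * m) = c ^ m := by
        rw [zpow_mul, hi, conj_zpow, hm, ← cfe.eq]; group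
      have h6 : i * m - m = 0 := tf c cN hc1 _ (by rw [zpow_sub, h5]; simp)
      have hm0 : m ≠ 0 := by rintro rfl; simp at hm; exact hf1 hm.symm
      have h7 : i = 1 := by
        have : (i - 1) * m = 0 := by linarith
        rcases mul_eq_zero.1 this with h | h
        · omega
        · exact absurd h hm0
      rw [h7, zpow_one] at hi
      show e * c = c * e
      rw [← mul_inv_eq_iff_eq_mul]; exact hi.symm
    obtain ⟨a, b, hab, hw⟩ := free_rel hφ.symm
    have wN : e ^ a * h ^ b ∈ φ.ker := by
      rw [MonoidHom.mem_ker]; simpa using hw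
    obtain ⟨k, hk⟩ := hc _ wN ((cfe.symm.zpow_left a).mul_left (hhf.zpow_left b))
    have hhw : Commute h (e ^ a * h ^ b) := by rw [← hk]; exact hhc.zpow_right k
    have hea : Commute h (e ^ a) := by
      have := hhw.mul_right ((Commute.refl h).zpow_right (-b))
      rwa [mul_assoc, ← zpow_add, add_neg_cancel, zpow_zero, mul_one] at this
    have fa : f ^ a = 1 := by
      have h5 : (h * e * h⁻¹) ^ a = e ^ a := by
        rw [conj_zpow, hea.eq]; group
      rw [fe, cfe.mul_zpow] at h5
      simpa using h5
    have a0 := tf f fN hf1 a fa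
    subst a0
    simp only [zpow_zero, one_mul, ne_eq, not_true_eq_false, false_or] at hk hab
    have ehb : Commute e (h ^ b) := by rw [← hk]; exact eec.zpow_right k
    have fb : f ^ b = 1 := by
      have h5 : e⁻¹ * h * e = f * h := by
        have : h * e = f * e * h := by rw [← fe]; group
        rw [mul_assoc, this, cfe.eq]; group
      have h6 : (f * h) ^ b = h ^ b := by
        rw [← h5]
        have := conj_zpow (a := e⁻¹) (b := h) (i := b)
        rw [inv_inv] at this
        rw [this, mul_assoc, ← ehb.eq]; group
      rw [hhf.symm.mul_zpow] at h6
      simpa using h6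
    exact hab (tf f fN hf1 b fb)
  · have hff : h * f * h⁻¹ = f⁻¹ := by
      rw [← hm, ← conj_zpow, h1]; simp
    show h ^ 2 * e = e * h ^ 2
    rw [← mul_inv_eq_iff_eq_mul]
    calc h ^ 2 * e * (h ^ 2)⁻¹ = h * (h * e * h⁻¹) * h⁻¹ := by rw [pow_two]; group
      _ = h * (f * e) * h⁻¹ := by rw [fe]
      _ = (h * f * h⁻¹) * (h * e * h⁻¹) := by group
      _ = e := by rw [hff, fe]; group

theorem fbf_tf {P : Type} [Group P] {Q : Type} [Group Q] [IsFreeGroup Q] (φ : P →* Q)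
    [IsFreeGroup φ.ker] (x : P) (k : ℤ) (hk : k ≠ 0) (h : x ^ k = 1) : x = 1 := by
  by_contra hx
  have h1 : φ x = 1 := by
    by_contra h1
    exact hk (free_tf (φ x) h1 k (by rw [← map_zpow, h, map_one]))
  exact hk (free_tf (F := φ.ker) ⟨x, h1⟩ (fun h => hx (congrArg Subtype.val h)) k
    (Subtype.ext (by simpa using h)))

end FbF


namespace FbF

/-- embeds in a finite product of free-by-free groups -/
def Emb (Γ : Type) [Group Γ] : Prop :=
  ∃ (m : ℕ) (P : Fin m → Type) (inst : ∀ i, Group (P i)),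
      haveI := inst
      (∀ i, IsFreeByFree (P i)) ∧ ∃ ψ : Γ →* (∀ i, P i), Function.Injective ψ

theorem Emb.of_inj {Γ Δ : Type} [Group Γ] [Group Δ] (h : Emb Γ) (ψ : Δ →* Γ)
    (hψ : Function.Injective ψ) : Emb Δ := by
  obtain ⟨m, P, inst, hP, χ, hχ⟩ := h
  exact ⟨m, P, inst, hP, χ.comp ψ, hχ.comp hψ⟩

theorem IsFreeByFree.elim {P : Type} [Group P] (h : IsFreeByFree P) :
    ∃ (Y : Type) (φ : P →* FreeGroup Y), Function.Surjective φ ∧ IsFreeGroup φ.ker ∧ AD 3 P := by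
  obtain ⟨Y, φ, hφ, X, ⟨e⟩⟩ := h
  exact ⟨Y, φ, hφ, ⟨⟨X, ⟨FreeGroupBasis.ofRepr e⟩⟩⟩, AD_ext φ hφ (AD_of_equiv e AD_free)⟩

theorem Emb.S {Γ : Type} [Group Γ] (H : Emb Γ) {e h : Γ} (H1 : Commute e (h*e*h⁻¹))
    (H2 : Commute e (h^2*e*(h^2)⁻¹)) : Commute (h^2) e := by
  obtain ⟨m, P, inst, hP, ψ, hψ⟩ := H
  have key : ∀ i, Commute ((ψ (h^2)) i) ((ψ e) i) := by
    intro i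
    obtain ⟨Y, φ, hφ, hf, -⟩ := IsFreeByFree.elim (hP i)
    have := lemma_S φ (e := ψ e i) (h := ψ h i) ?_ ?_
    · simpa using this
    · have := congrFun (congrArg ψ H1) i
      simpa [Commute, SemiconjBy] using this
    · have := congrFun (congrArg ψ H2) i
      simpa [Commute, SemiconjBy] using this
  apply hψ
  funext i
  have := key i
  simpa [Commute, SemiconjBy] using this

theorem Emb.tf {Γ : Type} [Group Γ] (H : Emb Γ) (x : Γ) (k : ℕ) (hk : k ≠ 0) (h : x ^ k = 1) :
    x = 1 := by
  obtain ⟨m, P, inst, hP, ψ, hψ⟩ := H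
  apply hψ
  funext i
  obtain ⟨Y, φ, hφ, hf, -⟩ := IsFreeByFree.elim (hP i)
  have := fbf_tf φ (ψ x i) k (by exact_mod_cast hk) (by
    have := congrFun (congrArg ψ h) i
    simpa using this)
  simpa using this

/-- principal congruence subgroup -/
def Gn {B : Type} [Ring B] (O : Subring B) (n : ℕ) : Subgroup Bˣ where
  carrier := {u | (∃ x ∈ O, (u : B) = 1 + n * x) ∧ (∃ x ∈ O, ((u⁻¹ : Bˣ) : B) = 1 + n * x)}
  one_mem' := ⟨⟨0, O.zero_mem, by simp⟩, ⟨0, O.zero_mem, by simp⟩⟩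
  mul_mem' := by
    have key : ∀ u v : B, (∃ x ∈ O, u = 1 + n * x) → (∃ x ∈ O, v = 1 + n * x) →
        ∃ x ∈ O, u * v = 1 + n * x := by
      rintro _ _ ⟨x, hx, rfl⟩ ⟨y, hy, rfl⟩
      refine ⟨x + y + x * (n * y), ?_, by noncomm_ring⟩
      exact O.add_mem (O.add_mem hx hy) (O.mul_mem hx (O.mul_mem (natCast_mem O n) hy))
    rintro u v ⟨h1, h2⟩ ⟨h3, h4⟩
    refine ⟨?_, ?_⟩
    · rw [Units.val_mul]; exact key _ _ h1 h3
    · rw [mul_inv_rev, Units.val_mul]; exact key _ _ h4 h2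
  inv_mem' := by
    rintro u ⟨h1, h2⟩
    exact ⟨h2, by simpa using h1⟩

theorem clear_denoms {K : Type} [Field K] [NumberField K] (R : Subring K) (hR : IsOrderIn R)
    (x : K) : ∃ n : ℕ, 1 ≤ n ∧ (n : K) * x ∈ R := by
  have hx : x ∈ Submodule.span ℚ (R : Set K) := by rw [hR.2]; trivial
  induction hx using Submodule.span_induction with
  | mem x hx => exact ⟨1, le_rfl, by simpa using hx⟩
  | zero => exact ⟨1, le_rfl, by simp⟩
  | add x y _ _ h1 h2 =>
    obtain ⟨n, hn, hnx⟩ := h1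
    obtain ⟨m, hm, hmx⟩ := h2
    refine ⟨n * m, Nat.one_le_iff_ne_zero.2 (by positivity), ?_⟩
    have : ((n * m : ℕ) : K) * (x + y) = m * (n * x) + n * (m * y) := by push_cast; ring
    rw [this]
    exact R.add_mem (R.mul_mem (natCast_mem R m) hnx) (R.mul_mem (natCast_mem R n) hmx)
  | smul a x _ h =>
    obtain ⟨n, hn, hnx⟩ := h
    refine ⟨a.den * n, Nat.one_le_iff_ne_zero.2 (by have := a.den_nz; positivity), ?_⟩
    have : ((a.den * n : ℕ) : K) * (a • x) = (a.num : K) * (n * x) := by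
      rw [Algebra.smul_def]
      have h : ((a.den : ℕ) : K) * algebraMap ℚ K a = (a.num : K) := by
        have := Rat.den_mul_eq_num a
        have h2 := congrArg (algebraMap ℚ K) this
        rw [map_mul, map_natCast, map_intCast] at h2
        exact h2
      push_cast
      rw [← h]; ring
    rw [this]
    exact R.mul_mem (intCast_mem R _) hnx

theorem clear_denoms' {K : Type} [Field K] [NumberField K] (R : Subring K) (hR : IsOrderIn R)
    (T : Finset K) : ∃ n : ℕ, 1 ≤ n ∧ ∀ x ∈ T, (n : K) * x ∈ R := by
  classical
  induction T using Finset.induction_on with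
  | empty => exact ⟨1, le_rfl, by simp⟩
  | insert a T ha ih =>
    obtain ⟨n, hn, h⟩ := ih
    obtain ⟨m, hm, h'⟩ := clear_denoms R hR a
    refine ⟨n * m, Nat.one_le_iff_ne_zero.2 (by positivity), ?_⟩
    intro x hx
    rcases Finset.mem_insert.1 hx with rfl | hx
    · push_cast; rw [mul_assoc]; exact R.mul_mem (natCast_mem R n) h'
    · push_cast; rw [mul_comm (n : K), mul_assoc]; exact R.mul_mem (natCast_mem R m) (h x hx)

theorem clear_denoms_A {K : Type} [Field K] [NumberField K] (R : Subring K) (hR : IsOrderIn R)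
    (G : Type) [Group G] [Finite G] (T : Set (MonoidAlgebra K G)) (hT : T.Finite) :
    ∃ n : ℕ, 1 ≤ n ∧ ∀ x ∈ T, (n : MonoidAlgebra K G) * x ∈
      (MonoidAlgebra.mapRingHom G R.subtype).range := by
  classical
  have := Fintype.ofFinite G
  obtain ⟨n, hn, h⟩ := clear_denoms' R hR
    (hT.toFinset.biUnion (fun x => Finset.univ.image (fun g => x.coeff g)))
  refine ⟨n, hn, fun x hx => ?_⟩
  have hg : ∀ g, (n : K) * x.coeff g ∈ R := by
    intro g
    apply h
    simp only [Finset.mem_biUnion, Finset.mem_image]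
    exact ⟨x, by simpa using hx, g, by simp, rfl⟩
  refine ⟨∑ g, MonoidAlgebra.single g ⟨_, hg g⟩, ?_⟩
  rw [map_sum]
  simp only [MonoidAlgebra.mapRingHom_single]
  ext g
  rw [MonoidAlgebra.natCast_def, MonoidAlgebra.coeff_single_one_mul, MonoidAlgebra.coeff_sum,
    Finsupp.finsetSum_apply]
  simp [Finsupp.single_apply]

theorem interface (K : Type) [Field K] [NumberField K] (R : Subring K) (hR : IsOrderIn R)
    (G : Type) [Group G] [Finite G]
    (h : IsVirtuallyDirectProductOfFreeByFree (MonoidAlgebra ↥R G)ˣ)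
    {B : Type} [Ring B] (f : MonoidAlgebra K G →+* B) (hf : Function.Surjective f) :
    ∃ Γ : Subgroup Bˣ, Emb Γ ∧ ∀ O : Subring B, O.toAddSubgroup.FG →
      ∃ n : ℕ, 1 ≤ n ∧ Γ.relIndex (Gn O n) ≠ 0 := by
  classical
  obtain ⟨H, hH, m, P, inst, hP, ⟨ε⟩⟩ := h
  have := Fintype.ofFinite G
  have : NeZero (Nat.card G : K) := ⟨by
    have : Nat.card G ≠ 0 := Nat.card_pos.ne'
    exact_mod_cast this⟩
  have : IsSemisimpleRing (MonoidAlgebra K G) := inferInstance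
  obtain ⟨q, hq, hk⟩ := IsSemisimpleRing.ideal_eq_span_idempotent (RingHom.ker f)
  have hfq : f q = 0 := by
    have : q ∈ RingHom.ker f := by rw [hk]; exact Ideal.mem_span_singleton_self q
    exact this
  have hker : ∀ x, f x = 0 → x * (1 - q) = 0 := by
    intro x hx
    have : x ∈ RingHom.ker f := hx
    rw [hk, Ideal.mem_span_singleton'] at this
    obtain ⟨a, rfl⟩ := this
    rw [mul_assoc, mul_sub, hq.eq]; simp
  choose g hg using hf
  set s : B → MonoidAlgebra K G := fun b => g b * (1 - q) with hs
  have hsf : ∀ x b, f x = b → s b = x * (1 - q) := by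
    intro x b hx
    have := hker (g b - x) (by rw [map_sub, hg, hx, sub_self])
    rw [sub_mul, sub_eq_zero] at this
    exact this
  have hqs : ∀ b, q * s b = 0 := by
    intro b
    have := hker (q * g b) (by rw [map_mul, hfq, zero_mul])
    rw [hs]; simp only; rw [← mul_assoc]; exact this
  have hsq : ∀ b, s b * q = 0 := by
    intro b
    rw [hs]; simp only; rw [mul_assoc, sub_mul, hq.eq]; simp
  have hs1 : s 1 = 1 - q := by rw [hsf 1 1 (map_one f), one_mul]
  have hadd : ∀ u v, s (u + v) = s u + s v := by
    intro u v
    rw [hsf (g u + g v) (u + v) (by rw [map_add, hg, hg]), add_mul]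
  have hmul : ∀ u v, s (u * v) = s u * s v := by
    intro u v
    rw [hsf (g u * g v) (u * v) (by rw [map_mul, hg, hg])]
    have := hqs v
    have h2 : s v = s v - q * s v := by rw [this, sub_zero]
    calc g u * g v * (1 - q) = g u * s v := by rw [hs]; simp only; rw [mul_assoc]
      _ = g u * (s v - q * s v) := by rw [← h2]
      _ = s u * s v := by rw [hs]; noncomm_ring
  have hfs : ∀ b, f (s b) = b := by
    intro b
    rw [hs]; simp [hg, hfq]
  let sA : B →+ MonoidAlgebra K G := AddMonoidHom.mk' s hadd
  let κ0 : B →* MonoidAlgebra K G :=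
    { toFun := fun u => q + s u
      map_one' := by rw [hs1]; abel
      map_mul' := by
        intro u v
        rw [add_mul, mul_add, mul_add, hqs, hsq, hq.eq, hmul]; abel }
  let κ : Bˣ →* (MonoidAlgebra K G)ˣ := Units.map κ0
  have hκ : Function.Injective κ := by
    intro u v huv
    have h1 : q + s u = q + s v := congrArg Units.val huv
    have h2 := congrArg f (add_left_cancel h1)
    rw [hfs, hfs] at h2
    exact Units.ext h2
  let ιR := MonoidAlgebra.mapRingHom G R.subtype
  have hι : Function.Injective ιR := by
    intro x y hxy
    ext k
    have := congrArg (fun z => z.coeff k) hxy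
    simpa [ιR] using this
  let ιU : (MonoidAlgebra R G)ˣ →* (MonoidAlgebra K G)ˣ := Units.map (ιR : _ →* _)
  have hιU : Function.Injective ιU := Units.map_injective hι
  refine ⟨(H.map ιU).comap κ, ?_, ?_⟩
  · refine ⟨m, P, inst, hP, ?_⟩
    let e1 := H.equivMapOfInjective ιU hιU
    refine ⟨ε.toMonoidHom.comp (e1.symm.toMonoidHom.comp (κ.subgroupComap (H.map ιU))), ?_⟩
    refine ε.injective.comp (e1.symm.injective.comp ?_)
    intro u v huv
    apply Subtype.ext
    apply hκ
    exact congrArg Subtype.val huv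
  · intro O hO
    obtain ⟨T, hT⟩ := hO
    obtain ⟨n, hn, hnT⟩ := clear_denoms_A R hR G (s '' T) (T.finite_toSet.image s)
    refine ⟨n, hn, ?_⟩
    have hO : ∀ x ∈ O, (n : MonoidAlgebra K G) * s x ∈ ιR.range := by
      intro x hx
      have hx' : x ∈ AddSubgroup.closure (T : Set B) := by rw [hT]; exact hx
      have hle : AddSubgroup.closure (T : Set B) ≤
          (ιR.range.toAddSubgroup.comap (AddMonoidHom.mulLeft (n : MonoidAlgebra K G))).comap sA := by
        rw [AddSubgroup.closure_le]
        intro t ht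
        exact hnT (s t) ⟨t, ht, rfl⟩
      exact hle hx'
    have hκn : ∀ u : B, (∃ x ∈ O, u = 1 + n * x) → κ0 u ∈ ιR.range := by
      rintro _ ⟨x, hx, rfl⟩
      have : κ0 (1 + n * x) = 1 + n * s x := by
        change q + s (1 + n * x) = _
        have h3 : s (n * x) = n * s x := by
          have := map_nsmul sA n x
          rw [nsmul_eq_mul, nsmul_eq_mul] at this
          exact this
        rw [hadd, hs1, h3]; abel
      rw [this]
      exact ιR.range.add_mem ιR.range.one_mem (hO x hx)
    have hle : Gn O n ≤ (((⊤ : Subgroup (MonoidAlgebra R G)ˣ).map ιU).comap κ) := by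
      rintro u ⟨h1, h2⟩
      obtain ⟨a, ha⟩ := hκn _ h1
      obtain ⟨b, hb⟩ := hκn _ h2
      refine ⟨⟨a, b, ?_, ?_⟩, trivial, ?_⟩
      · apply hι; rw [map_mul, ha, hb, ← map_mul, map_one]; simp
      · apply hι; rw [map_mul, ha, hb, ← map_mul, map_one]; simp
      · apply Units.ext
        exact ha
    have h0 : H.relIndex ⊤ ≠ 0 := by rw [Subgroup.relIndex_top_right]; exact hH.index_ne_zero
    have h1 : (H.map ιU).relIndex ((⊤ : Subgroup _).map ιU) ≠ 0 := by
      rwa [Subgroup.relIndex_map_map_of_injective _ _ hιU]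
    have h2 := Subgroup.relIndex_comap_ne_zero κ h1
    intro h3
    exact h2 (Subgroup.relIndex_eq_zero_of_le_right hle h3)

end FbF


namespace FbF
open scoped NumberField

/-- `1 + x` for square zero `x`, as a unit -/
def oneAdd {B : Type} [Ring B] (x : B) (hx : x * x = 0) : Bˣ where
  val := 1 + x
  inv := 1 - x
  val_inv := by noncomm_ring; rw [hx]; simp
  inv_val := by noncomm_ring; rw [hx]; simp

theorem pow_oneAdd {B : Type} [Ring B] (x : B) (hx : x * x = 0) (b : ℕ) :
    (((oneAdd x hx) ^ b : Bˣ) : B) = 1 + b * x := by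
  induction b with
  | zero => simp
  | succ k ih =>
    rw [pow_succ, Units.val_mul, ih]
    have : (k : B) * x * x = 0 := by rw [mul_assoc, hx, mul_zero]
    change (1 + (k : B) * x) * (1 + x) = _
    push_cast
    rw [mul_add, add_mul, add_mul, add_mul, this]; simp; abel

theorem core5 {B : Type} [Ring B] (hB : ∀ n : ℕ, n ≠ 0 → ∀ z : B, (n : B) * z = 0 → z = 0)
    (Γ : Subgroup Bˣ) (hΓ : Emb Γ) (O : Subring B) (n : ℕ) (hn : 1 ≤ n)
    (hi : Γ.relIndex (Gn O n) ≠ 0) (x : B) (hx : x * x = 0) (hxO : x ∈ O)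
    (h : Bˣ) (hh : h ∈ Gn O n) (hxh : ∀ a : ℤ, x * ((h ^ a : Bˣ) : B) * x = 0) :
    ∃ a : ℕ, 1 ≤ a ∧ ((h ^ a : Bˣ) : B) * x = x * ((h ^ a : Bˣ) : B) := by
  have hnx : ((n : B) * x) * ((n : B) * x) = 0 := by
    rw [mul_assoc, ← mul_assoc x, ← (Nat.cast_commute n x).eq, mul_assoc, hx]; simp
  set e := oneAdd ((n : B) * x) hnx with he
  have heG : e ∈ Gn O n := by
    refine ⟨⟨x, hxO, rfl⟩, ⟨-x, O.neg_mem hxO, ?_⟩⟩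
    change 1 - (n : B) * x = _
    noncomm_ring
  obtain ⟨b, hb, -, hbΓ⟩ := Subgroup.exists_pow_mem_of_relIndex_ne_zero hi heG
  obtain ⟨a, ha, -, haΓ⟩ := Subgroup.exists_pow_mem_of_relIndex_ne_zero hi hh
  have hbv : ((e ^ b : Bˣ) : B) = 1 + (b * n : ℕ) * x := by
    rw [he, pow_oneAdd]; push_cast; rw [mul_assoc]
  set N : ℕ := b * n with hN
  have hN0 : N ≠ 0 := by positivity
  -- conjugates commute
  have hc : ∀ g : Bˣ, (∃ k : ℤ, g = h ^ k) → e ^ b * (g * e ^ b * g⁻¹) = (g * e ^ b * g⁻¹) * e ^ b := by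
    rintro g ⟨k, rfl⟩
    apply Units.ext
    have h1 := hxh k
    have h2 := hxh (-k)
    rw [zpow_neg] at h2
    set g := h ^ k
    have h3 : (g : B) * (1 + (N : B) * x) * (g⁻¹ : Bˣ) = 1 + (N : B) * (g * x * (g⁻¹ : Bˣ)) := by
      rw [mul_add, mul_one, add_mul, Units.mul_inv, ← mul_assoc (g : B), ← (Nat.cast_commute N (g : B)).eq]
      simp only [mul_assoc]
    have h3' : ((g * e ^ b * g⁻¹ : Bˣ) : B) = 1 + (N : B) * (g * x * (g⁻¹ : Bˣ)) := by
      rw [Units.val_mul, Units.val_mul, hbv, h3]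
    rw [Units.val_mul (e ^ b), Units.val_mul _ (e ^ b), h3', hbv]
    have h4 : (N : B) * x * ((N : B) * (g * x * (g⁻¹ : Bˣ))) = 0 := by
      rw [mul_assoc, ← mul_assoc x, ← (Nat.cast_commute N x).eq, mul_assoc]
      have : x * ((g : B) * x * (g⁻¹ : Bˣ)) = 0 := by
        rw [← mul_assoc, ← mul_assoc, h1, zero_mul]
      rw [this]; simp
    have h5 : ((N : B) * (g * x * (g⁻¹ : Bˣ))) * ((N : B) * x) = 0 := by
      rw [mul_assoc, ← mul_assoc _ (N : B), ← (Nat.cast_commute N _).eq, mul_assoc]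
      have : ((g : B) * x * (g⁻¹ : Bˣ)) * x = 0 := by
        rw [mul_assoc, mul_assoc, ← mul_assoc x, h2, mul_zero]
      rw [this]; simp
    simp only [mul_add, add_mul, h4, h5, mul_one, one_mul]
    abel
  have hS := hΓ.S (e := ⟨e ^ b, hbΓ.1⟩) (h := ⟨h ^ a, haΓ.1⟩)
    (Subtype.ext (hc (h ^ a) ⟨a, by simp⟩)) (Subtype.ext (hc ((h ^ a) ^ 2) ⟨(a * 2 : ℕ), by
      rw [zpow_natCast, pow_mul]⟩))
  refine ⟨a * 2, by omega, ?_⟩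
  have h6 : (h ^ a) ^ 2 * e ^ b = e ^ b * (h ^ a) ^ 2 := congrArg Subtype.val hS.eq
  have h7 := congrArg Units.val h6
  rw [Units.val_mul, Units.val_mul, hbv, ← pow_mul] at h7
  rw [← sub_eq_zero]
  apply hB N hN0
  rw [mul_add, add_mul, mul_one, one_mul, add_right_inj, ← mul_assoc, ← (Nat.cast_commute N _).eq] at h7
  rw [mul_sub, ← mul_assoc, h7, ← mul_assoc, sub_self]

theorem exists_unit_inf (L : Type) [Field L] [NumberField L] (hL : 3 ≤ Module.finrank ℚ L) :
    ∃ u : (𝓞 L)ˣ, ∀ k : ℕ, 1 ≤ k → u ^ k ≠ 1 := by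
  have hr : 0 < NumberField.Units.rank L := by
    have h1 := NumberField.InfinitePlace.card_add_two_mul_card_eq_rank L
    have h2 := NumberField.InfinitePlace.card_eq_nrRealPlaces_add_nrComplexPlaces L
    unfold NumberField.Units.rank
    omega
  refine ⟨NumberField.Units.fundSystem L ⟨0, hr⟩, fun k hk h => ?_⟩
  have h1 := (NumberField.Units.basisUnitLattice L).ne_zero ⟨0, hr⟩
  apply h1
  apply Subtype.ext
  rw [← NumberField.Units.logEmbedding_fundSystem]
  apply NumberField.Units.dirichletUnitTheorem.logEmbedding_eq_zero_iff.2
  change IsOfFinOrder _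
  exact isOfFinOrder_iff_pow_eq_one.2 ⟨k, hk, h⟩

theorem exists_unit_cong (L : Type) [Field L] [NumberField L] (hL : 3 ≤ Module.finrank ℚ L)
    (n : ℕ) (hn : 1 ≤ n) :
    ∃ u : (𝓞 L)ˣ, (∀ k : ℕ, 1 ≤ k → u ^ k ≠ 1) ∧ (∃ y, (u : 𝓞 L) = 1 + n * y) ∧
      ∃ y, ((u⁻¹ : (𝓞 L)ˣ) : 𝓞 L) = 1 + n * y := by
  obtain ⟨u, hu⟩ := exists_unit_inf L hL
  have hne : Ideal.span {(n : 𝓞 L)} ≠ ⊥ := by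
    rw [Ne, Ideal.span_singleton_eq_bot]
    exact_mod_cast (by omega : n ≠ 0)
  have : Finite (𝓞 L ⧸ Ideal.span {(n : 𝓞 L)}) := Ideal.finiteQuotientOfFreeOfNeBot _ hne
  let π : (𝓞 L)ˣ →* (𝓞 L ⧸ Ideal.span {(n : 𝓞 L)})ˣ := Units.map (Ideal.Quotient.mk (Ideal.span {(n : 𝓞 L)})).toMonoidHom
  obtain ⟨k, hk, hk1⟩ := isOfFinOrder_iff_pow_eq_one.1 (isOfFinOrder_of_finite (π u))
  have key : ∀ v : (𝓞 L)ˣ, π v = 1 → ∃ y, (v : 𝓞 L) = 1 + n * y := by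
    intro v hv
    have h1 : Ideal.Quotient.mk (Ideal.span {(n : 𝓞 L)}) (v : 𝓞 L) = Ideal.Quotient.mk _ 1 :=
      congrArg Units.val hv
    rw [Ideal.Quotient.eq, Ideal.mem_span_singleton] at h1
    obtain ⟨y, hy⟩ := h1
    exact ⟨y, by rw [← hy]; ring⟩
  refine ⟨u ^ k, fun m hm => ?_, key _ (by rw [map_pow, hk1]), key _ (by rw [map_inv, map_pow, hk1, inv_one])⟩
  rw [← pow_mul]
  exact hu _ (Nat.mul_pos hk hm)

/-- order of integral matrices -/
noncomputable def OM {D : Type} [DivisionRing D] {L : Type} [Field L] (j : L →+* D) (d : ℕ) :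
    Matrix (Fin d) (Fin d) (𝓞 L) →+* Matrix (Fin d) (Fin d) D :=
  (j.comp (algebraMap (𝓞 L) L)).mapMatrix

theorem OM_fg {D : Type} [DivisionRing D] {L : Type} [Field L] [NumberField L] (j : L →+* D) (d : ℕ) :
    (OM j d).range.toAddSubgroup.FG := by
  have h1 : Module.Finite ℤ (Matrix (Fin d) (Fin d) (𝓞 L)) := inferInstance
  have h2 := h1.fg_top.map (OM j d).toAddMonoidHom.toIntLinearMap
  rw [Submodule.fg_iff_addSubgroup_fg] at h2
  have h3 : (OM j d).range.toAddSubgroup =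
      (Submodule.map (OM j d).toAddMonoidHom.toIntLinearMap ⊤).toAddSubgroup := by
    apply SetLike.coe_injective
    change Set.range (OM j d) = (OM j d) '' Set.univ
    exact Set.image_univ.symm
  rw [h3]
  exact h2

theorem matrix_case {D : Type} [DivisionRing D] {L : Type} [Field L] [NumberField L]
    (j : L →+* D) {d : ℕ} (Γ : Subgroup (Matrix (Fin d) (Fin d) D)ˣ) (hE : Emb Γ)
    (hΓ : ∀ O : Subring (Matrix (Fin d) (Fin d) D), O.toAddSubgroup.FG →
      ∃ n : ℕ, 1 ≤ n ∧ Γ.relIndex (Gn O n) ≠ 0) :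
    ¬ (3 ≤ d) ∧ ¬ (2 ≤ d ∧ 3 ≤ Module.finrank ℚ L) := by
  obtain ⟨n, hn, hi⟩ := hΓ _ (OM_fg j d)
  have hcast : ∀ m : ℕ, m ≠ 0 → (m : D) ≠ 0 := by
    intro m hm
    have : (j (m : L)) ≠ 0 := by
      rw [Ne, map_eq_zero]; exact_mod_cast hm
    simpa using this
  have hB : ∀ n : ℕ, n ≠ 0 → ∀ z : Matrix (Fin d) (Fin d) D, (n : Matrix (Fin d) (Fin d) D) * z = 0 → z = 0 := by
    intro m hm z hz
    rw [← nsmul_eq_mul] at hz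
    ext a b
    have := congrFun (congrFun hz a) b
    simpa [hcast m hm, hm] using this
  have hsO : ∀ a b : Fin d, Matrix.single a b (1 : D) ∈ (OM j d).range := by
    intro a b
    refine ⟨Matrix.single a b 1, ?_⟩
    change (Matrix.single a b 1).map (j.comp (algebraMap (𝓞 L) L)) = _
    rw [Matrix.map_single, map_one]
  constructor
  · intro hd
    let i0 : Fin d := ⟨0, by omega⟩
    let i1 : Fin d := ⟨1, by omega⟩
    let i2 : Fin d := ⟨2, by omega⟩
    have h01 : i0 ≠ i1 := by simp [i0, i1]
    have h02 : i0 ≠ i2 := by simp [i0, i2]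
    have h12 : i1 ≠ i2 := by simp [i1, i2]
    set x := Matrix.single i0 i1 (1 : D) with hx
    set y := Matrix.single i1 i2 (1 : D) with hy
    have hxx : x * x = 0 := by rw [hx, Matrix.single_mul_single_of_ne _ _ _ _ h01.symm]
    have hyy : y * y = 0 := by rw [hy, Matrix.single_mul_single_of_ne _ _ _ _ h12.symm]
    have hyx : y * x = 0 := by rw [hx, hy, Matrix.single_mul_single_of_ne _ _ _ _ h02.symm]
    have hxy : x * y ≠ 0 := by
      rw [hx, hy, Matrix.single_mul_single_same]
      intro h
      have := congrFun (congrFun h i0) i2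
      simp at this
    have hny : ((n : Matrix (Fin d) (Fin d) D) * y) * (n * y) = 0 := by
      rw [mul_assoc, ← mul_assoc y, ← (Nat.cast_commute n y).eq, mul_assoc, hyy]; simp
    have hpow : ∀ a : ℕ, x * (((oneAdd _ hny) ^ a : (Matrix (Fin d) (Fin d) D)ˣ) : Matrix (Fin d) (Fin d) D) * x = 0 := by
      intro a
      rw [pow_oneAdd, mul_add, mul_one, add_mul, hxx, mul_assoc, mul_assoc, mul_assoc, hyx]; simp
    obtain ⟨a, ha, hc⟩ := core5 hB Γ hE _ n hn hi x hxx (hsO _ _) (oneAdd _ hny)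
      ⟨⟨y, hsO _ _, rfl⟩, ⟨-y, Subring.neg_mem _ (hsO _ _), by
        change 1 - (n : Matrix (Fin d) (Fin d) D) * y = _
        noncomm_ring⟩⟩ (by
        intro a
        obtain ⟨k, rfl | rfl⟩ := a.eq_nat_or_neg
        · exact_mod_cast hpow k
        · have h1 : oneAdd ((n : Matrix (Fin d) (Fin d) D) * (-y)) (by simpa using hny) = (oneAdd _ hny)⁻¹ := by
            apply Units.ext
            change 1 + (n : Matrix (Fin d) (Fin d) D) * (-y) = 1 - n * y
            noncomm_ring
          rw [zpow_neg, ← inv_zpow, ← h1, zpow_natCast, pow_oneAdd, mul_add, mul_one, add_mul, hxx,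
            mul_assoc, mul_assoc, mul_assoc, neg_mul, hyx]; simp)
    rw [pow_oneAdd, mul_add, add_mul, one_mul, mul_one, add_right_inj, mul_assoc, mul_assoc, hyx] at hc
    simp only [mul_zero] at hc
    have h1 : x * ((a : Matrix (Fin d) (Fin d) D) * (n * y)) = ((a * n : ℕ) : Matrix (Fin d) (Fin d) D) * (x * y) := by
      push_cast
      rw [← mul_assoc, ← mul_assoc, ← (Nat.cast_commute a x).eq, mul_assoc _ x, ← (Nat.cast_commute n x).eq]
      noncomm_ring
    rw [h1] at hc
    exact hxy (hB _ (by positivity) _ hc.symm)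
  · rintro ⟨hd, hL⟩
    obtain ⟨u, hu, ⟨y, hy⟩, ⟨y', hy'⟩⟩ := exists_unit_cong L hL n hn
    let i0 : Fin d := ⟨0, by omega⟩
    let i1 : Fin d := ⟨1, by omega⟩
    have h01 : i0 ≠ i1 := by simp [i0, i1]
    set x := Matrix.single i0 i1 (1 : D) with hx
    have hxx : x * x = 0 := by rw [hx, Matrix.single_mul_single_of_ne _ _ _ _ h01.symm]
    let φ : (Fin d → 𝓞 L) →+* Matrix (Fin d) (Fin d) D :=
      (OM j d).comp (Matrix.diagonalRingHom (Fin d) (𝓞 L))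
    have hφ : ∀ v, φ v = Matrix.diagonal (fun k => j (v k : L)) := by
      intro v
      change (Matrix.diagonal v).map (j.comp (algebraMap (𝓞 L) L)) = _
      rw [Matrix.diagonal_map (by simp)]
      rfl
    let w : (Fin d → 𝓞 L)ˣ := MulEquiv.piUnits.symm (Pi.mulSingle i0 u)
    have hw0 : ∀ (a : ℕ), ((w ^ a : (Fin d → 𝓞 L)ˣ) : Fin d → 𝓞 L) i0 = (u ^ a : (𝓞 L)ˣ) := by
      intro a
      simp [w, MulEquiv.piUnits]
    have hw1 : ∀ (a : ℕ), ((w ^ a : (Fin d → 𝓞 L)ˣ) : Fin d → 𝓞 L) i1 = 1 := by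
      intro a
      simp [w, MulEquiv.piUnits, h01.symm]
    let h : (Matrix (Fin d) (Fin d) D)ˣ := Units.map (φ : _ →* _) w
    obtain ⟨a, ha, hc⟩ := core5 hB Γ hE _ n hn hi x hxx (hsO _ _) h
      (by
        have hr : ∀ v, φ v ∈ (OM j d).range := fun v => ⟨_, rfl⟩
        refine ⟨⟨φ (Pi.single i0 y), hr _, ?_⟩, ⟨φ (Pi.single i0 y'), hr _, ?_⟩⟩
        · change φ (w : Fin d → 𝓞 L) = _
          rw [← map_natCast φ, ← map_mul, ← map_one φ, ← map_add]
          congr 1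
          funext k
          by_cases hk : k = i0
          · subst hk; simp [w, MulEquiv.piUnits, hy]
          · simp [w, MulEquiv.piUnits, hk]
        · change φ ((w⁻¹ : (Fin d → 𝓞 L)ˣ) : Fin d → 𝓞 L) = _
          rw [← map_natCast φ, ← map_mul, ← map_one φ, ← map_add]
          congr 1
          funext k
          by_cases hk : k = i0
          · subst hk; simp [w, MulEquiv.piUnits]; exact hy'
          · simp [w, MulEquiv.piUnits, hk])
      (by
        intro a
        have : ((h ^ a : (Matrix (Fin d) (Fin d) D)ˣ) : Matrix (Fin d) (Fin d) D) = φ ((w ^ a : (Fin d → 𝓞 L)ˣ) : Fin d → 𝓞 L) := by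
          simp only [h]
          rw [← map_zpow]; rfl
        rw [this, hφ, hx]
        ext p q
        rw [Matrix.mul_apply]
        apply Finset.sum_eq_zero
        intro r _
        rw [Matrix.mul_diagonal, Matrix.single_apply, Matrix.single_apply]
        by_cases h1 : i0 = p ∧ i1 = r
        · have : ¬ (i0 = r ∧ i1 = q) := fun h2 => h01 (h2.1.trans h1.2.symm)
          simp [this]
        · simp [h1])
    have h1 : ((h ^ a : (Matrix (Fin d) (Fin d) D)ˣ) : Matrix (Fin d) (Fin d) D) = φ ((w ^ a : (Fin d → 𝓞 L)ˣ) : Fin d → 𝓞 L) := by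
          simp only [h]
          rw [← map_pow]; rfl
    rw [h1, hφ] at hc
    have h2 := congrFun (congrFun hc i0) i1
    rw [Matrix.diagonal_mul, Matrix.mul_diagonal, hx, Matrix.single_apply_same, one_mul, mul_one,
      hw0, hw1] at h2
    have h3 : ((u ^ a : (𝓞 L)ˣ) : 𝓞 L) = 1 := by
      have := j.injective h2
      exact_mod_cast this
    exact hu a ha (Units.ext h3)

end FbF


set_option linter.unusedSectionVars false
namespace FbF
open MeasureTheory

theorem mink {ι : Type} [Fintype ι] [DecidableEq ι] [Nonempty ι] (M : Matrix ι ι ℝ) (hM : |M.det| = 1) :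
    ∃ v : ι → ℤ, v ≠ 0 ∧ ∀ i, |(M.mulVec (fun k => (v k : ℝ))) i| ≤ 2 := by
  classical
  let b := Pi.basisFun ℝ ι
  let L : AddSubgroup (ι → ℝ) := (Submodule.span ℤ (Set.range b)).toAddSubgroup
  have hfund : IsAddFundamentalDomain L (ZSpan.fundamentalDomain b) volume :=
    ZSpan.isAddFundamentalDomain' b volume
  let T : (ι → ℝ) →ₗ[ℝ] (ι → ℝ) := Matrix.toLin' M
  have hT : LinearMap.det T = M.det := LinearMap.det_toLin' M
  let s : Set (ι → ℝ) := T ⁻¹' (Metric.closedBall 0 2)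
  have hs : volume s = ENNReal.ofReal (4 ^ Fintype.card ι) := by
    have h1 : LinearMap.det T ≠ 0 := by
      rw [hT]; intro h; rw [h] at hM; simp at hM
    have := Measure.addHaar_preimage_linearMap (volume : Measure (ι → ℝ)) h1 (Metric.closedBall 0 2)
    simp only [s]
    rw [this, hT, abs_inv, hM, Real.volume_pi_closedBall _ (by norm_num)]
    norm_num
  have hF : volume (ZSpan.fundamentalDomain b) = 1 := by
    rw [ZSpan.volume_fundamentalDomain]
    have : (Matrix.of ⇑b) = 1 := by
      ext i k
      simp [b, Matrix.one_apply, Pi.single_apply, eq_comm]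
    rw [this]; simp
  have hcount : Countable L := by
    change Countable (Submodule.span ℤ (Set.range b))
    infer_instance
  obtain ⟨x, hx0, hxs⟩ := exists_ne_zero_mem_lattice_of_measure_mul_two_pow_lt_measure (L := L)
    (s := s) hfund (by
      intro x hx
      simp only [s, Set.mem_preimage, map_neg] at hx ⊢
      simpa using hx)
    (by
      apply Convex.linear_preimage
      exact convex_closedBall 0 2) (by
      rw [hF, hs, one_mul]
      simp only [Module.finrank_fintype_fun_eq_card]
      rw [show (2 : ENNReal) = ENNReal.ofReal 2 by simp, ← ENNReal.ofReal_pow (by norm_num)]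
      rw [ENNReal.ofReal_lt_ofReal_iff (by positivity)]
      exact pow_lt_pow_left₀ (by norm_num) (by norm_num) Fintype.card_ne_zero)
  have hxL : (x : ι → ℝ) ∈ Submodule.span ℤ (Set.range b) := x.2
  rw [Module.Basis.mem_span_iff_repr_mem] at hxL
  choose v hv using hxL
  have hxv : (x : ι → ℝ) = fun k => (v k : ℝ) := by
    funext k
    have := hv k
    simpa [b] using this.symm
  refine ⟨v, ?_, ?_⟩
  · rintro rfl
    apply hx0
    apply Subtype.ext
    rw [hxv]; funext k; simp
  · intro i
    have h1 : ‖T x‖ ≤ 2 := by simpa [s] using hxs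
    have h2 := (norm_le_pi_norm (T x) i).trans h1
    rw [hxv] at h2
    simpa [T] using h2

/-- entrywise L1 norm -/
def ent {ι : Type} [Fintype ι] (M : Matrix ι ι ℝ) : ℝ := ∑ i, ∑ k, |M i k|

section
variable {ι : Type} [Fintype ι] [DecidableEq ι]

theorem le_ent (M : Matrix ι ι ℝ) (i k : ι) : |M i k| ≤ ent M :=
  (Finset.single_le_sum (f := fun k => |M i k|) (fun _ _ => abs_nonneg _) (Finset.mem_univ k)).trans
    (Finset.single_le_sum (f := fun i => ∑ k, |M i k|)
      (fun _ _ => Finset.sum_nonneg fun _ _ => abs_nonneg _) (Finset.mem_univ i))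

theorem ent_nonneg (M : Matrix ι ι ℝ) : 0 ≤ ent M :=
  Finset.sum_nonneg fun _ _ => Finset.sum_nonneg fun _ _ => abs_nonneg _

theorem ent_le (M : Matrix ι ι ℝ) (C : ℝ) (h : ∀ i k, |M i k| ≤ C) :
    ent M ≤ (Fintype.card ι) * ((Fintype.card ι) * C) := by
  have h1 : ∀ i, ∑ k, |M i k| ≤ (Fintype.card ι) * C := by
    intro i
    have := Finset.sum_le_card_nsmul Finset.univ (fun k => |M i k|) C (fun k _ => h i k)
    simpa using this
  have := Finset.sum_le_card_nsmul Finset.univ (fun i => ∑ k, |M i k|) _ (fun i _ => h1 i)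
  simpa [ent] using this

theorem ent_add (M N : Matrix ι ι ℝ) : ent (M + N) ≤ ent M + ent N := by
  unfold ent
  rw [← Finset.sum_add_distrib]
  apply Finset.sum_le_sum
  intro i _
  rw [← Finset.sum_add_distrib]
  apply Finset.sum_le_sum
  intro k _
  exact abs_add_le _ _

theorem ent_smul (r : ℝ) (M : Matrix ι ι ℝ) : ent (r • M) = |r| * ent M := by
  unfold ent
  simp [abs_mul, Finset.mul_sum]

theorem ent_mul (M N : Matrix ι ι ℝ) : ent (M * N) ≤ ent M * ent N := by
  have h1 : ∀ i k, |(M * N) i k| ≤ ∑ j, |M i j| * |N j k| := by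
    intro i k
    rw [Matrix.mul_apply]
    refine (Finset.abs_sum_le_sum_abs _ _).trans (le_of_eq ?_)
    simp [abs_mul]
  calc ent (M * N) ≤ ∑ i, ∑ k, ∑ j, |M i j| * |N j k| :=
        Finset.sum_le_sum fun i _ => Finset.sum_le_sum fun k _ => h1 i k
    _ = ∑ i, ∑ j, |M i j| * ∑ k, |N j k| := by
        apply Finset.sum_congr rfl
        intro i _
        rw [Finset.sum_comm]
        simp [Finset.mul_sum]
    _ ≤ ∑ i, ∑ j, |M i j| * ent N := by
        refine Finset.sum_le_sum fun i _ => Finset.sum_le_sum fun j _ => ?_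
        apply mul_le_mul_of_nonneg_left _ (abs_nonneg _)
        exact Finset.single_le_sum (f := fun i => ∑ k, |N i k|)
          (fun _ _ => Finset.sum_nonneg fun _ _ => abs_nonneg _) (Finset.mem_univ j)
    _ = ent M * ent N := by
        unfold ent
        simp [Finset.sum_mul]

theorem det_bound (M : Matrix ι ι ℝ) (C : ℝ) (h : ∀ i k, |M i k| ≤ C) :
    |M.det| ≤ (Fintype.card ι).factorial * C ^ Fintype.card ι := by
  have := Matrix.det_le (A := M) (abv := AbsoluteValue.abs) (x := C) h
  simpa using this

theorem adj_bound (M : Matrix ι ι ℝ) (C : ℝ) (hC : 1 ≤ C) (h : ∀ i k, |M i k| ≤ C) (i k : ι) :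
    |M.adjugate i k| ≤ (Fintype.card ι).factorial * C ^ Fintype.card ι := by
  rw [Matrix.adjugate_apply]
  apply det_bound
  intro a c
  rw [Matrix.updateRow_apply]
  split_ifs
  · rw [Pi.single_apply]; split_ifs <;> simp <;> linarith
  · exact h a c
end

end FbF


set_option linter.unusedSectionVars false
namespace FbF

section
variable {ι : Type} [Fintype ι] [DecidableEq ι] {A : Type} [Ring A] [Algebra ℝ A]
  (β : Module.Basis ι ℝ A)

noncomputable def nrm (x : A) : ℝ := ent (Algebra.leftMulMatrix β x)

theorem nrm_nonneg (x : A) : 0 ≤ nrm β x := ent_nonneg _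
theorem nrm_add (x y : A) : nrm β (x + y) ≤ nrm β x + nrm β y := by
  unfold nrm; rw [map_add]; exact ent_add _ _
theorem nrm_mul (x y : A) : nrm β (x * y) ≤ nrm β x * nrm β y := by
  unfold nrm; rw [map_mul]; exact ent_mul _ _
theorem nrm_smul (r : ℝ) (x : A) : nrm β (r • x) = |r| * nrm β x := by
  unfold nrm; rw [map_smul]; exact ent_smul _ _
theorem nrm_zero : nrm β 0 = 0 := by
  have := nrm_smul β 0 0
  simpa using this
theorem nrm_sum {κ : Type} (s : Finset κ) (f : κ → A) : nrm β (∑ i ∈ s, f i) ≤ ∑ i ∈ s, nrm β (f i) := by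
  classical
  induction s using Finset.induction_on with
  | empty => simp [nrm_zero]
  | insert a s ha ih =>
    rw [Finset.sum_insert ha, Finset.sum_insert ha]
    exact (nrm_add β _ _).trans (add_le_add le_rfl ih)

theorem nrm_le_of_repr (x : A) (C : ℝ) (h : ∀ i, |β.repr x i| ≤ C) :
    nrm β x ≤ C * ∑ i, nrm β (β i) := by
  conv_lhs => rw [← β.sum_repr x]
  refine (nrm_sum β _ _).trans ?_
  rw [Finset.mul_sum]
  refine Finset.sum_le_sum fun i _ => ?_
  rw [nrm_smul]
  exact mul_le_mul_of_nonneg_right (h i) (nrm_nonneg β _)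

theorem repr_le_nrm (x : A) (i : ι) : |β.repr x i| ≤ nrm β x * ∑ k, |β.repr 1 k| := by
  have h := congrFun (Algebra.leftMulMatrix_mulVec_repr β x 1) i
  rw [mul_one] at h
  rw [← h, Matrix.mulVec, dotProduct, Finset.mul_sum]
  refine (Finset.abs_sum_le_sum_abs _ _).trans (Finset.sum_le_sum fun k _ => ?_)
  rw [abs_mul]
  exact mul_le_mul_of_nonneg_right (le_ent _ _ _) (abs_nonneg _)

theorem nrm_eq_zero (x : A) (h : nrm β x = 0) : x = 0 := by
  apply β.repr.injective
  ext i
  have := repr_le_nrm β x i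
  rw [h, zero_mul] at this
  simpa using this

variable (Λ : Subring A) (hΛ : ∀ x, x ∈ Λ ↔ ∀ i, ∃ m : ℤ, β.repr x i = m)

theorem lat_matrix (hΛ : ∀ x, x ∈ Λ ↔ ∀ i, ∃ m : ℤ, β.repr x i = m) (x : A) (hx : x ∈ Λ) : ∃ M : Matrix ι ι ℤ,
    Algebra.leftMulMatrix β x = M.map (Int.cast : ℤ → ℝ) := by
  have hb : ∀ k, β k ∈ Λ := by
    intro k
    rw [hΛ]
    intro i
    rw [β.repr_self, Finsupp.single_apply]
    exact ⟨if k = i then 1 else 0, by split_ifs <;> simp⟩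
  have : ∀ k i, ∃ m : ℤ, β.repr (x * β k) i = m := fun k => (hΛ _).1 (Λ.mul_mem hx (hb k))
  choose m hm using this
  refine ⟨Matrix.of fun i k => m k i, ?_⟩
  ext i k
  rw [Algebra.leftMulMatrix_eq_repr_mul, hm]
  rfl

theorem lat_finite (hΛ : ∀ x, x ∈ Λ ↔ ∀ i, ∃ m : ℤ, β.repr x i = m) (C : ℝ) : {x : A | x ∈ Λ ∧ nrm β x ≤ C}.Finite := by
  classical
  set R := ∑ k, |β.repr 1 k| with hR
  let S : Set (ι → ℤ) := Set.Icc (fun _ => -⌈C * R⌉) (fun _ => ⌈C * R⌉)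
  have hS : S.Finite := Set.finite_Icc _ _
  refine (hS.image (fun v => ∑ i, (v i : ℝ) • β i)).subset ?_
  rintro x ⟨hx, hn⟩
  have h1 := (hΛ x).1 hx
  choose v hv using h1
  refine ⟨v, ?_, ?_⟩
  · have : ∀ i, |(v i : ℝ)| ≤ ⌈C * R⌉ := by
      intro i
      rw [← hv]
      refine (repr_le_nrm β x i).trans (le_trans ?_ (Int.le_ceil _))
      exact mul_le_mul_of_nonneg_right hn (Finset.sum_nonneg fun _ _ => abs_nonneg _)
    have h2 : ∀ i, |v i| ≤ ⌈C * R⌉ := fun i => by exact_mod_cast this i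
    exact ⟨fun i => (abs_le.1 (h2 i)).1, fun i => (abs_le.1 (h2 i)).2⟩
  · simp only [← hv]
    exact β.sum_repr x

theorem det_mul_inv_adj (u : Aˣ) : (Algebra.leftMulMatrix β (u : A)).det •
    Algebra.leftMulMatrix β ((u⁻¹ : Aˣ) : A) = (Algebra.leftMulMatrix β (u : A)).adjugate := by
  set M := Algebra.leftMulMatrix β (u : A) with hM
  set N := Algebra.leftMulMatrix β ((u⁻¹ : Aˣ) : A) with hN
  have h : M * N = 1 := by rw [hM, hN, ← map_mul, Units.mul_inv, map_one]
  calc M.det • N = (M.adjugate * M) * N := by rw [Matrix.adjugate_mul]; simp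
    _ = M.adjugate := by rw [mul_assoc, h, mul_one]

theorem det_ne_zero (u : Aˣ) : (Algebra.leftMulMatrix β (u : A)).det ≠ 0 := by
  have : IsUnit (Algebra.leftMulMatrix β (u : A)) := u.isUnit.map _
  exact ((Matrix.isUnit_iff_isUnit_det _).1 this).ne_zero

theorem cocompact (hΛ : ∀ x, x ∈ Λ ↔ ∀ i, ∃ m : ℤ, β.repr x i = m) [Nonempty ι] (hdiv : ∀ x ∈ Λ, x ≠ 0 → IsUnit x) (n : ℕ) (hn : 1 ≤ n) :
    ∃ C : ℝ, ∀ g : Aˣ, |(Algebra.leftMulMatrix β (g : A)).det| = 1 →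
      ∃ γ ∈ Gn Λ n, ∃ c : Aˣ, g = γ * c ∧ nrm β c ≤ C ∧ nrm β ((c⁻¹ : Aˣ) : A) ≤ C := by
  classical
  set Cz := 2 * ∑ i, nrm β (β i) with hCz
  set E := max 1 Cz with hE
  set C3 : ℝ := (Fintype.card ι).factorial * E ^ Fintype.card ι with hC3
  set Q : ℕ := (⌊C3⌋₊).factorial with hQ
  have hQ0 : 0 < Q := Nat.factorial_pos _
  set q : ℕ := n * Q with hq
  have hq0 : 0 < q := Nat.mul_pos hn hQ0
  have : NeZero q := ⟨hq0.ne'⟩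
  let X : Set Aˣ := {x | (x : A) ∈ Λ ∧ |(Algebra.leftMulMatrix β (x : A)).det| ≤ C3}
  have hXinv : ∀ x ∈ X, (Q : A) * ((x⁻¹ : Aˣ) : A) ∈ Λ := by
    rintro x ⟨hx, hdx⟩
    obtain ⟨M, hM⟩ := lat_matrix β Λ hΛ x hx
    have hd : (Algebra.leftMulMatrix β (x : A)).det = (M.det : ℝ) := by
      rw [hM]
      exact (RingHom.map_det (Int.castRingHom ℝ) M).symm
    have hd0 : M.det ≠ 0 := by
      intro h
      have := det_ne_zero β x
      rw [hd, h] at this; simp at this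
    have hdvd : M.det ∣ (Q : ℤ) := by
      rw [← Int.natAbs_dvd, Int.natCast_dvd_natCast]
      apply Nat.dvd_factorial (Int.natAbs_pos.2 hd0)
      apply Nat.le_floor
      rw [hd] at hdx
      rwa [Nat.cast_natAbs, Int.cast_abs]
    obtain ⟨t, ht⟩ := hdvd
    have hadj := det_mul_inv_adj β x
    have h1Λ := (hΛ 1).1 Λ.one_mem
    choose w hw using h1Λ
    have h2 : ∀ i, ∃ m : ℤ, (M.det : ℝ) * β.repr ((x⁻¹ : Aˣ) : A) i = m := by
      intro i
      have h3 := congrFun (Algebra.leftMulMatrix_mulVec_repr β ((x⁻¹ : Aˣ) : A) 1) i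
      rw [mul_one] at h3
      rw [← h3, ← hd, ← smul_eq_mul, ← Pi.smul_apply, ← Matrix.smul_mulVec, hadj, hM]
      have h4 : (M.map (Int.cast : ℤ → ℝ)).adjugate = M.adjugate.map (Int.cast : ℤ → ℝ) :=
        (RingHom.map_adjugate (Int.castRingHom ℝ) M).symm
      rw [h4]
      refine ⟨∑ k, M.adjugate i k * w k, ?_⟩
      simp [Matrix.mulVec, dotProduct, hw]
    rw [hΛ]
    intro i
    obtain ⟨m, hm⟩ := h2 i
    refine ⟨t * m, ?_⟩
    have h5 : (Q : A) * ((x⁻¹ : Aˣ) : A) = (Q : ℝ) • ((x⁻¹ : Aˣ) : A) := by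
      rw [← nsmul_eq_mul]; exact (Nat.cast_smul_eq_nsmul ℝ _ _).symm
    have h6 : (Q : ℝ) = M.det * t := by exact_mod_cast ht
    rw [h5, map_smul, Finsupp.smul_apply, smul_eq_mul, h6]
    rw [Int.cast_mul, ← hm]; ring
  -- residue classes
  have hcoord : ∀ x : Aˣ, ∃ v : ι → ℤ, x ∈ X → ∀ i, β.repr (x : A) i = v i := by
    intro x
    by_cases hx : x ∈ X
    · choose v hv using (hΛ x).1 hx.1
      exact ⟨v, fun _ => hv⟩
    · exact ⟨0, fun h => absurd h hx⟩
  choose v hv using hcoord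
  let cl : Aˣ → (ι → ZMod q) := fun x i => (v x i : ZMod q)
  have hrep : ∀ c : ι → ZMod q, ∃ y : Aˣ, (∃ x ∈ X, cl x = c) → y ∈ X ∧ cl y = c := by
    intro c
    by_cases h : ∃ x ∈ X, cl x = c
    · obtain ⟨x, hx⟩ := h
      exact ⟨x, fun _ => hx⟩
    · exact ⟨1, fun h' => absurd h' h⟩
  choose rep hrep using hrep
  obtain ⟨R1, hR1⟩ := Finite.bddAbove_range (fun c => nrm β (rep c : A))
  obtain ⟨R2, hR2⟩ := Finite.bddAbove_range (fun c => nrm β ((rep c)⁻¹ : Aˣ))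
  set C4 : ℝ := (Fintype.card ι) * ((Fintype.card ι) * C3) with hC4
  refine ⟨max (R1 * C4) (Cz * R2), ?_⟩
  intro g hg
  obtain ⟨u, hu0, hu⟩ := mink (Algebra.leftMulMatrix β ((g⁻¹ : Aˣ) : A)) (by
    have h1 : (Algebra.leftMulMatrix β (g : A)).det * (Algebra.leftMulMatrix β ((g⁻¹ : Aˣ) : A)).det = 1 := by
      rw [← Matrix.det_mul, ← map_mul, Units.mul_inv, map_one, Matrix.det_one]
    have h2 := congrArg abs h1
    rwa [abs_mul, hg, one_mul, abs_one] at h2)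
  set x0 : A := ∑ i, (u i : ℝ) • β i with hx0
  have hrx : ∀ i, β.repr x0 i = u i := by
    intro i
    rw [hx0, Module.Basis.repr_sum_self]
  have hx0Λ : x0 ∈ Λ := (hΛ _).2 fun i => ⟨u i, hrx i⟩
  have hx00 : x0 ≠ 0 := by
    intro h
    apply hu0
    funext i
    have := hrx i
    rw [h] at this
    simp at this
    simpa using this.symm
  obtain ⟨x, hxx0⟩ := hdiv x0 hx0Λ hx00
  set z : Aˣ := g⁻¹ * x with hz
  have hzc : ∀ i, |β.repr (z : A) i| ≤ 2 := by
    intro i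
    rw [hz, Units.val_mul, hxx0, ← Algebra.leftMulMatrix_mulVec_repr]
    have h9 : (⇑(β.repr x0) : ι → ℝ) = fun k => (u k : ℝ) := funext hrx
    rw [h9]
    exact hu i
  have hzn : nrm β (z : A) ≤ Cz := nrm_le_of_repr β _ _ hzc
  have hze : ∀ i k, |Algebra.leftMulMatrix β (z : A) i k| ≤ E := fun i k =>
    (le_ent _ i k).trans (hzn.trans (le_max_right _ _))
  have hdz : |(Algebra.leftMulMatrix β (z : A)).det| ≤ C3 := det_bound _ _ hze
  have hdxz : |(Algebra.leftMulMatrix β (x : A)).det| = |(Algebra.leftMulMatrix β (z : A)).det| := by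
    have : (x : A) = g * z := by rw [hz]; simp
    rw [this, map_mul, Matrix.det_mul, abs_mul, hg, one_mul]
  have hxX : x ∈ X := ⟨by rw [hxx0]; exact hx0Λ, by rw [hdxz]; exact hdz⟩
  have hdx1 : 1 ≤ |(Algebra.leftMulMatrix β (z : A)).det| := by
    rw [← hdxz]
    obtain ⟨M, hM⟩ := lat_matrix β Λ hΛ x hxX.1
    have hd : (Algebra.leftMulMatrix β (x : A)).det = (M.det : ℝ) := by
      rw [hM]
      exact (RingHom.map_det (Int.castRingHom ℝ) M).symm
    have hd0 : M.det ≠ 0 := by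
      intro h
      have := det_ne_zero β x
      rw [hd, h] at this; simp at this
    rw [hd]
    exact_mod_cast Int.one_le_abs hd0
  have hzi : nrm β ((z⁻¹ : Aˣ) : A) ≤ C4 := by
    apply ent_le
    intro i k
    have h1 := congrFun (congrFun (det_mul_inv_adj β z) i) k
    rw [Matrix.smul_apply, smul_eq_mul] at h1
    have h2 := adj_bound _ E (le_max_left _ _) hze i k
    rw [← h1, abs_mul] at h2
    refine le_trans ?_ h2
    exact le_mul_of_one_le_left (abs_nonneg _) hdx1
  obtain ⟨hyX, hycl⟩ := hrep (cl x) ⟨x, hxX, rfl⟩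
  set y := rep (cl x) with hy
  have hdiff : ∃ t ∈ Λ, (x : A) = y + (n : A) * (Q : A) * t := by
    have h1 : ∀ i, ∃ m : ℤ, v x i - v y i = q * m := by
      intro i
      have := congrFun hycl i
      have h2 := (ZMod.intCast_eq_intCast_iff_dvd_sub _ _ _).1 this
      exact h2
    choose m hm using h1
    refine ⟨∑ i, (m i : ℝ) • β i, (hΛ _).2 fun i => ⟨m i, by rw [Module.Basis.repr_sum_self]⟩, ?_⟩
    apply β.repr.injective
    ext i
    have h5 : ∀ w : A, (n : A) * (Q : A) * w = ((q : ℕ) : ℝ) • w := by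
      intro w
      rw [← Nat.cast_mul, ← nsmul_eq_mul]; exact (Nat.cast_smul_eq_nsmul ℝ _ _).symm
    rw [h5, map_add, Finsupp.add_apply, map_smul, Finsupp.smul_apply, Module.Basis.repr_sum_self,
      hv x hxX, hv y hyX, smul_eq_mul]
    have := hm i
    have h6 : (v x i : ℝ) - v y i = q * m i := by exact_mod_cast this
    linarith
  obtain ⟨t, ht, hxy⟩ := hdiff
  have hcomm : ∀ w : A, (n : A) * (Q : A) * t * w = (n : A) * (t * ((Q : A) * w)) := by
    intro w
    rw [mul_assoc (n : A), (Nat.cast_commute Q t).eq]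
    simp only [mul_assoc]
  refine ⟨x * y⁻¹, ⟨⟨t * (Q * ((y⁻¹ : Aˣ) : A)), Λ.mul_mem ht (hXinv y hyX), ?_⟩,
    ⟨-(t * (Q * ((x⁻¹ : Aˣ) : A))), Λ.neg_mem (Λ.mul_mem ht (hXinv x hxX)), ?_⟩⟩, y * z⁻¹, ?_, ?_, ?_⟩
  · rw [Units.val_mul, hxy, add_mul, Units.mul_inv, hcomm]
  · rw [mul_inv_rev, inv_inv, Units.val_mul]
    have : (y : A) = x - (n : A) * (Q : A) * t := by rw [hxy]; abel
    rw [this, sub_mul, Units.mul_inv, hcomm]; noncomm_ring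
  · rw [hz]; group
  · refine le_trans ?_ (le_max_left _ _)
    rw [Units.val_mul]
    refine (nrm_mul β _ _).trans ?_
    have h1 : nrm β (y : A) ≤ R1 := hR1 ⟨cl x, rfl⟩
    exact mul_le_mul h1 hzi (nrm_nonneg β _) ((nrm_nonneg β _).trans h1)
  · refine le_trans ?_ (le_max_right _ _)
    rw [mul_inv_rev, inv_inv, Units.val_mul]
    refine (nrm_mul β _ _).trans ?_
    have h1 : nrm β ((y⁻¹ : Aˣ) : A) ≤ R2 := hR2 ⟨cl x, rfl⟩
    exact mul_le_mul hzn h1 (nrm_nonneg β _) ((nrm_nonneg β _).trans hzn)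

theorem cocompact' (hΛ : ∀ x, x ∈ Λ ↔ ∀ i, ∃ m : ℤ, β.repr x i = m) [Nonempty ι] (hdiv : ∀ x ∈ Λ, x ≠ 0 → IsUnit x) (n : ℕ) (hn : 1 ≤ n)
    (Δ : Subgroup Aˣ) (hΔ : Δ.relIndex (Gn Λ n) ≠ 0) :
    ∃ C : ℝ, ∀ g : Aˣ, |(Algebra.leftMulMatrix β (g : A)).det| = 1 →
      ∃ δ ∈ Δ ⊓ Gn Λ n, ∃ c : Aˣ, g = δ * c ∧ nrm β c ≤ C ∧ nrm β ((c⁻¹ : Aˣ) : A) ≤ C := by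
  obtain ⟨C, hC⟩ := cocompact β Λ hΛ hdiv n hn
  have hfin : Finite (Gn Λ n ⧸ Δ.subgroupOf (Gn Λ n)) := by
    apply Nat.finite_of_card_ne_zero
    exact hΔ
  obtain ⟨R1, hR1⟩ := Finite.bddAbove_range
    (fun c : Gn Λ n ⧸ Δ.subgroupOf (Gn Λ n) => nrm β ((c.out : Aˣ) : A))
  obtain ⟨R2, hR2⟩ := Finite.bddAbove_range
    (fun c : Gn Λ n ⧸ Δ.subgroupOf (Gn Λ n) => nrm β (((c.out : Aˣ)⁻¹ : Aˣ) : A))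
  refine ⟨max (R2 * C) (C * R1), fun g hg => ?_⟩
  obtain ⟨γ, hγ, c, rfl, h1, h2⟩ := hC g hg
  set k : Gn Λ n ⧸ Δ.subgroupOf (Gn Λ n) := QuotientGroup.mk (⟨γ, hγ⟩ : Gn Λ n)⁻¹ with hk
  have h3 : (QuotientGroup.mk k.out : Gn Λ n ⧸ Δ.subgroupOf (Gn Λ n)) = QuotientGroup.mk (⟨γ, hγ⟩ : Gn Λ n)⁻¹ :=
    Quotient.out_eq k
  rw [QuotientGroup.eq] at h3
  have h4 : ((k.out : Aˣ))⁻¹ * γ⁻¹ ∈ Δ := h3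
  refine ⟨γ * (k.out : Aˣ), ⟨?_, (Gn Λ n).mul_mem hγ k.out.2⟩, (k.out : Aˣ)⁻¹ * c, by group, ?_, ?_⟩
  · have := Δ.inv_mem h4
    simpa using this
  · refine le_trans ?_ (le_max_left _ _)
    rw [Units.val_mul]
    refine (nrm_mul β _ _).trans ?_
    have h5 : nrm β (((k.out : Aˣ)⁻¹ : Aˣ) : A) ≤ R2 := hR2 ⟨k, rfl⟩
    exact mul_le_mul h5 h1 (nrm_nonneg β _) ((nrm_nonneg β _).trans h5)
  · refine le_trans ?_ (le_max_right _ _)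
    rw [mul_inv_rev, inv_inv, Units.val_mul]
    refine (nrm_mul β _ _).trans ?_
    have h5 : nrm β ((k.out : Aˣ) : A) ≤ R1 := hR1 ⟨k, rfl⟩
    exact mul_le_mul h2 h5 (nrm_nonneg β _) ((nrm_nonneg β _).trans h2)

end
end FbF


set_option linter.unusedSectionVars false
namespace FbF
open Relation

structure Rep (A : Type) [Ring A] [Algebra ℝ A] (d : ℕ) where
  τ : A →ₐ[ℝ] Matrix (Fin d) (Fin d) ℂ
  s : Matrix (Fin d) (Fin d) ℂ →ₗ[ℝ] A
  f0 : A
  s_mul : ∀ x y, s (x * y) = s x * s y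
  f0_mul : ∀ x, f0 * s x = 0
  mul_f0 : ∀ x, s x * f0 = 0
  f0_idem : f0 * f0 = f0
  f0_add : f0 + s 1 = 1
  τ_s : ∀ x, τ (s x) = x

section
variable {ι : Type} [Fintype ι] [DecidableEq ι] {A : Type} [Ring A] [Algebra ℝ A]
  (β : Module.Basis ι ℝ A) {d : ℕ} (r : Rep A d)

noncomputable def Rep.θ0 : Matrix (Fin d) (Fin d) ℂ →* A where
  toFun x := r.f0 + r.s x
  map_one' := r.f0_add
  map_mul' x y := by
    rw [add_mul, mul_add, mul_add, r.f0_mul, r.mul_f0, r.f0_idem, r.s_mul]; abel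

noncomputable def Rep.θ : (Matrix (Fin d) (Fin d) ℂ)ˣ →* Aˣ := Units.map r.θ0

theorem Rep.θ_val (x : (Matrix (Fin d) (Fin d) ℂ)ˣ) : (r.θ x : A) = r.f0 + r.s x := rfl

theorem Rep.θ_conj (x : (Matrix (Fin d) (Fin d) ℂ)ˣ) (y : Matrix (Fin d) (Fin d) ℂ) :
    (r.θ x : A) * r.s y * ((r.θ x)⁻¹ : Aˣ) = r.s (x * y * ((x⁻¹ : (Matrix (Fin d) (Fin d) ℂ)ˣ) : Matrix (Fin d) (Fin d) ℂ)) := by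
  rw [← map_inv, r.θ_val, r.θ_val, add_mul, r.f0_mul, zero_add, mul_add, mul_assoc, r.mul_f0,
    mul_zero, zero_add, r.s_mul, r.s_mul]

/-- absolute value of determinant -/
noncomputable def Rep.χ : (Matrix (Fin d) (Fin d) ℂ)ˣ →* ℝ where
  toFun x := |(Algebra.leftMulMatrix β (r.θ x : A)).det|
  map_one' := by simp
  map_mul' x y := by simp [abs_mul]

theorem Rep.χ_pos (x) : 0 < r.χ β x := abs_pos.2 (det_ne_zero β _)

theorem Rep.χ_conj (x y) : r.χ β (x * y * x⁻¹) = r.χ β y := by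
  rw [map_mul, map_mul, mul_comm, ← mul_assoc, ← map_mul]; simp

variable (i0 i1 : Fin d) (h01 : i0 ≠ i1)

abbrev Mt (d : ℕ) := Matrix (Fin d) (Fin d) ℂ

theorem E01_sq (h01 : i0 ≠ i1) (z : ℂ) : Matrix.single i0 i1 z * Matrix.single i0 i1 z = 0 :=
  Matrix.single_mul_single_of_ne _ _ _ _ h01.symm _

/-- unipotent -/
def uni (z : ℂ) : (Mt d)ˣ := oneAdd (Matrix.single i0 i1 z) (E01_sq i0 i1 h01 z)

theorem uni_val (z : ℂ) : (uni i0 i1 h01 z : Mt d) = 1 + Matrix.single i0 i1 z := rfl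

theorem uni_mul (z w : ℂ) : uni i0 i1 h01 z * uni i0 i1 h01 w = uni i0 i1 h01 (z + w) := by
  apply Units.ext
  rw [Units.val_mul, uni_val, uni_val, uni_val, Matrix.single_add, add_mul, mul_add, mul_add,
    Matrix.single_mul_single_of_ne _ _ _ _ h01.symm]
  simp; abel

theorem uni_inv (z : ℂ) : (uni i0 i1 h01 z)⁻¹ = uni i0 i1 h01 (-z) := by
  apply inv_eq_of_mul_eq_one_left
  rw [uni_mul]
  apply Units.ext
  rw [uni_val]; simp

/-- diagonal units -/
noncomputable def dg : (Fin d → ℂˣ) →* (Mt d)ˣ :=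
  (Units.map (Matrix.diagonalRingHom (Fin d) ℂ).toMonoidHom).comp
    (MulEquiv.piUnits (M := fun _ : Fin d => ℂ)).symm.toMonoidHom

theorem dg_val (v : Fin d → ℂˣ) : (dg v : Mt d) = Matrix.diagonal (fun i => (v i : ℂ)) := rfl

noncomputable def two' : ℂˣ := Units.mk0 2 two_ne_zero

noncomputable def av : Fin d → ℂˣ := fun i => if i = i0 then two' else if i = i1 then two'⁻¹ else 1

theorem dg_conj (v : Fin d → ℂˣ) (i k : Fin d) (z : ℂ) :
    (dg v : Mt d) * Matrix.single i k z * ((dg v)⁻¹ : (Mt d)ˣ) = Matrix.single i k (v i * z * (v k)⁻¹) := by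
  rw [← map_inv, dg_val, dg_val]
  ext p q
  rw [Matrix.mul_diagonal, Matrix.diagonal_mul]
  simp only [Matrix.single_apply]
  split_ifs with h
  · obtain ⟨rfl, rfl⟩ := h
    simp
  · simp

theorem a_conj01 (h01 : i0 ≠ i1) (k : ℕ) (z : ℂ) :
    ((dg (av i0 i1) ^ k : (Mt d)ˣ) : Mt d) * Matrix.single i0 i1 z * (((dg (av i0 i1)) ^ k)⁻¹ : (Mt d)ˣ) = Matrix.single i0 i1 (4 ^ k * z) := by
  rw [← map_pow, dg_conj]
  congr 1
  simp [av, h01.symm, two']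
  rw [show (4 : ℂ) = 2 * 2 by norm_num, mul_pow]; ring

theorem a_conj10 (h01 : i0 ≠ i1) (k : ℕ) (z : ℂ) :
    ((dg (av i0 i1) ^ k : (Mt d)ˣ) : Mt d) * Matrix.single i1 i0 z * (((dg (av i0 i1)) ^ k)⁻¹ : (Mt d)ˣ) = Matrix.single i1 i0 ((4 ^ k)⁻¹ * z) := by
  rw [← map_pow, dg_conj]
  congr 1
  simp [av, h01.symm, two']
  rw [show (4 : ℂ) = 2 * 2 by norm_num, mul_pow, mul_inv]; ring

theorem a_uni (k : ℕ) (z : ℂ) :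
    (dg (av i0 i1)) ^ k * uni i0 i1 h01 z * ((dg (av i0 i1)) ^ k)⁻¹ = uni i0 i1 h01 (4 ^ k * z) := by
  apply Units.ext
  rw [Units.val_mul, Units.val_mul, uni_val, uni_val, mul_add, add_mul, mul_one, Units.mul_inv,
    a_conj01 i0 i1 h01]

theorem χ_uni (z : ℂ) : r.χ β (uni i0 i1 h01 z) = 1 := by
  have h1 := r.χ_conj β ((dg (av i0 i1)) ^ 1) (uni i0 i1 h01 z)
  rw [a_uni] at h1
  have h2 : uni i0 i1 h01 (4 ^ 1 * z) = uni i0 i1 h01 z * uni i0 i1 h01 z * (uni i0 i1 h01 z * uni i0 i1 h01 z) := by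
    simp only [uni_mul]; congr 1; ring
  rw [h2] at h1
  simp only [map_mul] at h1
  have hp := r.χ_pos β (uni i0 i1 h01 z)
  set t := r.χ β (uni i0 i1 h01 z)
  have h3 : t ^ 3 = 1 := by
    have : t * (t ^ 3 - 1) = 0 := by linear_combination h1
    rcases mul_eq_zero.1 this with h | h
    · exact absurd h hp.ne'
    · linarith
  exact (pow_eq_one_iff_of_nonneg hp.le (by norm_num)).1 h3

theorem χ_a (h01 : i0 ≠ i1) : r.χ β (dg (av i0 i1)) = 1 := by
  let σ : Equiv.Perm (Fin d) := Equiv.swap i0 i1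
  let s : (Mt d)ˣ := ⟨σ.permMatrix ℂ, σ.permMatrix ℂ, by
    rw [← Matrix.permMatrix_mul]; simp [σ], by
    rw [← Matrix.permMatrix_mul]; simp [σ]⟩
  have h1 : s * dg (av i0 i1) * s⁻¹ = (dg (av i0 i1))⁻¹ := by
    apply Units.ext
    rw [← map_inv]
    change σ.permMatrix ℂ * (dg (av i0 i1) : Mt d) * σ.permMatrix ℂ = _
    rw [dg_val, dg_val, Equiv.Perm.permMatrix, PEquiv.toMatrix_toPEquiv_mul,
      PEquiv.mul_toMatrix_toPEquiv, Matrix.submatrix_submatrix]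
    have h5 : σ.symm = σ := Equiv.symm_swap _ _
    rw [h5, Function.comp_id, Function.id_comp, Matrix.submatrix_diagonal_equiv]
    congr 1
    funext p
    simp only [Function.comp, Pi.inv_apply]
    by_cases hp0 : p = i0
    · subst hp0; simp [σ, av, h01.symm]
    · by_cases hp1 : p = i1
      · subst hp1; simp [σ, av, h01.symm]
      · have : σ p = p := Equiv.swap_apply_of_ne_of_ne hp0 hp1
        rw [this]; simp [av, hp0, hp1]
  have h2 := r.χ_conj β s (dg (av i0 i1))
  rw [h1] at h2
  have h3 : r.χ β (dg (av i0 i1)) * r.χ β ((dg (av i0 i1))⁻¹) = 1 := by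
    rw [← map_mul]; simp
  rw [h2] at h3
  have hp := r.χ_pos β (dg (av i0 i1))
  nlinarith

end
end FbF


set_option linter.unusedSectionVars false
namespace FbF
open Relation

section
variable {ι : Type} [Fintype ι] [DecidableEq ι] {A : Type} [Ring A] [Algebra ℝ A]
  (β : Module.Basis ι ℝ A) {d : ℕ} (r : Rep A d)

theorem entry_bound (i0 i1 : Fin d) : ∃ C : ℝ, 0 ≤ C ∧ ∀ x : A, ‖r.τ x i0 i1‖ ≤ C * nrm β x := by
  refine ⟨(∑ k, |β.repr 1 k|) * ∑ i, ‖r.τ (β i) i0 i1‖, by positivity, fun x => ?_⟩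
  have h : r.τ x i0 i1 = ∑ i, (β.repr x i : ℂ) * r.τ (β i) i0 i1 := by
    conv_lhs => rw [← β.sum_repr x]
    rw [map_sum, Matrix.sum_apply]
    simp
  rw [h]
  refine (norm_sum_le _ _).trans ?_
  rw [Finset.mul_sum, Finset.sum_mul]
  refine Finset.sum_le_sum fun i _ => ?_
  rw [norm_mul, Complex.norm_real, Real.norm_eq_abs]
  have := repr_le_nrm β x i
  calc |β.repr x i| * ‖r.τ (β i) i0 i1‖ ≤ (nrm β x * ∑ k, |β.repr 1 k|) * ‖r.τ (β i) i0 i1‖ :=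
        mul_le_mul_of_nonneg_right this (norm_nonneg _)
    _ = _ := by ring

variable (i0 i1 : Fin d) (h01 : i0 ≠ i1)

theorem nrm_uni : ∃ C : ℝ, 0 ≤ C ∧ ∀ z : ℂ, |z.re| ≤ 1 → |z.im| ≤ 1 →
    nrm β (r.θ (uni i0 i1 h01 z) : A) ≤ C := by
  refine ⟨nrm β 1 + (nrm β (r.s (Matrix.single i0 i1 1)) + nrm β (r.s (Matrix.single i0 i1 Complex.I))),
    add_nonneg (nrm_nonneg β _) (add_nonneg (nrm_nonneg β _) (nrm_nonneg β _)), fun z h1 h2 => ?_⟩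
  have h : (r.θ (uni i0 i1 h01 z) : A) = 1 + (z.re • r.s (Matrix.single i0 i1 1) +
      z.im • r.s (Matrix.single i0 i1 Complex.I)) := by
    rw [r.θ_val, uni_val, map_add, ← add_assoc, r.f0_add, ← map_smul, ← map_smul, ← map_add]
    congr 2
    rw [Matrix.smul_single, Matrix.smul_single, ← Matrix.single_add]
    congr 1
    apply Complex.ext <;> simp
  rw [h]
  refine (nrm_add β _ _).trans (add_le_add le_rfl ((nrm_add β _ _).trans (add_le_add ?_ ?_)))
  · rw [nrm_smul]; exact mul_le_of_le_one_left (nrm_nonneg β _) h1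
  · rw [nrm_smul]; exact mul_le_of_le_one_left (nrm_nonneg β _) h2

/-- the family -/
noncomputable def fam (x y z : ℕ) : (Mt d)ˣ :=
  uni i0 i1 h01 ((x : ℂ) + y * Complex.I) * (dg (av i0 i1)) ^ z

theorem fam_χ (x y z : ℕ) : r.χ β (fam i0 i1 h01 x y z) = 1 := by
  rw [fam, map_mul, map_pow, χ_uni, χ_a β r i0 i1 h01]; simp

theorem fam_diff (x y z x' y' z' : ℕ) : ∃ w : ℂ, w.re = (x' : ℝ) - x ∧ w.im = (y' : ℝ) - y ∧
    (fam i0 i1 h01 x y z)⁻¹ * fam i0 i1 h01 x' y' z' =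
      ((dg (av i0 i1)) ^ z)⁻¹ * uni i0 i1 h01 w * (dg (av i0 i1)) ^ z' := by
  refine ⟨-((x : ℂ) + y * Complex.I) + ((x' : ℂ) + y' * Complex.I), by simp; ring, by simp; ring, ?_⟩
  rw [← uni_mul, ← uni_inv, fam, fam]
  group

theorem fam_diff2 (x y z x' y' e : ℕ) : ∃ w : ℂ, w.re = ((x' : ℝ) - x) / 4 ^ z ∧ w.im = ((y' : ℝ) - y) / 4 ^ z ∧
    (fam i0 i1 h01 x y z)⁻¹ * fam i0 i1 h01 x' y' (z + e) =
      uni i0 i1 h01 w * (dg (av i0 i1)) ^ e := by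
  obtain ⟨w, h1, h2, h3⟩ := fam_diff i0 i1 h01 x y z x' y' (z + e)
  have h4 : (w / 4 ^ z).re = w.re / 4 ^ z := by
    have : (4 : ℂ) ^ z = ((4 ^ z : ℝ) : ℂ) := by push_cast; rfl
    rw [this, Complex.div_ofReal_re]
  have h5 : (w / 4 ^ z).im = w.im / 4 ^ z := by
    have : (4 : ℂ) ^ z = ((4 ^ z : ℝ) : ℂ) := by push_cast; rfl
    rw [this, Complex.div_ofReal_im]
  refine ⟨w / 4 ^ z, by rw [h4, h1], by rw [h5, h2], ?_⟩
  have h6 := a_uni i0 i1 h01 z (w / 4 ^ z)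
  rw [mul_div_cancel₀ _ (pow_ne_zero _ (by norm_num : (4 : ℂ) ≠ 0))] at h6
  rw [h3, ← h6, pow_add]
  group

/-- neighbours are close -/
theorem fam_near : ∃ C : ℝ, 0 ≤ C ∧ ∀ x y z x' y' z' : ℕ, x ≤ x' → x' ≤ x + 1 → y ≤ y' → y' ≤ y + 1 →
    z ≤ z' → z' ≤ z + 1 →
    nrm β (r.θ ((fam i0 i1 h01 x y z)⁻¹ * fam i0 i1 h01 x' y' z') : A) ≤ C ∧
    nrm β (r.θ ((fam i0 i1 h01 x' y' z')⁻¹ * fam i0 i1 h01 x y z) : A) ≤ C := by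
  obtain ⟨C, hC0, hC⟩ := nrm_uni β r i0 i1 h01
  set N1 := max (nrm β (r.θ (dg (av i0 i1)) : A)) (nrm β ((r.θ (dg (av i0 i1)))⁻¹ : Aˣ)) with hN1
  set N2 := max N1 (nrm β (1 : A)) with hN2
  have hN20 : 0 ≤ N2 := (nrm_nonneg β 1).trans (le_max_right _ _)
  refine ⟨C * N2, mul_nonneg hC0 hN20, ?_⟩
  intro x y z x' y' z' hx hx' hy hy' hz hz'
  obtain ⟨e, rfl⟩ := Nat.exists_eq_add_of_le hz
  obtain ⟨w, h1, h2, h3⟩ := fam_diff2 i0 i1 h01 x y z x' y' e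
  have h4 : (1 : ℝ) ≤ 4 ^ z := one_le_pow₀ (by norm_num)
  have hwre : |w.re| ≤ 1 := by
    have a1 : (x : ℝ) ≤ x' := by exact_mod_cast hx
    have a2 : (x' : ℝ) ≤ x + 1 := by exact_mod_cast hx'
    rw [h1, abs_le]
    constructor
    · have : 0 ≤ ((x' : ℝ) - x) / 4 ^ z := div_nonneg (by linarith) (by linarith)
      linarith
    · rw [div_le_one (by linarith)]; linarith
  have hwim : |w.im| ≤ 1 := by
    have a1 : (y : ℝ) ≤ y' := by exact_mod_cast hy
    have a2 : (y' : ℝ) ≤ y + 1 := by exact_mod_cast hy'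
    rw [h2, abs_le]
    constructor
    · have : 0 ≤ ((y' : ℝ) - y) / 4 ^ z := div_nonneg (by linarith) (by linarith)
      linarith
    · rw [div_le_one (by linarith)]; linarith
  have he : e = 0 ∨ e = 1 := by omega
  have hpe : nrm β (r.θ ((dg (av i0 i1)) ^ e) : A) ≤ N2 ∧
      nrm β (r.θ (((dg (av i0 i1)) ^ e)⁻¹) : A) ≤ N2 := by
    rcases he with rfl | rfl
    · simp [hN2]
    · simp [hN2, hN1]
  constructor
  · rw [h3, map_mul, Units.val_mul]
    exact (nrm_mul β _ _).trans (mul_le_mul (hC w hwre hwim) hpe.1 (nrm_nonneg β _) hC0)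
  · have h5 : (fam i0 i1 h01 x' y' (z + e))⁻¹ * fam i0 i1 h01 x y z =
        ((dg (av i0 i1)) ^ e)⁻¹ * uni i0 i1 h01 (-w) := by
      rw [← uni_inv, ← mul_inv_rev, ← h3]; group
    rw [h5, map_mul, Units.val_mul, mul_comm C]
    exact (nrm_mul β _ _).trans (mul_le_mul hpe.2 (hC (-w) (by simpa using hwre) (by simpa using hwim))
      (nrm_nonneg β _) hN20)

/-- far in the diagonal direction -/
theorem fam_far1 (x y x' y' N : ℕ) :
    (((fam i0 i1 h01 x y 0)⁻¹ * fam i0 i1 h01 x' y' N : (Mt d)ˣ) : Mt d) * Matrix.single i0 i1 1 *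
     ((((fam i0 i1 h01 x y 0)⁻¹ * fam i0 i1 h01 x' y' N)⁻¹ : (Mt d)ˣ) : Mt d) =
      (4 ^ N : ℝ) • Matrix.single i0 i1 1 := by
  obtain ⟨w, h1, h2, h3⟩ := fam_diff i0 i1 h01 x y 0 x' y' N
  rw [h3]
  simp only [pow_zero, inv_one, one_mul, mul_inv_rev, Units.val_mul, uni_inv]
  have h4 := a_conj01 i0 i1 h01 N 1
  have h8 : ∀ (u a e a1 u1 : Mt d), u * a * e * (a1 * u1) = u * (a * e * a1) * u1 := by
    intro u a e a1 u1
    simp only [mul_assoc]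
  rw [h8, h4, uni_val, uni_val]
  have h5 : ∀ a b : ℂ, Matrix.single i0 i1 a * Matrix.single i0 i1 b = 0 := fun a b =>
    Matrix.single_mul_single_of_ne _ _ _ _ h01.symm _
  rw [add_mul 1, one_mul, h5, add_zero, mul_add, mul_one, h5, add_zero, Matrix.smul_single]
  congr 1
  simp

/-- far in the unipotent direction -/
theorem fam_far2 (x y z x' y' z' : ℕ) :
    ‖(((((fam i0 i1 h01 x y z)⁻¹ * fam i0 i1 h01 x' y' z' : (Mt d)ˣ) : Mt d) * Matrix.single i1 i0 1 *
     ((((fam i0 i1 h01 x y z)⁻¹ * fam i0 i1 h01 x' y' z')⁻¹ : (Mt d)ˣ) : Mt d)) : Mt d) i0 i1‖ =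
      (((x' : ℝ) - x) ^ 2 + ((y' : ℝ) - y) ^ 2) / (4 ^ z * 4 ^ z') := by
  obtain ⟨w, h1, h2, h3⟩ := fam_diff i0 i1 h01 x y z x' y' z'
  rw [h3]
  have h4 := a_conj10 i0 i1 h01 z' 1
  rw [mul_one] at h4
  simp only [mul_inv_rev, Units.val_mul, uni_inv, inv_inv]
  have h8 : ∀ (p p' q s t u v : Mt d), p * q * s * t * (u * (v * p')) = p * (q * (s * t * u) * v) * p' := by
    intro p p' q s t u v
    simp only [mul_assoc]
  rw [h8, h4, uni_val, uni_val]
  rw [← inv_pow, ← map_inv, ← map_pow, ← map_pow, dg_val, dg_val, Matrix.mul_diagonal, Matrix.diagonal_mul]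
  have h9 : ((1 + Matrix.single i0 i1 w) * Matrix.single i1 i0 ((4 ^ z' : ℂ)⁻¹) *
      (1 + Matrix.single i0 i1 (-w)) : Mt d) i0 i1 = - w ^ 2 * (4 ^ z')⁻¹ := by
    rw [mul_add, mul_one, add_mul, one_mul, add_mul, Matrix.single_mul_single_same,
      Matrix.single_mul_single_same, Matrix.single_mul_single_same]
    simp [h01, h01.symm]
    ring
  rw [h9]
  have hw : ‖w‖ ^ 2 = ((x' : ℝ) - x) ^ 2 + ((y' : ℝ) - y) ^ 2 := by
    rw [Complex.sq_norm, Complex.normSq_apply, h1, h2]; ring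
  simp only [norm_mul, norm_neg, norm_pow, norm_inv]
  rw [hw]
  simp [av, h01.symm, two', norm_pow]
  rw [show (4 : ℝ) ^ z = 2 ^ z * 2 ^ z by rw [← mul_pow]; norm_num]
  field_simp

end
end FbF


set_option linter.unusedSectionVars false
namespace FbF
open Relation

theorem Tpp {ι : Type} [Fintype ι] [DecidableEq ι] {A : Type} [Ring A] [Algebra ℝ A]
    (β : Module.Basis ι ℝ A) {d : ℕ} (r : Rep A d) (i0 i1 : Fin d) (h01 : i0 ≠ i1)
    (Λ : Subring A) (hΛ : ∀ x, x ∈ Λ ↔ ∀ i, ∃ m : ℤ, β.repr x i = m)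
    (Δ : Subgroup Aˣ) (hΔ : ∀ δ ∈ Δ, (δ : A) ∈ Λ) (C : ℝ)
    (hC : ∀ g : Aˣ, |(Algebra.leftMulMatrix β (g : A)).det| = 1 →
      ∃ δ ∈ Δ, ∃ c : Aˣ, g = δ * c ∧ nrm β (c : A) ≤ C ∧ nrm β ((c⁻¹ : Aˣ) : A) ≤ C)
    {P : Type} [Group P] (hP : AD 3 P) (ψ : Δ →* P) :
    ∃ δ : Δ, ψ δ = 1 ∧ ¬ ∀ x : A, ((δ : Aˣ) : A) * x = x * ((δ : Aˣ) : A) := by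
  classical
  by_contra hcon
  push Not at hcon
  have hg : ∀ x y z : ℕ, ∃ δ : Δ, ∃ c : Aˣ, r.θ (fam i0 i1 h01 x y z) = δ * c ∧ nrm β (c : A) ≤ C ∧
      nrm β ((c⁻¹ : Aˣ) : A) ≤ C := by
    intro x y z
    obtain ⟨δ, hδ, c, h⟩ := hC (r.θ (fam i0 i1 h01 x y z)) (fam_χ β r i0 i1 h01 x y z)
    exact ⟨⟨δ, hδ⟩, c, h⟩
  choose D c hD hc hc' using hg
  have hC0 : 0 ≤ C := (nrm_nonneg β _).trans (hc 0 0 0)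
  obtain ⟨C5, hC5, hnear⟩ := fam_near β r i0 i1 h01
  have tri : ∀ (a b e : A) (x y z : ℝ), nrm β a ≤ x → nrm β b ≤ y → nrm β e ≤ z → 0 ≤ x → 0 ≤ y → 
      nrm β (a * b * e) ≤ x * y * z := by
    intro a b e x y z ha hb he hx hy
    exact (nrm_mul β _ _).trans (mul_le_mul ((nrm_mul β _ _).trans
      (mul_le_mul ha hb (nrm_nonneg β _) hx)) he (nrm_nonneg β _) (mul_nonneg hx hy))
  set S : Set Δ := {δ | nrm β ((δ : Aˣ) : A) ≤ C * C5 * C ∧ nrm β (((δ⁻¹ : Δ) : Aˣ) : A) ≤ C * C5 * C} with hS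
  have hSfin : S.Finite := by
    refine Set.Finite.of_finite_image (f := fun δ : Δ => ((δ : Aˣ) : A)) ?_ ?_
    · refine (lat_finite β Λ hΛ (C * C5 * C)).subset ?_
      rintro _ ⟨δ, hδ, rfl⟩
      exact ⟨hΔ _ δ.2, hδ.1⟩
    · intro a _ b _ hab
      exact Subtype.ext (Units.ext hab)
  have hSsymm : ∀ p q : Δ, p⁻¹ * q ∈ S → q⁻¹ * p ∈ S := by
    intro p q h
    have : q⁻¹ * p = (p⁻¹ * q)⁻¹ := by group
    rw [this]
    exact ⟨h.2, by rw [inv_inv]; exact h.1⟩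
  obtain ⟨col, B, hB, hcB⟩ := hP (ψ '' S) (hSfin.image _)
  have hdb : ∃ db : P → Δ, ∀ b, (∃ δ, ψ δ = b) → ψ (db b) = b := by
    refine ⟨fun b => if h : ∃ δ, ψ δ = b then h.choose else 1, fun b h => ?_⟩
    simp only [h, dif_pos]
    exact h.choose_spec
  obtain ⟨db, hdb⟩ := hdb
  obtain ⟨C7, hC7⟩ := (hB.image (fun b => nrm β ((db b : Aˣ) : A) + nrm β ((((db b)⁻¹ : Δ) : Aˣ) : A))).bddAbove
  have hC7a : ∀ b ∈ B, nrm β ((db b : Aˣ) : A) ≤ |C7| ∧ nrm β ((((db b)⁻¹ : Δ) : Aˣ) : A) ≤ |C7| := by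
    intro b hb
    have h1 := hC7 ⟨b, hb, rfl⟩
    have h2 := nrm_nonneg β ((db b : Aˣ) : A)
    have h3 := nrm_nonneg β ((((db b)⁻¹ : Δ) : Aˣ) : A)
    have h4 := le_abs_self C7
    simp only at h1
    constructor <;> linarith
  set C8 := C * |C7| * C with hC8
  have hC80 : 0 ≤ C8 := by positivity
  have key : ∀ x y z x' y' z' : ℕ, ReflTransGen (fun p q : Δ => p⁻¹ * q ∈ S ∧ col (ψ p) = col (ψ q))
      (D x y z) (D x' y' z') → ∀ u : Mt d,
      nrm β (r.s ((((fam i0 i1 h01 x y z)⁻¹ * fam i0 i1 h01 x' y' z' : (Mt d)ˣ) : Mt d) * u *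
     ((((fam i0 i1 h01 x y z)⁻¹ * fam i0 i1 h01 x' y' z')⁻¹ : (Mt d)ˣ) : Mt d))) ≤ C8 * C8 * nrm β (r.s u) := by
    intro x y z x' y' z' hR u
    have h1 : ReflTransGen (fun a b : P => a⁻¹ * b ∈ ψ '' S ∧ col a = col b) (ψ (D x y z)) (ψ (D x' y' z')) := by
      refine ReflTransGen.lift ψ ?_ _ _ hR
      rintro p q ⟨hpq, hcc⟩
      exact ⟨⟨_, hpq, by simp⟩, hcc⟩
    have h2 := hcB _ _ h1
    set p := D x y z
    set q := D x' y' z'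
    set b := (ψ p)⁻¹ * ψ q with hb
    have h3 : ψ (db b) = b := hdb b ⟨p⁻¹ * q, by simp [hb]⟩
    have hμ : ψ ((db b)⁻¹ * (p⁻¹ * q)) = 1 := by
      rw [map_mul, map_inv, map_mul, map_inv, h3, ← hb, inv_mul_cancel]
    set μ : Δ := (db b)⁻¹ * (p⁻¹ * q) with hμd
    have hμc : ∀ v : Aˣ, (μ : Aˣ) * v = v * μ := fun v => Units.ext (hcon μ hμ v)
    set h : Aˣ := (c x y z)⁻¹ * (db b : Aˣ) * c x' y' z' with hh
    have h4 : r.θ ((fam i0 i1 h01 x y z)⁻¹ * fam i0 i1 h01 x' y' z') = h * μ := by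
      have hm : (μ : Aˣ) = (db b : Aˣ)⁻¹ * ((p : Aˣ)⁻¹ * (q : Aˣ)) := rfl
      rw [map_mul, map_inv, hD x y z, hD x' y' z', hh, mul_assoc _ _ (μ : Aˣ), ← hμc, hm]
      change (((p : Aˣ)) * _)⁻¹ * ((q : Aˣ) * _) = _
      simp only [mul_inv_rev, mul_assoc, mul_inv_cancel_left]
    rw [← r.θ_conj, h4, mul_inv_rev h, Units.val_mul h, Units.val_mul _ h⁻¹]
    have h5 : (h : A) * (μ : Aˣ) * r.s u * (((μ : Aˣ)⁻¹ : Aˣ) * ((h⁻¹ : Aˣ) : A)) = h * r.s u * ((h⁻¹ : Aˣ) : A) := by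
      rw [mul_assoc (h : A) ((μ : Aˣ) : A), hcon μ hμ, ← mul_assoc (h : A), mul_assoc ((h : A) * r.s u), Units.mul_inv_cancel_left]
    rw [h5]
    have h6 : nrm β (h : A) ≤ C8 := by
      rw [hh, Units.val_mul, Units.val_mul]
      exact tri _ _ _ _ _ _ (hc' _ _ _) (hC7a b h2).1 (hc _ _ _) hC0 (abs_nonneg _)
    have h7 : nrm β ((h⁻¹ : Aˣ) : A) ≤ C8 := by
      rw [hh, mul_inv_rev, mul_inv_rev, inv_inv, ← mul_assoc, Units.val_mul, Units.val_mul]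
      exact tri _ _ _ _ _ _ (hc' _ _ _) (hC7a b h2).2 (hc _ _ _) hC0 (abs_nonneg _)
    refine (tri _ _ _ _ _ _ h6 le_rfl h7 hC80 (nrm_nonneg β _)).trans (le_of_eq (by ring))
  have hpos : ∀ u : Mt d, u ≠ 0 → 0 < nrm β (r.s u) := by
    intro u hu
    refine lt_of_le_of_ne (nrm_nonneg β _) (fun h => hu ?_)
    have := nrm_eq_zero β _ h.symm
    rw [← r.τ_s u, this, map_zero]
  obtain ⟨N, hN⟩ := pow_unbounded_of_one_lt (C8 * C8) (by norm_num : (1 : ℝ) < 4)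
  obtain ⟨C9, hC90, hC9⟩ := entry_bound β r i0 i1
  set Q := C9 * (C8 * C8 * nrm β (r.s (Matrix.single i1 i0 1))) with hQ
  have hQ0 : 0 ≤ Q := by have := nrm_nonneg β (r.s (Matrix.single i1 i0 1)); positivity
  obtain ⟨M, hM⟩ := exists_nat_gt (4 ^ N * 4 ^ N * Q + 1)
  have far2 : ∀ x y z x' y' z' : ℕ, z ≤ N → z' ≤ N → ReflTransGen (fun p q : Δ => p⁻¹ * q ∈ S ∧ col (ψ p) = col (ψ q))
      (D x y z) (D x' y' z') → (((x' : ℝ) - x) ^ 2 + ((y' : ℝ) - y) ^ 2) < M ^ 2 := by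
    intro x y z x' y' z' hz hz' hR
    have h1 := key _ _ _ _ _ _ hR (Matrix.single i1 i0 1)
    have h2 := fam_far2 i0 i1 h01 x y z x' y' z'
    have h3 := hC9 (r.s ((((fam i0 i1 h01 x y z)⁻¹ * fam i0 i1 h01 x' y' z' : (Mt d)ˣ) : Mt d) * Matrix.single i1 i0 1 *
     ((((fam i0 i1 h01 x y z)⁻¹ * fam i0 i1 h01 x' y' z')⁻¹ : (Mt d)ˣ) : Mt d)))
    rw [r.τ_s, h2] at h3
    have h4 := h3.trans (mul_le_mul_of_nonneg_left h1 hC90)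
    rw [← hQ, div_le_iff₀ (by positivity)] at h4
    have h5 : (4 : ℝ) ^ z * 4 ^ z' ≤ 4 ^ N * 4 ^ N := by
      gcongr <;> first | norm_num | assumption
    have h6 : Q * (4 ^ z * 4 ^ z') ≤ 4 ^ N * 4 ^ N * Q := by
      rw [mul_comm]; exact mul_le_mul_of_nonneg_right h5 hQ0
    have h7 : (0 : ℝ) ≤ 4 ^ N * 4 ^ N * Q := by positivity
    nlinarith
  have hcl := cube_lemma (fun p : Δ => col (ψ p)) (fun p q : Δ => p⁻¹ * q ∈ S) hSsymm D M M N (by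
    intro x y z x' y' z' hx hx' hy hy' hz hz' _ _ _
    obtain ⟨h1, h2⟩ := hnear x y z x' y' z' hx hx' hy hy' hz hz'
    have gen : ∀ x y z x' y' z' : ℕ, nrm β (r.θ ((fam i0 i1 h01 x y z)⁻¹ * fam i0 i1 h01 x' y' z') : A) ≤ C5 →
        nrm β ((((D x y z)⁻¹ * D x' y' z' : Δ) : Aˣ) : A) ≤ C * C5 * C := by
      intro x y z x' y' z' h
      have e : (((D x y z)⁻¹ * D x' y' z' : Δ) : Aˣ) = c x y z * r.θ ((fam i0 i1 h01 x y z)⁻¹ * fam i0 i1 h01 x' y' z') * (c x' y' z')⁻¹ := by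
        rw [map_mul, map_inv, hD x y z, hD x' y' z']
        simp only [Subgroup.coe_mul, Subgroup.coe_inv]
        group
      rw [e, Units.val_mul, Units.val_mul]
      exact tri _ _ _ _ _ _ (hc _ _ _) h (hc' _ _ _) hC0 hC5
    refine ⟨gen _ _ _ _ _ _ h1, ?_⟩
    rw [mul_inv_rev, inv_inv]
    exact gen _ _ _ _ _ _ h2)
  rcases hcl with h | h | h
  · obtain ⟨y, z, y', z', _, hz, _, hz', hR⟩ := h
    have := far2 _ _ _ _ _ _ hz hz' hR
    push_cast at this
    nlinarith [sq_nonneg ((y' : ℝ) - y)]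
  · obtain ⟨y, z, y', z', _, hz, _, hz', hR⟩ := h
    have := far2 _ _ _ _ _ _ hz hz' hR
    push_cast at this
    nlinarith [sq_nonneg ((y' : ℝ) - y)]
  · obtain ⟨x, y, x', y', _, _, _, _, hR⟩ := h
    have h1 := key _ _ _ _ _ _ hR (Matrix.single i0 i1 1)
    rw [fam_far1, map_smul, nrm_smul, abs_of_nonneg (by positivity)] at h1
    have h2 := hpos (Matrix.single i0 i1 1) (by
      intro h0
      have := congrFun (congrFun h0 i0) i1
      simp at this)
    have := mul_lt_mul_of_pos_right hN h2
    linarith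

end FbF


set_option linter.unusedSectionVars false
namespace FbF
open Relation

theorem det_one_add_nil {ι : Type} [Fintype ι] [DecidableEq ι] (N : Matrix ι ι ℝ) (hN : N * N = 0) :
    (1 + N).det = 1 := by
  have h0 : IsNilpotent N := ⟨2, by rw [pow_two, hN]⟩
  have h1 := (Matrix.isNilpotent_charpoly_sub_pow_of_isNilpotent h0).eq_zero
  have h2 : N.charpoly.eval (-1) = (-1) ^ (Fintype.card ι) := by
    rw [sub_eq_zero.1 h1]; simp
  rw [Matrix.eval_charpoly] at h2
  have h3 : Matrix.scalar ι (-1 : ℝ) - N = -(1 + N) := by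
    rw [map_neg, map_one]; abel
  rw [h3, Matrix.det_neg] at h2
  have h4 : ((-1 : ℝ) ^ (Fintype.card ι)) ≠ 0 := by simp
  exact mul_left_cancel₀ h4 (by rw [h2, mul_one])

theorem poly_const (P : Polynomial ℝ) (M : ℝ) (h : ∀ t, |P.eval t| ≤ M) (t : ℝ) : P.eval t = P.eval 0 := by
  have h1 : P.degree ≤ 0 := (Polynomial.isBoundedUnder_abs_atTop_iff P).1
    ⟨M, Filter.eventually_map.2 (Filter.Eventually.of_forall h)⟩
  rw [Polynomial.eq_C_of_degree_le_zero h1]; simp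

section
variable {ι : Type} [Fintype ι] [DecidableEq ι] {A : Type} [Ring A] [Algebra ℝ A]
  (β : Module.Basis ι ℝ A)

theorem lin_bound (T : A →ₗ[ℝ] A) : ∃ C : ℝ, 0 ≤ C ∧ ∀ x, nrm β (T x) ≤ C * nrm β x := by
  refine ⟨(∑ k, |β.repr 1 k|) * ∑ i, nrm β (T (β i)), 
    mul_nonneg (by positivity) (Finset.sum_nonneg fun i _ => nrm_nonneg β _), fun x => ?_⟩
  have h : T x = ∑ i, β.repr x i • T (β i) := by
    conv_lhs => rw [← β.sum_repr x]
    rw [map_sum]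
    simp
  rw [h]
  refine (nrm_sum β _ _).trans ?_
  rw [Finset.mul_sum, Finset.sum_mul]
  refine Finset.sum_le_sum fun i _ => ?_
  rw [nrm_smul]
  have := repr_le_nrm β x i
  calc |β.repr x i| * nrm β (T (β i)) ≤ (nrm β x * ∑ k, |β.repr 1 k|) * nrm β (T (β i)) :=
        mul_le_mul_of_nonneg_right this (nrm_nonneg β _)
    _ = _ := by ring

theorem BD (Δ : Subgroup Aˣ) (C : ℝ)
    (hC : ∀ g : Aˣ, |(Algebra.leftMulMatrix β (g : A)).det| = 1 →
      ∃ δ ∈ Δ, ∃ c : Aˣ, g = δ * c ∧ nrm β (c : A) ≤ C ∧ nrm β ((c⁻¹ : Aˣ) : A) ≤ C)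
    (T : A →ₗ[ℝ] A) (hT : ∀ δ ∈ Δ, ∀ x : A, T ((δ : A) * x * ((δ⁻¹ : Aˣ) : A)) = δ * T x * ((δ⁻¹ : Aˣ) : A))
    (ν : A) (hν : ν * ν = 0) (x : A) : T (ν * x * ν) = ν * T x * ν := by
  obtain ⟨CT, hCT0, hCT⟩ := lin_bound β T
  have hsq : ∀ t : ℝ, (t • ν) * (t • ν) = 0 := fun t => by simp [hν]
  have hdet : ∀ t : ℝ, |(Algebra.leftMulMatrix β ((oneAdd (t • ν) (hsq t) : Aˣ) : A)).det| = 1 := by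
    intro t
    change |(Algebra.leftMulMatrix β (1 + t • ν)).det| = 1
    rw [map_add, map_one, det_one_add_nil, abs_one]
    rw [← map_mul, hsq, map_zero]
  set f : ℝ → A := fun t => (1 - t • ν) * T ((1 + t • ν) * x * (1 - t • ν)) * (1 + t • ν) with hf
  have hbd : ∃ M, ∀ t, nrm β (f t) ≤ M := by
    refine ⟨C * (CT * (C * nrm β x * C)) * C, fun t => ?_⟩
    obtain ⟨δ, hδ, c, hg, h1, h2⟩ := hC _ (hdet t)
    have hC0 : 0 ≤ C := (nrm_nonneg β _).trans h1
    set g : Aˣ := oneAdd (t • ν) (hsq t) with hgd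
    have e : f t = ((c⁻¹ : Aˣ) : A) * T (c * x * ((c⁻¹ : Aˣ) : A)) * c := by
      have e1 : f t = ((g⁻¹ : Aˣ) : A) * T (g * x * ((g⁻¹ : Aˣ) : A)) * g := rfl
      rw [e1, hg]
      have e2 : ((δ * c : Aˣ) : A) * x * (((δ * c)⁻¹ : Aˣ) : A) = δ * (c * x * ((c⁻¹ : Aˣ) : A)) * ((δ⁻¹ : Aˣ) : A) := by
        rw [mul_inv_rev, Units.val_mul, Units.val_mul]; simp only [mul_assoc]
      rw [e2, hT δ hδ, mul_inv_rev, Units.val_mul, Units.val_mul]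
      simp only [mul_assoc, Units.inv_mul_cancel_left]
    rw [e]
    have h3 : nrm β (c * x * ((c⁻¹ : Aˣ) : A)) ≤ C * nrm β x * C :=
      (nrm_mul β _ _).trans (mul_le_mul ((nrm_mul β _ _).trans (mul_le_mul_of_nonneg_right h1 (nrm_nonneg β _)))
        h2 (nrm_nonneg β _) (mul_nonneg hC0 (nrm_nonneg β _)))
    have h4 := (hCT (c * x * ((c⁻¹ : Aˣ) : A))).trans (mul_le_mul_of_nonneg_left h3 hCT0)
    refine (nrm_mul β _ _).trans (mul_le_mul ((nrm_mul β _ _).trans (mul_le_mul h2 h4 (nrm_nonneg β _) hC0))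
      h1 (nrm_nonneg β _) ?_)
    exact mul_nonneg hC0 ((nrm_nonneg β _).trans h4)
  obtain ⟨M, hM⟩ := hbd
  have hpoly : ∀ t, f t = T x + t • (T (ν * x - x * ν) + (T x * ν - ν * T x)) +
      t ^ 2 • (- T (ν * x * ν) + (T (ν * x - x * ν) * ν - ν * T (ν * x - x * ν)) - ν * T x * ν) +
      t ^ 3 • (- (T (ν * x * ν) * ν - ν * T (ν * x * ν)) - ν * T (ν * x - x * ν) * ν) +
      t ^ 4 • (ν * T (ν * x * ν) * ν) := by
    intro t
    have e1 : (1 + t • ν) * x * (1 - t • ν) = x + t • (ν * x - x * ν) - t ^ 2 • (ν * x * ν) := by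
      simp only [add_mul, mul_sub, smul_mul_assoc, mul_smul_comm, one_mul, mul_one]
      module
    simp only [hf]
    rw [e1, map_sub, map_add, map_smul, map_smul]
    generalize T x = X
    generalize T (ν * x - x * ν) = W
    generalize T (ν * x * ν) = V
    simp only [add_mul, mul_sub, mul_add, sub_mul, smul_mul_assoc, mul_smul_comm, one_mul, mul_one, neg_mul, mul_neg, mul_assoc]
    module
  have hconst : ∀ t, f t = T x := by
    intro t
    have f0 : f 0 = T x := by simp [hf]
    rw [← f0]
    apply β.repr.injective
    ext i
    obtain ⟨q0, q1, q2, q3, q4, hq⟩ : ∃ q0 q1 q2 q3 q4 : A, ∀ t, f t = q0 + t • q1 + t ^ 2 • q2 + t ^ 3 • q3 + t ^ 4 • q4 :=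
      ⟨_, _, _, _, _, hpoly⟩
    set P : Polynomial ℝ := Polynomial.C (β.repr q0 i) + Polynomial.X * Polynomial.C (β.repr q1 i) +
      Polynomial.X ^ 2 * Polynomial.C (β.repr q2 i) + Polynomial.X ^ 3 * Polynomial.C (β.repr q3 i) +
      Polynomial.X ^ 4 * Polynomial.C (β.repr q4 i) with hP
    have hev : ∀ t, β.repr (f t) i = P.eval t := by
      intro t
      rw [hq t, hP]
      simp
      ring
    rw [hev, hev]
    refine poly_const P (M * ∑ k, |β.repr 1 k|) (fun u => ?_) t
    rw [← hev]
    exact (repr_le_nrm β _ _).trans (mul_le_mul_of_nonneg_right (hM u) (by positivity))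
  have hconj : ∀ t : ℝ, T ((1 + t • ν) * x * (1 - t • ν)) = (1 + t • ν) * T x * (1 - t • ν) := by
    intro t
    rw [← hconst t]
    have e1 : (1 + t • ν) * (1 - t • ν) = 1 := (oneAdd (t • ν) (hsq t)).val_inv
    simp only [hf]
    generalize T ((1 + t • ν) * x * (1 - t • ν)) = Y
    simp only [← mul_assoc]
    rw [e1, one_mul, mul_assoc, e1, mul_one]
  have h1 := hconj 1
  have h2 := hconj (-1)
  simp only [one_smul, neg_smul, sub_neg_eq_add] at h1 h2
  have e1 : (1 + ν) * x * (1 - ν) + (1 + -ν) * x * (1 + ν) = (2 : ℝ) • x - (2 : ℝ) • (ν * x * ν) := by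
    rw [two_smul, two_smul]; noncomm_ring
  have e2 : (1 + ν) * T x * (1 - ν) + (1 + -ν) * T x * (1 + ν) = (2 : ℝ) • T x - (2 : ℝ) • (ν * T x * ν) := by
    rw [two_smul, two_smul]; noncomm_ring
  have h3 := congrArg T e1
  rw [map_add, h1, h2, e2, map_sub, map_smul, map_smul] at h3
  have h4 : (2 : ℝ) • (ν * T x * ν) = (2 : ℝ) • T (ν * x * ν) := sub_right_injective h3
  exact (smul_right_injective A (two_ne_zero (α := ℝ)) h4).symm

end

/-! matrix lemma -/

theorem eig_scalar {V : Type} [AddCommGroup V] [Module ℂ V] (a : V →ₗ[ℂ] V)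
    (h : ∀ v, ∃ c : ℂ, a v = c • v) : ∃ c : ℂ, ∀ v, a v = c • v := by
  obtain ⟨c, hc⟩ := LinearMap.exists_eq_smul_id_of_forall_notLinearIndependent (f := a) (by
    intro v hv
    obtain ⟨c, hc⟩ := h v
    by_cases h0 : v = 0
    · exact hv.ne_zero 0 (by simp [h0])
    · exact (LinearIndependent.pair_iff' h0).1 hv c hc.symm)
  exact ⟨c, fun v => by rw [hc]; simp⟩

theorem two_eig {V : Type} [AddCommGroup V] [Module ℂ V] (a b : V →ₗ[ℂ] V)
    (h : ∀ v, (∃ c : ℂ, a v = c • v) ∨ (∃ c : ℂ, b v = c • v)) :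
    (∃ c : ℂ, ∀ v, a v = c • v) ∨ (∃ c : ℂ, ∀ v, b v = c • v) := by
  by_contra hcon
  push Not at hcon
  obtain ⟨ha, hb⟩ := hcon
  have ha' : ∃ v0, ∀ c : ℂ, a v0 ≠ c • v0 := by
    by_contra h1; push Not at h1
    obtain ⟨c, hc⟩ := eig_scalar a h1
    obtain ⟨v, hv⟩ := ha c
    exact hv (hc v)
  have hb' : ∃ v0, ∀ c : ℂ, b v0 ≠ c • v0 := by
    by_contra h1; push Not at h1
    obtain ⟨c, hc⟩ := eig_scalar b h1
    obtain ⟨v, hv⟩ := hb c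
    exact hv (hc v)
  obtain ⟨v0, h0⟩ := ha'
  obtain ⟨v1, h1⟩ := hb'
  have gen : ∀ (a : V →ₗ[ℂ] V) (v0 v1 : V), (∀ c : ℂ, a v0 ≠ c • v0) → (∃ c : ℂ, a v1 = c • v1) → 
      ∀ t1 t2 : ℂ, (∃ c : ℂ, a (v0 + t1 • v1) = c • (v0 + t1 • v1)) → (∃ c : ℂ, a (v0 + t2 • v1) = c • (v0 + t2 • v1)) → 
      t1 = t2 := by
    rintro a v0 v1 h0 ⟨α, hα⟩ t1 t2 ⟨c1, hc1⟩ ⟨c2, hc2⟩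
    rw [map_add, map_smul, hα] at hc1 hc2
    have e1 : a v0 = c1 • v0 + (t1 * (c1 - α)) • v1 := by
      rw [eq_sub_of_add_eq hc1]; module
    have e2 : a v0 = c2 • v0 + (t2 * (c2 - α)) • v1 := by
      rw [eq_sub_of_add_eq hc2]; module
    have e3 : (c1 - c2) • v0 = (t2 * (c2 - α) - t1 * (c1 - α)) • v1 := by
      have := e1.symm.trans e2
      rw [sub_smul, sub_smul, sub_eq_sub_iff_add_eq_add, this]; abel
    by_cases hcc : c1 = c2
    · subst hcc
      by_cases hca : c1 = α
      · exact absurd (by rw [e1, hca]; simp) (h0 c1)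
      · rw [sub_self, zero_smul, ← sub_mul] at e3
        by_cases hv : v1 = 0
        · exact absurd (by rw [e1, hv]; simp) (h0 c1)
        · rcases smul_eq_zero.1 e3.symm with h | h
          · rcases mul_eq_zero.1 h with h | h
            · exact (sub_eq_zero.1 h).symm
            · exact absurd (sub_eq_zero.1 h) hca
          · exact absurd h hv
    · exfalso
      have hcc' : c1 - c2 ≠ 0 := sub_ne_zero.2 hcc
      have e4 : v0 = ((c1 - c2)⁻¹ * (t2 * (c2 - α) - t1 * (c1 - α))) • v1 := by
        rw [mul_smul, ← e3, inv_smul_smul₀ hcc']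
      refine h0 α ?_
      rw [e4, map_smul, hα, smul_comm]
  have hv1 : ∃ c : ℂ, a v1 = c • v1 := (h v1).resolve_right (fun ⟨c, hc⟩ => h1 c hc)
  have hv0 : ∃ c : ℂ, b v0 = c • v0 := (h v0).resolve_left (fun ⟨c, hc⟩ => h0 c hc)
  have ga := gen a v0 v1 h0 hv1
  have gb : ∀ t1 t2 : ℂ, t1 ≠ 0 → t2 ≠ 0 → (∃ c : ℂ, b (v0 + t1 • v1) = c • (v0 + t1 • v1)) → 
      (∃ c : ℂ, b (v0 + t2 • v1) = c • (v0 + t2 • v1)) → t1 = t2 := by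
    intro t1 t2 ht1 ht2 k1 k2
    have conv : ∀ t : ℂ, t ≠ 0 → (∃ c : ℂ, b (v0 + t • v1) = c • (v0 + t • v1)) → 
        ∃ c : ℂ, b (v1 + t⁻¹ • v0) = c • (v1 + t⁻¹ • v0) := by
      rintro t ht ⟨c, hc⟩
      refine ⟨c, ?_⟩
      have : v1 + t⁻¹ • v0 = t⁻¹ • (v0 + t • v1) := by
        rw [smul_add, inv_smul_smul₀ ht, add_comm]
      rw [this, map_smul, hc, smul_comm]
    exact inv_injective (gen b v1 v0 h1 hv0 _ _ (conv t1 ht1 k1) (conv t2 ht2 k2))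
  rcases h (v0 + (1 : ℂ) • v1) with k1 | k1 <;> rcases h (v0 + (2 : ℂ) • v1) with k2 | k2 <;>
    rcases h (v0 + (3 : ℂ) • v1) with k3 | k3
  all_goals first
    | (have := ga _ _ k1 k2; norm_num at this; done)
    | (have := ga _ _ k1 k3; norm_num at this; done)
    | (have := ga _ _ k2 k3; norm_num at this; done)
    | (have := gb _ _ (by norm_num) (by norm_num) k1 k2; norm_num at this; done)
    | (have := gb _ _ (by norm_num) (by norm_num) k1 k3; norm_num at this; done)
    | (have := gb _ _ (by norm_num) (by norm_num) k2 k3; norm_num at this; done)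

theorem matrix_lemma {d : ℕ} (a b : Mt d)
    (h : ∀ x : Mt d, x * x = 0 → (x * a * x) * b = b * (x * a * x)) :
    (∀ y, a * y = y * a) ∨ (∀ y, b * y = y * b) := by
  have key : ∀ v : Fin d → ℂ, (∃ c : ℂ, a.mulVec v = c • v) ∨ (∃ c : ℂ, b.mulVec v = c • v) := by
    intro v
    by_contra hcon
    push Not at hcon
    obtain ⟨h1, h2⟩ := hcon
    have hm : a.mulVec v ∉ Submodule.span ℂ {v} := by
      rw [Submodule.mem_span_singleton]
      rintro ⟨c, hc⟩
      exact h1 c hc.symm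
    obtain ⟨φ, hφ1, hφ2⟩ := Submodule.exists_dual_map_eq_bot_of_notMem hm inferInstance
    set f : Fin d → ℂ := fun i => φ (Pi.single i 1) with hf
    have hfv : ∀ w, φ w = f ⬝ᵥ w := by
      intro w
      conv_lhs => rw [← (Pi.basisFun ℂ (Fin d)).sum_repr w]
      rw [map_sum]
      simp [dotProduct, hf, mul_comm]
    have hv0 : f ⬝ᵥ v = 0 := by
      rw [← hfv]
      have : φ v ∈ (Submodule.span ℂ {v}).map φ := ⟨v, Submodule.mem_span_singleton_self v, rfl⟩
      rw [hφ2] at this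
      simpa using this
    rw [hfv] at hφ1
    set x : Mt d := Matrix.vecMulVec v f with hx
    have hxx : x * x = 0 := by
      rw [hx, Matrix.vecMulVec_mul_vecMulVec, hv0]; simp
    have hxax : x * a * x = (f ⬝ᵥ a.mulVec v) • x := by
      rw [hx, mul_assoc, Matrix.mul_vecMulVec, Matrix.vecMulVec_mul_vecMulVec]
      simp
    have hc := h x hxx
    rw [hxax, Matrix.smul_mul, Matrix.mul_smul] at hc
    have hc2 := smul_right_injective _ hφ1 hc
    rw [hx, Matrix.mul_vecMulVec, Matrix.vecMulVec_mul] at hc2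
    obtain ⟨i, hi⟩ : ∃ i, f i ≠ 0 := by
      by_contra h0; push Not at h0
      exact hφ1 (by simp [dotProduct, h0])
    refine h2 ((Matrix.vecMul f b) i / f i) ?_
    ext j
    have := congrFun (congrFun hc2 j) i
    simp only [Matrix.vecMulVec_apply] at this
    rw [Pi.smul_apply, smul_eq_mul]
    field_simp
    linear_combination -this
  have fin : ∀ (m : Mt d) (c : ℂ), (∀ v, m.mulVecLin v = c • v) → ∀ y, m * y = y * m := by
    intro m c hm y
    have : m = c • 1 := by
      apply Matrix.mulVec_injective
      funext v
      have := hm v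
      rw [Matrix.mulVecLin_apply] at this
      rw [this, Matrix.smul_mulVec, Matrix.one_mulVec]
    rw [this]; simp
  rcases two_eig a.mulVecLin b.mulVecLin key with ⟨c, hc⟩ | ⟨c, hc⟩
  · exact Or.inl (fin a c hc)
  · exact Or.inr (fin b c hc)

end FbF


set_option linter.unusedSectionVars false
namespace FbF
open Relation TensorProduct

theorem proj_exists {D : Type} [DivisionRing D] [Algebra ℚ D] [FiniteDimensional ℚ D] (S : Set D) :
    ∃ p : D →ₗ[ℚ] D, (∀ x, p x ∈ Subalgebra.centralizer ℚ S) ∧ (∀ x ∈ Subalgebra.centralizer ℚ S, p x = x) ∧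
      ∀ u : Dˣ, (∀ e ∈ Subalgebra.centralizer ℚ S, (u : D) * e * ((u⁻¹ : Dˣ) : D) ∈ Subalgebra.centralizer ℚ S) →
        (∀ e ∈ Subalgebra.centralizer ℚ S, ((u⁻¹ : Dˣ) : D) * e * (u : D) ∈ Subalgebra.centralizer ℚ S) →
        ∀ x, p ((u : D) * x * ((u⁻¹ : Dˣ) : D)) = (u : D) * p x * ((u⁻¹ : Dˣ) : D) := by
  set tr : D →ₗ[ℚ] ℚ := (LinearMap.trace ℚ D).comp (Algebra.lmul ℚ D).toLinearMap with htr
  have trc : ∀ x y, tr (x * y) = tr (y * x) := by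
    intro x y
    simp only [htr, LinearMap.comp_apply, AlgHom.toLinearMap_apply, map_mul]
    exact LinearMap.trace_mul_comm ℚ _ _
  have tr1 : tr 1 ≠ 0 := by
    simp only [htr, LinearMap.comp_apply, AlgHom.toLinearMap_apply, map_one, LinearMap.trace_one]
    exact_mod_cast (Module.finrank_pos (R := ℚ) (M := D)).ne'
  let B : LinearMap.BilinForm ℚ D := (LinearMap.mul ℚ D).compr₂ tr
  have hB : ∀ x y, B x y = tr (x * y) := fun x y => rfl
  have hBr : B.IsRefl := by
    intro x y h
    rw [hB] at h ⊢
    rw [trc, h]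
  set E := Subalgebra.centralizer ℚ S with hE
  set W : Submodule ℚ D := Subalgebra.toSubmodule E with hW
  have hc : IsCompl W (B.orthogonal W) := by
    rw [LinearMap.BilinForm.isCompl_orthogonal_iff_disjoint hBr, Submodule.disjoint_def]
    intro x hx hx'
    by_contra h0
    have hxi : x⁻¹ ∈ W := by
      change x⁻¹ ∈ E
      rw [hE, Subalgebra.mem_centralizer_iff]
      intro g hg
      have h1 := (Subalgebra.mem_centralizer_iff ℚ).1 (show x ∈ Subalgebra.centralizer ℚ S from hx) g hg
      exact (Commute.inv_right₀ (show Commute g x from h1)).eq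
    have := hx' x⁻¹ hxi
    rw [hB, inv_mul_cancel₀ h0] at this
    exact tr1 this
  have dec : ∀ x, ∃ e ∈ W, ∃ e' ∈ B.orthogonal W, x = e + e' := by
    intro x
    have : x ∈ W ⊔ B.orthogonal W := by rw [hc.sup_eq_top]; trivial
    obtain ⟨e, he, e', he', h⟩ := Submodule.mem_sup.1 this
    exact ⟨e, he, e', he', h.symm⟩
  let p : D →ₗ[ℚ] D := W.projection _ hc
  have hp1 : ∀ x ∈ W, p x = x := fun x hx => Submodule.projection_apply_of_mem_left hc hx
  have hp2 : ∀ x ∈ B.orthogonal W, p x = 0 := fun x hx => Submodule.projection_apply_of_mem_right hc hx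
  refine ⟨p, fun x => Submodule.projection_apply_mem hc x, hp1, ?_⟩
  intro u hu1 hu2 x
  obtain ⟨e, he, e', he', rfl⟩ := dec x
  rw [mul_add, add_mul, map_add, map_add, hp1 e he, hp2 e' he', add_zero, hp1 _ (hu1 e he), hp2, add_zero]
  intro w hw
  rw [hB]
  have h1 := he' _ (hu2 w hw)
  rw [hB] at h1
  rw [← mul_assoc, trc, ← h1]
  simp only [mul_assoc]

section
variable {D : Type} [DivisionRing D] [Algebra ℚ D] [FiniteDimensional ℚ D]

/-- inclusion -/
noncomputable abbrev jj (D : Type) [DivisionRing D] [Algebra ℚ D] : D →ₐ[ℚ] (ℝ ⊗[ℚ] D) :=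
  Algebra.TensorProduct.includeRight

theorem central_iff (a : D) : (∀ x : D, a * x = x * a) ↔ (∀ x : ℝ ⊗[ℚ] D, jj D a * x = x * jj D a) := by
  constructor
  · intro h x
    induction x with
    | zero => simp
    | tmul r x => simp [h x]
    | add x y hx hy => rw [mul_add, add_mul, hx, hy]
  · intro h x
    have h1 := h (jj D x)
    rw [← map_mul, ← map_mul] at h1
    exact Algebra.TensorProduct.includeRight_injective (R := ℚ) (A := ℝ) (B := D) (algebraMap ℚ ℝ).injective h1

variable {ι : Type} [Fintype ι] [DecidableEq ι] (β : Module.Basis ι ℝ (ℝ ⊗[ℚ] D)) {d : ℕ}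
  (r : Rep (ℝ ⊗[ℚ] D) d) (hd : d ≠ 0)

theorem τ_inj (hd : d ≠ 0) : Function.Injective (fun x : D => r.τ (jj D x)) := by
  haveI : Nonempty (Fin d) := ⟨⟨0, Nat.pos_of_ne_zero hd⟩⟩
  exact (r.τ.toRingHom.comp (jj D).toRingHom).injective

theorem central_of_τ (hd : d ≠ 0) (a : D) (h : ∀ y : Mt d, r.τ (jj D a) * y = y * r.τ (jj D a)) : ∀ x : D, a * x = x * a := by
  intro x
  apply τ_inj r hd
  simp only [map_mul]
  exact h _

theorem scalar_of_commute (M : Mt d) (h : ∀ y, M * y = y * M) : ∃ c : ℂ, M = c • 1 := by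
  have h1 : M ∈ Set.range (Matrix.scalar (Fin d)) := by
    apply Matrix.mem_range_scalar_of_commute_single
    intro i j _
    exact (h _).symm
  obtain ⟨c, hc⟩ := h1
  refine ⟨c, ?_⟩
  rw [← hc, Matrix.smul_one_eq_diagonal]
  rfl

theorem pair_lemma (r : Rep (ℝ ⊗[ℚ] D) d) (hd : d ≠ 0) (Δ : Subgroup Dˣ)
    (htf : ∀ x ∈ Δ, ∀ k : ℕ, k ≠ 0 → x ^ k = 1 → x = 1) (C : ℝ)
    (hC : ∀ g : (ℝ ⊗[ℚ] D)ˣ, |(Algebra.leftMulMatrix β (g : ℝ ⊗[ℚ] D)).det| = 1 →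
      ∃ δ ∈ Δ.map (Units.map (jj D : D →* ℝ ⊗[ℚ] D)), ∃ c : (ℝ ⊗[ℚ] D)ˣ, g = δ * c ∧ nrm β (c : ℝ ⊗[ℚ] D) ≤ C ∧
        nrm β ((c⁻¹ : (ℝ ⊗[ℚ] D)ˣ) : ℝ ⊗[ℚ] D) ≤ C)
    (N1 N2 : Subgroup Dˣ) (h1 : N1 ≤ Δ) (h2 : N2 ≤ Δ)
    (hn1 : ∀ δ ∈ Δ, ∀ n ∈ N1, δ * n * δ⁻¹ ∈ N1) (hn2 : ∀ δ ∈ Δ, ∀ n ∈ N2, δ * n * δ⁻¹ ∈ N2)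
    (hc1 : ∃ a ∈ N1, ¬ ∀ x : D, (a : D) * x = x * a) (hc2 : ∃ a ∈ N2, ¬ ∀ x : D, (a : D) * x = x * a) :
    ∃ a ∈ N1 ⊓ N2, ¬ ∀ x : D, (a : D) * x = x * a := by
  by_contra hcon
  push Not at hcon
  have hcomm : ∀ x ∈ N1, ∀ y ∈ N2, x * y = y * x := by
    intro x hx y hy
    have hz1 : x * y * x⁻¹ * y⁻¹ ∈ N1 := by
      have := N1.mul_mem hx (hn1 y (h2 hy) _ (N1.inv_mem hx))
      simpa only [mul_assoc] using this
    have hz2 : x * y * x⁻¹ * y⁻¹ ∈ N2 := N2.mul_mem (hn2 x (h1 hx) y hy) (N2.inv_mem hy)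
    set ζ := x * y * x⁻¹ * y⁻¹ with hζ
    have hcen := (central_iff (ζ : D)).1 (hcon ζ ⟨hz1, hz2⟩)
    obtain ⟨c, hc⟩ := scalar_of_commute (r.τ (jj D ζ)) (fun y => by
      rw [← r.τ_s y, ← map_mul, hcen, map_mul])
    let F : D →* Mt d := (r.τ : _ →* Mt d).comp (jj D : D →* ℝ ⊗[ℚ] D)
    have hF : ∀ z, F z = r.τ (jj D z) := fun z => rfl
    have hdet : (F ζ).det = 1 := by
      let H : Dˣ →* ℂˣ := Units.map ((Matrix.detMonoidHom).comp F)
      have : H ζ = 1 := by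
        rw [hζ]; simp only [map_mul, map_inv]
        rw [mul_right_comm]; simp
      have h3 : ((H ζ : ℂˣ) : ℂ) = 1 := by rw [this]; rfl
      exact h3
    rw [hF, hc] at hdet
    rw [Matrix.det_smul, Matrix.det_one, mul_one, Fintype.card_fin] at hdet
    have hpow : ζ ^ d = 1 := by
      apply Units.ext
      apply τ_inj r hd
      simp only [Units.val_pow_eq_pow_val, map_pow, Units.val_one, map_one]
      rw [hc, smul_pow, hdet, one_pow, one_smul]
    have hζ1 := htf ζ (h1 hz1) d hd hpow
    rw [hζ, mul_inv_eq_one, mul_inv_eq_iff_eq_mul] at hζ1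
    exact hζ1
  obtain ⟨b, hb, hbc⟩ := hc1
  obtain ⟨a, ha, hac⟩ := hc2
  set S : Set D := {x | ∃ n ∈ N1, x = ((n : Dˣ) : D)} with hS
  obtain ⟨p, hp1, hp2, hp3⟩ := proj_exists S
  have hconj : ∀ u ∈ Δ, ∀ e ∈ Subalgebra.centralizer ℚ S, (u : D) * e * ((u⁻¹ : Dˣ) : D) ∈ Subalgebra.centralizer ℚ S := by
    intro u hu e he
    rw [Subalgebra.mem_centralizer_iff]
    rintro _ ⟨n, hn, rfl⟩
    have h3 := (Subalgebra.mem_centralizer_iff ℚ).1 he _ ⟨_, hn1 u⁻¹ (Δ.inv_mem hu) n hn, rfl⟩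
    simp only [inv_inv, Units.val_mul] at h3
    calc (n : D) * (u * e * ((u⁻¹ : Dˣ) : D)) = u * (((u⁻¹ : Dˣ) : D) * n * u * e) * ((u⁻¹ : Dˣ) : D) := by
          simp only [mul_assoc, Units.mul_inv_cancel_left]
      _ = u * e * ((u⁻¹ : Dˣ) : D) * n := by
          rw [h3]; simp only [mul_assoc, Units.mul_inv, mul_one]
  let T : ℝ ⊗[ℚ] D →ₗ[ℝ] ℝ ⊗[ℚ] D := p.baseChange ℝ
  have hT : ∀ δ ∈ Δ.map (Units.map (jj D : D →* ℝ ⊗[ℚ] D)), ∀ x : ℝ ⊗[ℚ] D,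
      T ((δ : ℝ ⊗[ℚ] D) * x * ((δ⁻¹ : (ℝ ⊗[ℚ] D)ˣ) : ℝ ⊗[ℚ] D)) = δ * T x * ((δ⁻¹ : (ℝ ⊗[ℚ] D)ˣ) : ℝ ⊗[ℚ] D) := by
    rintro _ ⟨u, hu, rfl⟩ x
    rw [← map_inv]
    change T (jj D u * x * jj D (u⁻¹ : Dˣ)) = jj D u * T x * jj D (u⁻¹ : Dˣ)
    induction x with
    | zero => simp
    | tmul c x =>
      have h3 := hp3 u (hconj u hu) (fun e he => by
        have := hconj u⁻¹ (Δ.inv_mem hu) e he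
        rwa [inv_inv] at this) x
      simp only [jj, T, Algebra.TensorProduct.includeRight_apply, Algebra.TensorProduct.tmul_mul_tmul, one_mul, mul_one,
        LinearMap.baseChange_tmul, h3]
    | add x y hx hy => rw [mul_add, add_mul, map_add, hx, hy, map_add, mul_add, add_mul]
  have hTb : ∀ x, T x * jj D b = jj D b * T x := by
    intro x
    induction x with
    | zero => simp
    | tmul c x =>
      have h3 := (Subalgebra.mem_centralizer_iff ℚ).1 (hp1 x) _ ⟨b, hb, rfl⟩
      simp only [jj, T, Algebra.TensorProduct.includeRight_apply, Algebra.TensorProduct.tmul_mul_tmul, one_mul, mul_one,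
        LinearMap.baseChange_tmul, h3]
    | add x y hx hy => rw [map_add, mul_add, add_mul, hx, hy]
  have hTa : T (jj D a) = jj D a := by
    have : (a : D) ∈ Subalgebra.centralizer ℚ S := by
      rw [Subalgebra.mem_centralizer_iff]
      rintro _ ⟨n, hn, rfl⟩
      exact congrArg Units.val (hcomm n hn a ha)
    simp only [jj, T, Algebra.TensorProduct.includeRight_apply, LinearMap.baseChange_tmul, hp2 _ this]
  rcases matrix_lemma (r.τ (jj D a)) (r.τ (jj D b)) (by
    intro x hx
    have hν : r.s x * r.s x = 0 := by rw [← r.s_mul, hx, map_zero]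
    have h3 := BD β _ C hC T hT (r.s x) hν (jj D a)
    rw [hTa] at h3
    have h4 := hTb (r.s x * jj D a * r.s x)
    rw [h3] at h4
    have h5 := congrArg r.τ h4
    simpa only [map_mul, r.τ_s] using h5) with h | h
  · exact hac (central_of_τ r hd _ h)
  · exact hbc (central_of_τ r hd _ h)

theorem div_core (r : Rep (ℝ ⊗[ℚ] D) d) (i0 i1 : Fin d) (h01 : i0 ≠ i1) (Δ : Subgroup Dˣ) (hE : Emb Δ)
    (Λ : Subring (ℝ ⊗[ℚ] D)) (hΛ : ∀ x, x ∈ Λ ↔ ∀ i, ∃ m : ℤ, β.repr x i = m)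
    (hΔ : ∀ δ ∈ Δ, jj D (δ : D) ∈ Λ) (C : ℝ)
    (hC : ∀ g : (ℝ ⊗[ℚ] D)ˣ, |(Algebra.leftMulMatrix β (g : ℝ ⊗[ℚ] D)).det| = 1 →
      ∃ δ ∈ Δ.map (Units.map (jj D : D →* ℝ ⊗[ℚ] D)), ∃ c : (ℝ ⊗[ℚ] D)ˣ, g = δ * c ∧ nrm β (c : ℝ ⊗[ℚ] D) ≤ C ∧
        nrm β ((c⁻¹ : (ℝ ⊗[ℚ] D)ˣ) : ℝ ⊗[ℚ] D) ≤ C) : False := by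
  classical
  have hd : d ≠ 0 := by rintro rfl; exact i0.elim0
  have hjinj : Function.Injective (Units.map (jj D : D →* ℝ ⊗[ℚ] D)) :=
    Units.map_injective (Algebra.TensorProduct.includeRight_injective (R := ℚ) (A := ℝ) (B := D) (algebraMap ℚ ℝ).injective)
  have htf : ∀ x ∈ Δ, ∀ k : ℕ, k ≠ 0 → x ^ k = 1 → x = 1 := by
    intro x hx k hk h
    have := Emb.tf hE ⟨x, hx⟩ k hk (Subtype.ext h)
    exact congrArg Subtype.val this
  have tpp : ∀ {P : Type} [Group P], AD 3 P → ∀ ψ : Δ →* P, ∃ δ : Δ, ψ δ = 1 ∧ ¬ ∀ x : D, ((δ : Dˣ) : D) * x = x * ((δ : Dˣ) : D) := by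
    intro P _ hP ψ
    let e := Δ.equivMapOfInjective _ hjinj
    obtain ⟨δ, hδ, hnc⟩ := Tpp β r i0 i1 h01 Λ hΛ (Δ.map (Units.map (jj D : D →* ℝ ⊗[ℚ] D))) (by
      rintro _ ⟨u, hu, rfl⟩
      exact hΔ u hu) C hC hP (ψ.comp e.symm.toMonoidHom)
    refine ⟨e.symm δ, hδ, fun h => hnc ?_⟩
    have h1 := (central_iff _).1 h
    have h2 : jj D ((e.symm δ : Dˣ) : D) = ((δ : (ℝ ⊗[ℚ] D)ˣ) : ℝ ⊗[ℚ] D) := by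
      conv_rhs => rw [← e.apply_symm_apply δ]
      rfl
    rwa [h2] at h1
  obtain ⟨m, P, inst, hP, ψ, hψ⟩ := hE
  let ker : Fin m → Subgroup Dˣ := fun i => (((Pi.evalMonoidHom P i).comp ψ).ker).map Δ.subtype
  have hker : ∀ i x, x ∈ ker i ↔ ∃ hx : x ∈ Δ, ψ ⟨x, hx⟩ i = 1 := by
    intro i x
    constructor
    · rintro ⟨δ, hδ, rfl⟩
      exact ⟨δ.2, hδ⟩
    · rintro ⟨hx, h⟩
      exact ⟨⟨x, hx⟩, h, rfl⟩
  have hmain : ∀ s : Finset (Fin m), ∃ N : Subgroup Dˣ, N ≤ Δ ∧ (∀ δ ∈ Δ, ∀ n ∈ N, δ * n * δ⁻¹ ∈ N) ∧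
      (∀ i ∈ s, N ≤ ker i) ∧ ∃ a ∈ N, ¬ ∀ x : D, (a : D) * x = x * a := by
    intro s
    induction s using Finset.induction_on with
    | empty =>
      obtain ⟨δ, _, hδ⟩ := tpp (P := Unit) (fun S _ => ⟨fun _ => 0, {1}, Set.finite_singleton _,
        fun x y _ => Subsingleton.elim _ _⟩) 1
      exact ⟨Δ, le_rfl, fun δ hδ n hn => Δ.mul_mem (Δ.mul_mem hδ hn) (Δ.inv_mem hδ), by simp, δ, δ.2, hδ⟩
    | insert i s _ ih =>
      obtain ⟨N, hN1, hN2, hN3, hN4⟩ := ih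
      have k1 : ker i ≤ Δ := fun x hx => ((hker i x).1 hx).1
      have k2 : ∀ δ ∈ Δ, ∀ n ∈ ker i, δ * n * δ⁻¹ ∈ ker i := by
        intro δ hδ n hn
        obtain ⟨hn1, hn2⟩ := (hker i n).1 hn
        refine (hker i _).2 ⟨Δ.mul_mem (Δ.mul_mem hδ hn1) (Δ.inv_mem hδ), ?_⟩
        have : (⟨δ * n * δ⁻¹, Δ.mul_mem (Δ.mul_mem hδ hn1) (Δ.inv_mem hδ)⟩ : Δ) = ⟨δ, hδ⟩ * ⟨n, hn1⟩ * ⟨δ, hδ⟩⁻¹ := rfl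
        rw [this, map_mul, map_mul, map_inv, Pi.mul_apply, Pi.mul_apply, hn2, mul_one, Pi.inv_apply, mul_inv_cancel]
      have k3 : ∃ a ∈ ker i, ¬ ∀ x : D, (a : D) * x = x * a := by
        obtain ⟨Y, φ, _, _, hAD⟩ := IsFreeByFree.elim (hP i)
        obtain ⟨δ, h1, h2⟩ := tpp hAD ((Pi.evalMonoidHom P i).comp ψ)
        exact ⟨δ, (hker i _).2 ⟨δ.2, h1⟩, h2⟩
      refine ⟨N ⊓ ker i, inf_le_left.trans hN1, ?_, ?_, 
        pair_lemma β r hd Δ htf C hC N (ker i) hN1 k1 hN2 k2 hN4 k3⟩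
      · intro δ hδ n hn
        exact ⟨hN2 δ hδ n hn.1, k2 δ hδ n hn.2⟩
      · intro j hj
        rcases Finset.mem_insert.1 hj with rfl | hj
        · exact inf_le_right
        · exact inf_le_left.trans (hN3 j hj)
  obtain ⟨N, hN1, _, hN3, a, ha, hac⟩ := hmain Finset.univ
  have : (⟨a, hN1 ha⟩ : Δ) = 1 := by
    apply hψ
    rw [map_one]
    funext i
    obtain ⟨_, h⟩ := (hker i a).1 (hN3 i (Finset.mem_univ i) ha)
    exact h
  have h1 : a = 1 := congrArg Subtype.val this
  exact hac (fun x => by rw [h1]; simp)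

end
end FbF


set_option linter.unusedSectionVars false
namespace FbF
open TensorProduct

theorem ss_tensor (k E D : Type) [Field k] [CharZero k] [Field E] [Algebra k E] [DivisionRing D] [Algebra k D]
    [FiniteDimensional k D] : IsSemisimpleRing (E ⊗[k] D) := by
  classical
  set tr : D →ₗ[k] k := (LinearMap.trace k D).comp (Algebra.lmul k D).toLinearMap with htr
  have trc : ∀ x y, tr (x * y) = tr (y * x) := by
    intro x y
    simp only [htr, LinearMap.comp_apply, AlgHom.toLinearMap_apply, map_mul]
    exact LinearMap.trace_mul_comm k _ _
  have tr1 : tr 1 ≠ 0 := by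
    simp only [htr, LinearMap.comp_apply, AlgHom.toLinearMap_apply, map_one, LinearMap.trace_one]
    exact_mod_cast (Module.finrank_pos (R := k) (M := D)).ne'
  let B : LinearMap.BilinForm k D := (LinearMap.mul k D).compr₂ tr
  have hB : ∀ x y, B x y = tr (x * y) := fun x y => rfl
  have hBs : B.IsSymm := ⟨fun x y => by rw [hB, hB]; exact trc x y⟩
  have hBn : B.Nondegenerate := by
    refine (LinearMap.BilinForm.IsSymm.isRefl hBs).nondegenerate_iff_separatingLeft.2 ?_
    intro x hx
    by_contra h0
    have := hx x⁻¹
    rw [hB, mul_inv_cancel₀ h0] at this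
    exact tr1 this
  set trA : E ⊗[k] D →ₗ[E] E := (LinearMap.trace E (E ⊗[k] D)).comp (Algebra.lmul E (E ⊗[k] D)).toLinearMap with htrA
  have hA : ∀ (e : E) (x : D), trA (e ⊗ₜ x) = e * algebraMap k E (tr x) := by
    intro e x
    have h1 : Algebra.lmul E (E ⊗[k] D) (e ⊗ₜ x) = e • (Algebra.lmul k D x).baseChange E := by
      apply LinearMap.ext
      intro y
      induction y with
      | zero => simp
      | tmul c y => simp [TensorProduct.smul_tmul']
      | add y z hy hz => rw [map_add, map_add, hy, hz]
    simp only [htrA, LinearMap.comp_apply, AlgHom.toLinearMap_apply, h1, map_smul, LinearMap.trace_baseChange, smul_eq_mul]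
    rfl
  let b := Module.finBasis k D
  let b' := B.dualBasis hBn b
  let bA := Algebra.TensorProduct.basis E b
  have hnd : ∀ x : E ⊗[k] D, (∀ y, trA (x * y) = 0) → x = 0 := by
    intro x hx
    apply bA.repr.injective
    ext j
    rw [map_zero, Finsupp.zero_apply]
    have h1 := hx (1 ⊗ₜ b' j)
    rw [← bA.sum_repr x, Finset.sum_mul, map_sum] at h1
    have h2 : ∀ i, trA (bA.repr x i • bA i * (1 ⊗ₜ b' j)) = if i = j then bA.repr x i else 0 := by
      intro i
      rw [smul_mul_assoc, map_smul]
      simp only [bA, Algebra.TensorProduct.basis_apply, Algebra.TensorProduct.tmul_mul_tmul, one_mul]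
      rw [hA, ← hB, hBs.eq, LinearMap.BilinForm.apply_dualBasis_left]
      split_ifs <;> simp
    rw [Finset.sum_congr rfl (fun i _ => h2 i)] at h1
    simpa using h1
  have : IsArtinianRing (E ⊗[k] D) := IsArtinianRing.of_finite E _
  rw [IsArtinianRing.isSemisimpleRing_iff_jacobson, eq_bot_iff]
  intro x hx
  rw [Submodule.mem_bot]
  apply hnd
  intro y
  obtain ⟨n, hn⟩ := IsArtinianRing.isNilpotent_jacobson_bot (R := E ⊗[k] D)
  have hxy : x * y ∈ Ring.jacobson (E ⊗[k] D) := Ideal.mul_mem_right _ _ hx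
  have hnil : IsNilpotent (x * y) := by
    refine ⟨n, ?_⟩
    have := Ideal.pow_mem_pow (show x * y ∈ Ideal.jacobson (⊥ : Ideal (E ⊗[k] D)) by rwa [Ideal.jacobson_bot]) n
    rw [hn] at this
    exact this
  have := (LinearMap.isNilpotent_trace_of_isNilpotent (hnil.map (Algebra.lmul E (E ⊗[k] D))))
  exact this.eq_zero

theorem rep_exists {K : Type} [Field K] [NumberField K] {D : Type} [DivisionRing D] [Algebra ℚ D] [Algebra K D]
    [FiniteDimensional K D] [FiniteDimensional ℚ D] (hD : ¬ ∀ x y : D, x * y = y * x) (σ : K →+* ℂ) (k0 : K)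
    (hk : (σ k0).im ≠ 0) : ∃ d, 2 ≤ d ∧ Nonempty (Rep (ℝ ⊗[ℚ] D) d) := by
  classical
  letI : Algebra K ℂ := σ.toAlgebra
  have h1 := ss_tensor K ℂ D
  obtain ⟨n, d, _, ⟨e⟩⟩ := IsSemisimpleRing.exists_algEquiv_pi_matrix_of_isAlgClosed ℂ (ℂ ⊗[K] D)
  have hi : ∃ i, 2 ≤ d i := by
    by_contra hcon
    push Not at hcon
    apply hD
    intro x y
    have hinj : Function.Injective (Algebra.TensorProduct.includeRight : D →ₐ[K] ℂ ⊗[K] D) :=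
      Algebra.TensorProduct.includeRight_injective (algebraMap K ℂ).injective
    apply hinj
    apply e.injective
    simp only [map_mul]
    funext i
    have : Subsingleton (Fin (d i)) := by
      have := hcon i
      exact Fin.subsingleton_iff_le_one.2 (by omega)
    simp only [Pi.mul_apply]
    ext a b
    rw [Matrix.mul_apply, Matrix.mul_apply]
    apply Finset.sum_congr rfl
    intro c _
    rw [mul_comm, Subsingleton.elim c a, Subsingleton.elim b a]
  obtain ⟨i, hi⟩ := hi
  refine ⟨d i, hi, ?_⟩
  let τ0 : ℂ ⊗[K] D →ₐ[ℂ] Mt (d i) := (Pi.evalAlgHom ℂ (fun i => Mt (d i)) i).comp e.toAlgHom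
  have hτ0 : Function.Surjective τ0 := (Function.surjective_eval i).comp e.surjective
  let ρ : D →+* Mt (d i) := τ0.toRingHom.comp (Algebra.TensorProduct.includeRight : D →ₐ[K] ℂ ⊗[K] D).toRingHom
  have hρ : ∀ x, ρ x = τ0 (1 ⊗ₜ x) := fun x => rfl
  let ρ' : D →ₐ[ℚ] Mt (d i) := ρ.toRatAlgHom
  let τ : ℝ ⊗[ℚ] D →ₐ[ℝ] Mt (d i) := Algebra.TensorProduct.lift (Algebra.ofId ℝ _) ρ' 
    (fun r x => show Commute _ _ from Algebra.commutes r (ρ' x))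
  have hτ : ∀ (r : ℝ) x, τ (r ⊗ₜ x) = r • ρ x := by
    intro r x
    rw [Algebra.smul_def]
    exact Algebra.TensorProduct.lift_tmul _ _ _ r x
  have hc : ∀ (c : ℂ) x, τ0 (c ⊗ₜ x) = c • ρ x := by
    intro c x
    rw [hρ, ← map_smul, TensorProduct.smul_tmul', smul_eq_mul, mul_one]
  have hσ : ∀ x y, ρ (algebraMap K D x * y) = σ x • ρ y := by
    intro x y
    rw [← Algebra.smul_def, hρ, TensorProduct.tmul_smul, TensorProduct.smul_tmul', ← hc]
    congr 2
    rw [Algebra.smul_def, mul_one]; rfl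
  have hsurj : Function.Surjective τ := by
    have hS : ∀ (c : ℂ) (y : D), ∃ a, τ a = c • ρ y := by
      intro c y
      refine ⟨(c.im / (σ k0).im) ⊗ₜ (algebraMap K D k0 * y) + (c.re - c.im / (σ k0).im * (σ k0).re) ⊗ₜ y, ?_⟩
      rw [map_add, hτ, hτ, hσ]
      have e1 : ∀ (r : ℝ) (M : Mt (d i)), r • M = (r : ℂ) • M := fun r M => by
        ext a b; simp
      rw [e1, e1, smul_smul, ← add_smul]
      congr 1
      apply Complex.ext
      · simp
      · simp; field_simp
    intro m
    obtain ⟨x, rfl⟩ := hτ0 m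
    induction x with
    | zero => exact ⟨0, by simp⟩
    | tmul c x => rw [hc]; exact hS c x
    | add x y hx hy =>
      obtain ⟨a, ha⟩ := hx
      obtain ⟨b, hb⟩ := hy
      exact ⟨a + b, by rw [map_add, map_add, ha, hb]⟩
  have h2 := ss_tensor ℚ ℝ D
  obtain ⟨q, hq, hk⟩ := IsSemisimpleRing.ideal_eq_span_idempotent (RingHom.ker τ)
  have hfq : τ q = 0 := by
    have : q ∈ RingHom.ker τ := by rw [hk]; exact Ideal.mem_span_singleton_self q
    exact this
  have hker : ∀ x, τ x = 0 → x * (1 - q) = 0 := by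
    intro x hx
    have : x ∈ RingHom.ker τ := hx
    rw [hk, Ideal.mem_span_singleton'] at this
    obtain ⟨a, rfl⟩ := this
    rw [mul_assoc, mul_sub, hq.eq]; simp
  choose g hg using hsurj
  set s : Mt (d i) → ℝ ⊗[ℚ] D := fun b => g b * (1 - q) with hs
  have hsf : ∀ x b, τ x = b → s b = x * (1 - q) := by
    intro x b hx
    have := hker (g b - x) (by rw [map_sub, hg, hx, sub_self])
    rw [sub_mul, sub_eq_zero] at this
    exact this
  have hqs : ∀ b, q * s b = 0 := by
    intro b
    have := hker (q * g b) (by rw [map_mul, hfq, zero_mul])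
    rw [hs]; simp only; rw [← mul_assoc]; exact this
  have hsq : ∀ b, s b * q = 0 := by
    intro b
    rw [hs]; simp only; rw [mul_assoc, sub_mul, hq.eq]; simp
  have hs1 : s 1 = 1 - q := by rw [hsf 1 1 (map_one τ), one_mul]
  have hadd : ∀ u v, s (u + v) = s u + s v := by
    intro u v
    rw [hsf (g u + g v) (u + v) (by rw [map_add, hg, hg]), add_mul]
  have hsm : ∀ (c : ℝ) v, s (c • v) = c • s v := by
    intro c v
    rw [hsf (c • g v) (c • v) (by rw [map_smul, hg]), smul_mul_assoc]
  have hmul : ∀ u v, s (u * v) = s u * s v := by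
    intro u v
    rw [hsf (g u * g v) (u * v) (by rw [map_mul, hg, hg])]
    have := hqs v
    have h2 : s v = s v - q * s v := by rw [this, sub_zero]
    calc g u * g v * (1 - q) = g u * s v := by rw [hs]; simp only; rw [mul_assoc]
      _ = g u * (s v - q * s v) := by rw [← h2]
      _ = s u * s v := by rw [hs]; noncomm_ring
  have hfs : ∀ b, τ (s b) = b := by
    intro b
    rw [hs]; simp [hg, hfq]
  exact ⟨{ τ := τ, s := ⟨⟨s, hadd⟩, hsm⟩, f0 := q, s_mul := hmul, f0_mul := hqs, mul_f0 := hsq, f0_idem := hq.eq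
           f0_add := by change q + s 1 = 1; rw [hs1]; abel
           τ_s := hfs }⟩

end FbF


set_option linter.unusedSectionVars false
namespace FbF
open TensorProduct

theorem order_exists (D : Type) [DivisionRing D] [Algebra ℚ D] [FiniteDimensional ℚ D] :
    ∃ O : Subring D, O.toAddSubgroup.FG ∧ ∃ (m : ℕ) (b : Module.Basis (Fin m) ℚ D),
      ∀ x, x ∈ O ↔ ∀ i, ∃ z : ℤ, b.repr x i = z := by
  classical
  let b := Module.finBasis ℚ D
  obtain ⟨N, hN⟩ := IsLocalization.exist_integer_multiples_of_finite (nonZeroDivisors ℤ)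
    (fun t : Fin (Module.finrank ℚ D) × Fin (Module.finrank ℚ D) × Fin (Module.finrank ℚ D) =>
      b.repr (b t.1 * b t.2.1) t.2.2)
  set c : ℤ := N.1 with hc
  have hc0 : c ≠ 0 := nonZeroDivisors.ne_zero N.2
  let S : Set D := {1} ∪ Set.range (fun i => c • b i)
  have hSf : S.Finite := (Set.finite_singleton _).union (Set.finite_range _)
  let M : Submodule ℤ D := Submodule.span ℤ S
  have h1 : (1 : D) ∈ M := Submodule.subset_span (Or.inl rfl)
  have hb : ∀ i, c • b i ∈ M := fun i => Submodule.subset_span (Or.inr ⟨i, rfl⟩)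
  have hMM : M * M ≤ M := by
    rw [Submodule.span_mul_span, Submodule.span_le]
    rintro _ ⟨x, hx, y, hy, rfl⟩
    rcases hx with hx | ⟨i, rfl⟩
    · rw [Set.mem_singleton_iff] at hx
      subst hx
      simpa using Submodule.subset_span hy
    · rcases hy with hy | ⟨j, rfl⟩
      · rw [Set.mem_singleton_iff] at hy
        subst hy
        simpa using hb i
      · have h2 : ∀ k, ∃ z : ℤ, (z : ℚ) = c * b.repr (b i * b j) k := by
          intro k
          obtain ⟨z, hz⟩ := hN (i, j, k)
          refine ⟨z, ?_⟩
          simpa using hz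
        choose z hz using h2
        have h3 : (c • b i) * (c • b j) = ∑ k, z k • (c • b k) := by
          have h4 : c • (b i * b j) = ∑ k, z k • b k := by
            conv_lhs => rw [← b.sum_repr (b i * b j)]
            rw [Finset.smul_sum]
            apply Finset.sum_congr rfl
            intro k _
            rw [← Int.cast_smul_eq_zsmul ℚ c, ← Int.cast_smul_eq_zsmul ℚ (z k), smul_smul, hz]
          rw [smul_mul_assoc, mul_smul_comm, h4, Finset.smul_sum]
          apply Finset.sum_congr rfl
          intro k _
          rw [smul_comm]
        change (c • b i) * (c • b j) ∈ M
        rw [h3]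
        exact M.sum_mem fun k _ => M.smul_mem _ (hb k)
  let O : Subring D :=
    { carrier := M
      mul_mem' := fun {x y} hx hy => hMM (Submodule.mul_mem_mul hx hy)
      one_mem' := h1
      add_mem' := fun {x y} hx hy => M.add_mem hx hy
      zero_mem' := M.zero_mem
      neg_mem' := fun {x} hx => M.neg_mem hx }
  have hfg : M.FG := Submodule.fg_span hSf
  refine ⟨O, ?_, ?_⟩
  · have : O.toAddSubgroup = M.toAddSubgroup := rfl
    rw [this, ← Submodule.fg_iff_addSubgroup_fg]
    exact hfg
  · have : Module.Finite ℤ M := Module.Finite.iff_fg.2 hfg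
    have : CharZero D := algebraRat.charZero D
    have : Module.IsTorsionFree ℤ M := inferInstance
    have : Module.Free ℤ M := inferInstance
    let bM := Module.finBasis ℤ M
    have hli : LinearIndependent ℚ (fun i => (bM i : D)) := by
      rw [← LinearIndependent.iff_fractionRing ℤ ℚ]
      exact bM.linearIndependent.map' M.subtype (Submodule.ker_subtype M)
    have hMs : ∀ x ∈ M, x ∈ Submodule.span ℤ (Set.range fun i => (bM i : D)) := by
      intro x hx
      have h2 : M.subtype ⟨x, hx⟩ ∈ (Submodule.span ℤ (Set.range bM)).map M.subtype := by
        rw [bM.span_eq]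
        exact ⟨_, trivial, rfl⟩
      rw [Submodule.map_span, ← Set.range_comp] at h2
      exact h2
    have hsp : ⊤ ≤ Submodule.span ℚ (Set.range fun i => (bM i : D)) := by
      rw [← b.span_eq, Submodule.span_le]
      rintro _ ⟨i, rfl⟩
      have h2 := Submodule.span_le_restrictScalars ℤ ℚ _ (hMs _ (hb i))
      have h3 := Submodule.smul_mem _ ((c : ℚ)⁻¹) h2
      rw [← Int.cast_smul_eq_zsmul ℚ c, smul_smul, inv_mul_cancel₀ (by exact_mod_cast hc0), one_smul] at h3
      exact h3
    refine ⟨_, Module.Basis.mk hli hsp, ?_⟩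
    intro x
    have h2 : x ∈ O ↔ x ∈ Submodule.span ℤ (Set.range (Module.Basis.mk hli hsp)) := by
      rw [Module.Basis.coe_mk]
      constructor
      · exact fun hx => hMs x hx
      · intro hx
        change x ∈ M
        refine (Submodule.span_le.2 ?_) hx
        rintro _ ⟨i, rfl⟩
        exact (bM i).2
    rw [h2, Module.Basis.mem_span_iff_repr_mem]
    simp only [Set.mem_range, eq_intCast, eq_comm]

theorem div_case {K : Type} [Field K] [NumberField K] {D : Type} [DivisionRing D] [Algebra ℚ D] [Algebra K D]
    [FiniteDimensional K D] [FiniteDimensional ℚ D] (hD : ¬ ∀ x y : D, x * y = y * x) (σ : K →+* ℂ) (k0 : K)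
    (hk : (σ k0).im ≠ 0) (Γ : Subgroup Dˣ) (hE : Emb Γ)
    (hΓ : ∀ O : Subring D, O.toAddSubgroup.FG → ∃ n : ℕ, 1 ≤ n ∧ Γ.relIndex (Gn O n) ≠ 0) : False := by
  classical
  obtain ⟨d, hd, ⟨r⟩⟩ := rep_exists hD σ k0 hk
  obtain ⟨O, hO, m, b, hb⟩ := order_exists D
  obtain ⟨n, hn, hrel⟩ := hΓ O hO
  let β : Module.Basis (Fin m) ℝ (ℝ ⊗[ℚ] D) := Algebra.TensorProduct.basis ℝ b
  let Λ : Subring (ℝ ⊗[ℚ] D) := O.map (jj D : D →+* ℝ ⊗[ℚ] D)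
  have hjinj0 : Function.Injective (jj D) :=
    Algebra.TensorProduct.includeRight_injective (R := ℚ) (A := ℝ) (B := D) (algebraMap ℚ ℝ).injective
  have hjinj : Function.Injective (Units.map (jj D : D →* ℝ ⊗[ℚ] D)) := Units.map_injective hjinj0
  have hrepr : ∀ y i, β.repr (jj D y) i = (b.repr y i : ℝ) := by
    intro y i
    have := Algebra.TensorProduct.basis_repr_tmul b (1 : ℝ) y
    simp [β, jj]
  have hΛ : ∀ x, x ∈ Λ ↔ ∀ i, ∃ m : ℤ, β.repr x i = m := by
    intro x
    constructor
    · rintro ⟨y, hy, rfl⟩ i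
      obtain ⟨z, hz⟩ := (hb y).1 hy i
      refine ⟨z, ?_⟩
      change β.repr (jj D y) i = _
      rw [hrepr, hz]; simp
    · intro h
      choose z hz using h
      refine ⟨∑ i, z i • b i, ?_, ?_⟩
      · refine O.sum_mem fun i _ => O.zsmul_mem ?_ _
        rw [hb]
        intro k
        rw [b.repr_self, Finsupp.single_apply]
        split_ifs
        · exact ⟨1, by simp⟩
        · exact ⟨0, by simp⟩
      · rw [← β.sum_repr x, map_sum]
        apply Finset.sum_congr rfl
        intro i _
        rw [hz, map_zsmul, Int.cast_smul_eq_zsmul]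
        simp [β, jj]
  have hjn : ∀ y, jj D (1 + n * y) = 1 + n * jj D y := by
    intro y
    rw [map_add, map_mul, map_natCast, map_one]
  have hGn : Gn Λ n = (Gn O n).map (Units.map (jj D : D →* ℝ ⊗[ℚ] D)) := by
    ext u
    constructor
    · rintro ⟨⟨_, ⟨y, hy, rfl⟩, h1⟩, ⟨_, ⟨y', hy', rfl⟩, h2⟩⟩
      have h1' : (u : ℝ ⊗[ℚ] D) = jj D (1 + n * y) := by rw [h1, hjn]; rfl
      have h2' : ((u⁻¹ : (ℝ ⊗[ℚ] D)ˣ) : ℝ ⊗[ℚ] D) = jj D (1 + n * y') := by rw [h2, hjn]; rfl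
      refine ⟨⟨1 + n * y, 1 + n * y', ?_, ?_⟩, ⟨⟨y, hy, rfl⟩, ⟨y', hy', rfl⟩⟩, ?_⟩
      · apply hjinj0
        rw [map_mul, ← h1', ← h2', map_one]; simp only [Units.mul_inv, Units.inv_mul]
      · apply hjinj0
        rw [map_mul, ← h1', ← h2', map_one]; simp only [Units.mul_inv, Units.inv_mul]
      · apply Units.ext
        exact h1'.symm
    · rintro ⟨v, ⟨⟨y, hy, h1⟩, ⟨y', hy', h2⟩⟩, rfl⟩
      refine ⟨⟨jj D y, ⟨y, hy, rfl⟩, ?_⟩, ⟨jj D y', ⟨y', hy', rfl⟩, ?_⟩⟩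
      · change jj D v = _
        rw [h1, hjn]
      · change jj D (v⁻¹ : Dˣ) = _
        rw [h2, hjn]
  have hne : Nonempty (Fin m) := b.index_nonempty
  obtain ⟨C, hC⟩ := cocompact' β Λ hΛ (by
    rintro _ ⟨y, hy, rfl⟩ h0
    have hy0 : y ≠ 0 := by rintro rfl; exact h0 (map_zero _)
    exact (IsUnit.mk0 y hy0).map (jj D)) n hn (Γ.map (Units.map (jj D : D →* ℝ ⊗[ℚ] D))) (by
    rw [hGn, Subgroup.relIndex_map_map_of_injective _ _ hjinj]; exact hrel)
  refine div_core β r ⟨0, by omega⟩ ⟨1, by omega⟩ (by simp) (Γ ⊓ Gn O n)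
    (hE.of_inj (Subgroup.inclusion inf_le_left) (Subgroup.inclusion_injective _)) Λ hΛ ?_ C ?_
  · rintro δ ⟨_, ⟨⟨y, hy, h1⟩, _⟩⟩
    rw [h1]
    exact ⟨1 + n * y, O.add_mem O.one_mem (O.mul_mem (natCast_mem O n) hy), rfl⟩
  · rw [Subgroup.map_inf_eq _ _ _ hjinj, ← hGn]
    exact hC

end FbF


set_option linter.unusedSectionVars false
namespace FbF

theorem two_le_of_nonreal (K : Type) [Field K] [NumberField K] (σ : K →+* ℂ) (k0 : K) (hk : (σ k0).im ≠ 0) :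
    2 ≤ Module.finrank ℚ K ∧ (Module.finrank ℚ K = 2 → IsEmpty (K →+* ℝ)) := by
  classical
  have hne : σ ≠ (starRingEnd ℂ).comp σ := by
    intro h
    have h1 := congrArg Complex.im (RingHom.congr_fun h k0)
    simp only [RingHom.comp_apply, Complex.conj_im] at h1
    exact hk (by linarith)
  rw [← NumberField.Embeddings.card K ℂ]
  constructor
  · have h2 := Finset.card_le_univ ({σ, (starRingEnd ℂ).comp σ} : Finset (K →+* ℂ))
    rwa [Finset.card_pair hne] at h2
  · intro h2
    refine ⟨fun φ => ?_⟩
    set ψ : K →+* ℂ := Complex.ofRealHom.comp φ with hψ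
    have hψ0 : (ψ k0).im = 0 := by simp [hψ]
    have h3 : ψ ≠ σ := by
      intro h; rw [h] at hψ0; exact hk hψ0
    have h4 : ψ ≠ (starRingEnd ℂ).comp σ := by
      intro h
      rw [h, RingHom.comp_apply, Complex.conj_im] at hψ0
      exact hk (by linarith)
    have h5 := Finset.card_le_univ ({ψ, σ, (starRingEnd ℂ).comp σ} : Finset (K →+* ℂ))
    rw [Finset.card_insert_of_notMem (by simp [h3, h4]), Finset.card_pair hne] at h5
    omega

theorem big_subfield {K : Type} [Field K] [NumberField K] {D : Type} [DivisionRing D] [Algebra K D]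
    [FiniteDimensional K D] (h2 : 2 ≤ Module.finrank ℚ K) (hD : ¬ ∀ x y : D, x * y = y * x) :
    ∃ (L : Type) (_ : Field L) (_ : NumberField L) (_ : L →+* D), 3 ≤ Module.finrank ℚ L := by
  push Not at hD
  obtain ⟨a, y, hay⟩ := hD
  have hinteg : IsIntegral K a := Algebra.IsIntegral.isIntegral a
  have hirr : Irreducible (minpoly K a) := minpoly.irreducible hinteg
  haveI : Fact (Irreducible (minpoly K a)) := ⟨hirr⟩
  let pb := AdjoinRoot.powerBasis hirr.ne_zero
  have hfin : Module.Finite K (AdjoinRoot (minpoly K a)) := pb.finite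
  have hrank : Module.finrank K (AdjoinRoot (minpoly K a)) = (minpoly K a).natDegree := by
    rw [pb.finrank]; rfl
  have hNF : NumberField (AdjoinRoot (minpoly K a)) := NumberField.of_module_finite K _
  refine ⟨AdjoinRoot (minpoly K a), inferInstance, hNF,
    Ideal.Quotient.lift _ (Polynomial.aeval a : Polynomial K →ₐ[K] D).toRingHom ?_, ?_⟩
  · intro p hp
    rw [Ideal.mem_span_singleton] at hp
    obtain ⟨q, rfl⟩ := hp
    simp
  · have h3 := Module.finrank_mul_finrank ℚ K (AdjoinRoot (minpoly K a))
    have h4 : 2 ≤ (minpoly K a).natDegree := by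
      have h5 : (minpoly K a).natDegree ≠ 1 := by
        intro h
        rw [minpoly.natDegree_eq_one_iff] at h
        obtain ⟨k, rfl⟩ := h
        exact hay (Algebra.commutes k y)
      have h6 := minpoly.natDegree_pos hinteg
      omega
    rw [hrank] at h3
    have : 2 * 2 ≤ Module.finrank ℚ K * (minpoly K a).natDegree := Nat.mul_le_mul h2 h4
    have h7 : Module.finrank ℚ K * (minpoly K a).natDegree = Module.finrank ℚ (AdjoinRoot (minpoly K a)) := h3
    omega

theorem quot_case (K : Type) [Field K] [NumberField K] (R : Subring K) (hR : IsOrderIn R)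
    (G : Type) [Group G] [Finite G]
    (h : IsVirtuallyDirectProductOfFreeByFree (MonoidAlgebra ↥R G)ˣ) (σ : K →+* ℂ) (k0 : K) (hk : (σ k0).im ≠ 0)
    (B : Type) [Ring B] [IsSimpleRing B] (hB : ¬∀ u v : B, u * v = v * u)
    (f : MonoidAlgebra K G →+* B) (hf : Function.Surjective f) :
    Module.finrank ℚ K = 2 ∧ ∃ (F : Type) (_ : Field F), Nonempty (B ≃+* Matrix (Fin 2) (Fin 2) F) := by
  classical
  letI : Algebra K B := (f.comp (algebraMap K (MonoidAlgebra K G))).toAlgebra' (by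
    intro c x
    obtain ⟨y, rfl⟩ := hf x
    rw [RingHom.comp_apply, ← map_mul, ← map_mul, Algebra.commutes])
  let fA : MonoidAlgebra K G →ₐ[K] B := { f with commutes' := fun c => rfl }
  have hKG : Module.Finite K (MonoidAlgebra K G) := Module.Finite.of_basis (MonoidAlgebra.basis G K)
  have hfin : Module.Finite K B := Module.Finite.of_surjective fA.toLinearMap hf
  have hart : IsArtinianRing B := IsArtinianRing.of_finite K B
  obtain ⟨n, hn, D, instD, instA, instF, ⟨e⟩⟩ := IsSimpleRing.exists_algEquiv_matrix_divisionRing_finite K B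
  have hcz : CharZero D := charZero_of_injective_algebraMap (algebraMap K D).injective
  have hQ : FiniteDimensional ℚ D := Module.Finite.trans K D
  obtain ⟨h2, _⟩ := two_le_of_nonreal K σ k0 hk
  have hn1 : n ≠ 1 := by
    rintro rfl
    let e1 : B ≃+* D := e.toRingEquiv.trans Matrix.uniqueRingEquiv
    obtain ⟨Γ, hE, hΓ⟩ := interface K R hR G h ((e1 : B →+* D).comp f) (e1.surjective.comp hf)
    refine div_case (K := K) (D := D) ?_ σ k0 hk Γ hE hΓ
    intro hc
    apply hB
    intro u v
    apply e1.injective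
    rw [map_mul, map_mul, hc]
  obtain ⟨Γ, hE, hΓ⟩ := interface K R hR G h ((e.toRingEquiv : B →+* Matrix (Fin n) (Fin n) D).comp f)
    (e.toRingEquiv.surjective.comp hf)
  obtain ⟨h3, h4⟩ := matrix_case (algebraMap K D) Γ hE hΓ
  have hn0 : n ≠ 0 := hn.out
  have hn2 : n = 2 := by omega
  subst hn2
  have hDc : ∀ x y : D, x * y = y * x := by
    by_contra hD
    obtain ⟨L, _, _, j, hL⟩ := big_subfield h2 hD
    exact (matrix_case j Γ hE hΓ).2 ⟨le_rfl, hL⟩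
  refine ⟨by omega, D, { instD with mul_comm := hDc }, ⟨?_⟩⟩
  exact e.toRingEquiv

end FbF

theorem group_ring_units_free_by_free_implies_totally_real_or_split
    (K : Type) [Field K] [NumberField K] (R : Subring K) (hR : IsOrderIn R)
    (G : Type) [Group G] [Finite G] (hG : ¬∀ a b : G, a * b = b * a)
    (h : IsVirtuallyDirectProductOfFreeByFree (MonoidAlgebra ↥R G)ˣ) :
    (∀ σ : K →+* ℂ, ∀ x : K, (σ x).im = 0) ∨
    ((Module.finrank ℚ K = 2 ∧ IsEmpty (K →+* ℝ)) ∧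
      ∀ (B : Type) [Ring B], IsSimpleRing B → (¬∀ u v : B, u * v = v * u) →
        (∃ f : MonoidAlgebra K G →+* B, Function.Surjective f) →
        ∃ (F : Type) (_ : Field F), Nonempty (B ≃+* Matrix (Fin 2) (Fin 2) F)) := by
  classical
  by_cases hreal : ∀ σ : K →+* ℂ, ∀ x : K, (σ x).im = 0
  · exact Or.inl hreal
  right
  push Not at hreal
  obtain ⟨σ, k0, hk⟩ := hreal
  have hdeg : Module.finrank ℚ K = 2 := by
    have : NeZero (Nat.card G : K) := ⟨by
      have : Nat.card G ≠ 0 := Nat.card_pos.ne'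
      exact_mod_cast this⟩
    have : IsSemisimpleRing (MonoidAlgebra K G) := inferInstance
    obtain ⟨n, D, d, _, hd, ⟨e⟩⟩ := IsSemisimpleRing.exists_ringEquiv_pi_matrix_divisionRing (MonoidAlgebra K G)
    have hi : ∃ i, ¬ ∀ u v : Matrix (Fin (d i)) (Fin (d i)) (D i), u * v = v * u := by
      by_contra hcon
      push Not at hcon
      apply hG
      intro a b
      have h1 : MonoidAlgebra.of K G (a * b) = MonoidAlgebra.of K G (b * a) := by
        rw [map_mul, map_mul]
        apply e.injective
        rw [map_mul, map_mul]
        funext i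
        exact hcon i _ _
      exact MonoidAlgebra.of_injective h1
    obtain ⟨i, hi⟩ := hi
    have := hd i
    exact (FbF.quot_case K R hR G h σ k0 hk _ hi 
      ((Pi.evalRingHom (fun i => Matrix (Fin (d i)) (Fin (d i)) (D i)) i).comp e.toRingHom)
      ((Function.surjective_eval i).comp e.surjective)).1
  refine ⟨⟨hdeg, (FbF.two_le_of_nonreal K σ k0 hk).2 hdeg⟩, ?_⟩
  intro B _ hB hnc ⟨f, hf⟩
  exact (FbF.quot_case K R hR G h σ k0 hk B hnc f hf).2
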